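/- Let b : [0,T] × T^d → R^d be a Borel, divergence-free vector field with b ∈ L^1_loc([0,T); BV(T^d;R^d)) and ∫_0^T ∫_{T^d} |b(t,x)| dx dt < ∞. Then there exists a unique Borel probability measure η on Γ_T such that (i) η is concentrated on integral curves of b, and (ii) (e_t)_#η = L^d for every t ∈ [0,T]. Furthermore, there exists a Borel family {γ_y}_{y∈T^d} of paths in Γ_T such that for every disintegration {η_{0,y}}_{y∈T^d} of η with respect to e_0 and L^d, one has η_{0,y} = δ_{γ_y} for L^d-a.e. y ∈ T^d. -/

import Mathlib

open MeasureTheory Set Filter Topology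
open scoped ENNReal

noncomputable section

/-- The `d`-dimensional flat torus `ℝ^d/ℤ^d`. -/
abbrev Torus (d : ℕ) : Type := Fin d → AddCircle (1 : ℝ)

/-- Values of vector fields: `ℝ^d` with the Euclidean norm. -/
abbrev Vec (d : ℕ) : Type := EuclideanSpace ℝ (Fin d)

/-- The canonical projection `ℝ^d → 𝕋^d`. -/
def projT (d : ℕ) (x : Vec d) : Torus d := fun i => (x i : AddCircle (1 : ℝ))

/-- The path space `Γ_T = C([0,T]; 𝕋^d)` with the supremum metric. -/
abbrev PathSpace (T : ℝ) (d : ℕ) : Type := C(Set.Icc (0 : ℝ) T, Torus d)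

instance (T : ℝ) (d : ℕ) : MeasurableSpace (PathSpace T d) := borel _
instance (T : ℝ) (d : ℕ) : BorelSpace (PathSpace T d) := ⟨rfl⟩

/-- Extension of a path `γ : [0,T] → 𝕋^d` to all of `ℝ` by projection onto `[0,T]`. -/
def extendPath {T : ℝ} {d : ℕ} (hT : 0 ≤ T) (γ : PathSpace T d) : ℝ → Torus d :=
  fun s => γ (Set.projIcc 0 T hT s)

/-- `γ` is an integral curve of `b`:  `s ↦ b(s,γ(s))` is integrable on `(0,T)` and
`γ(t) = γ(0) + ∫_0^t b(s,γ(s)) ds` for all `t ∈ [0,T]`, the integral computed in `ℝ^d`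
and projected to the torus. -/
def IsIntegralCurveOf {T : ℝ} {d : ℕ} (hT : 0 ≤ T) (b : ℝ → Torus d → Vec d)
    (γ : PathSpace T d) : Prop :=
  MeasureTheory.IntegrableOn (fun s => b s (extendPath hT γ s)) (Set.Ioc 0 T) volume ∧
  ∀ t : Set.Icc (0 : ℝ) T,
    γ t = γ ⟨0, Set.left_mem_Icc.2 hT⟩
      + projT d (∫ s in Set.Ioc (0 : ℝ) (t : ℝ), b s (extendPath hT γ s))

/-- `η` is concentrated on integral curves of `b`. -/
def ConcentratedOnCurves {T : ℝ} {d : ℕ} (hT : 0 ≤ T) (b : ℝ → Torus d → Vec d)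
    (η : Measure (PathSpace T d)) : Prop :=
  ∀ᵐ γ ∂η, IsIntegralCurveOf hT b γ

/-- `{k y}_{y}` is a disintegration of `μ` with respect to `f` and `ν`:
a Borel family of measures, with `k y` concentrated on `f⁻¹(y)` and
`μ(A) = ∫ k y (A) dν(y)` for every Borel set `A`. -/
def IsDisintegration {X Y : Type*} [MeasurableSpace X] [MeasurableSpace Y]
    (μ : Measure X) (f : X → Y) (ν : Measure Y) (k : Y → Measure X) : Prop :=
  (∀ A : Set X, MeasurableSet A → Measurable fun y => k y A) ∧
  (∀ y : Y, k y ((f ⁻¹' {y})ᶜ) = 0) ∧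
  (∀ A : Set X, MeasurableSet A → μ A = ∫⁻ y, k y A ∂ν)

/-- A disintegration consisting of probability measures. -/
def IsProbDisintegration {X Y : Type*} [MeasurableSpace X] [MeasurableSpace Y]
    (μ : Measure X) (f : X → Y) (ν : Measure Y) (k : Y → Measure X) : Prop :=
  (∀ y : Y, IsProbabilityMeasure (k y)) ∧ IsDisintegration μ f ν k

/-- The fundamental domain `[0,1)^d ⊂ ℝ^d` of the torus. -/
def unitCube (d : ℕ) : Set (Vec d) := {x | ∀ i, x i ∈ Set.Ico (0 : ℝ) 1}

/-- `b` is divergence-free: for a.e. `t ∈ (0,T)`, `∫_{𝕋^d} b(t,·)·∇φ = 0` for every smooth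
`ℤ^d`-periodic test function `φ` (the torus integral written over the fundamental domain). -/
def DivergenceFree (T : ℝ) (d : ℕ) (b : ℝ → Torus d → Vec d) : Prop :=
  ∀ᵐ t ∂(volume.restrict (Set.Ioo 0 T)),
    ∀ φ : Vec d → ℝ, ContDiff ℝ (⊤ : ℕ∞) φ →
      (∀ x y : Vec d, projT d x = projT d y → φ x = φ y) →
      ∫ x in unitCube d, ∑ i, b t (projT d x) i * fderiv ℝ φ x (EuclideanSpace.single i 1) = 0

/-- `u : 𝕋^d → ℝ^d` is of bounded variation with derivative the matrix of finite signed
measures `Dp i j - Dm i j`: for all `i, j` and every smooth periodic test function `φ`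
(with `φb` its descent to the torus), `∫_{𝕋^d} u_j ∂_iφ = -∫_{𝕋^d} φb d(D_i u_j)`. -/
def HasBVStructure (d : ℕ) (u : Torus d → Vec d)
    (Dp Dm : Fin d → Fin d → Measure (Torus d)) : Prop :=
  (∀ i j, Dp i j Set.univ < ∞ ∧ Dm i j Set.univ < ∞) ∧
  ∀ (i j : Fin d) (φ : Vec d → ℝ) (φb : Torus d → ℝ),
    ContDiff ℝ (⊤ : ℕ∞) φ → (∀ x, φb (projT d x) = φ x) →
    ∫ x in unitCube d, u (projT d x) j * fderiv ℝ φ x (EuclideanSpace.single i 1)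
      = -((∫ y, φb y ∂(Dp i j)) - ∫ y, φb y ∂(Dm i j))

/-- `b ∈ L¹_loc((0,T]; BV(𝕋^d;ℝ^d))`: for a.e. `t ∈ (0,T]`, `b(t,·) ∈ BV`, and for every
`τ ∈ (0,T)` the total variations are integrable on `(τ,T]`. -/
def MemL1locBVIoc (T : ℝ) (d : ℕ) (b : ℝ → Torus d → Vec d) : Prop :=
  ∃ Dp Dm : ℝ → Fin d → Fin d → Measure (Torus d),
    (∀ᵐ t ∂(volume.restrict (Set.Ioc 0 T)), HasBVStructure d (b t) (Dp t) (Dm t)) ∧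
    ∀ τ ∈ Set.Ioo 0 T,
      ∫⁻ t in Set.Ioc τ T, (∑ i, ∑ j, (Dp t i j Set.univ + Dm t i j Set.univ)) < ∞

/-- `b ∈ L¹_loc([0,T); BV(𝕋^d;ℝ^d))`: for a.e. `t ∈ [0,T)`, `b(t,·) ∈ BV`, and for every
`τ ∈ (0,T)` the total variations are integrable on `[0,T-τ)`. -/
def MemL1locBVIco (T : ℝ) (d : ℕ) (b : ℝ → Torus d → Vec d) : Prop :=
  ∃ Dp Dm : ℝ → Fin d → Fin d → Measure (Torus d),
    (∀ᵐ t ∂(volume.restrict (Set.Ico 0 T)), HasBVStructure d (b t) (Dp t) (Dm t)) ∧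
    ∀ τ ∈ Set.Ioo 0 T,
      ∫⁻ t in Set.Ico 0 (T - τ), (∑ i, ∑ j, (Dp t i j Set.univ + Dm t i j Set.univ)) < ∞

/-- `b ∈ L^q((0,T); L^p(𝕋^d;ℝ^d))`. -/
def MemLqLp (T : ℝ) (d : ℕ) (p q : ℝ≥0∞) (b : ℝ → Torus d → Vec d) : Prop :=
  (q ≠ ∞ → ∫⁻ t in Set.Ioo 0 T,
      (eLpNorm (b t) p (volume : Measure (Torus d))) ^ q.toReal < ∞) ∧
  (q = ∞ → essSup (fun t => eLpNorm (b t) p (volume : Measure (Torus d)))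
      (volume.restrict (Set.Ioo 0 T)) < ∞)

noncomputable section

/-- projection from the pi type -/
def pr {d : ℕ} (x : Fin d → ℝ) : Torus d := fun i => (x i : AddCircle (1 : ℝ))

/-- representative in `(-1/2,1/2]` -/
def lf {d : ℕ} (w : Torus d) : Fin d → ℝ := fun i => (AddCircle.equivIoc (1:ℝ) (-1/2) (w i) : ℝ)

lemma projT_eq (d : ℕ) (x : Vec d) : projT d x = pr x.ofLp := rfl

lemma pr_add {d : ℕ} (x y : Fin d → ℝ) : pr (x + y) = pr x + pr y := by
  ext i; simp [pr]

lemma pr_sub {d : ℕ} (x y : Fin d → ℝ) : pr (x - y) = pr x - pr y := by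
  ext i; simp [pr]

lemma pr_zero {d : ℕ} : pr (0 : Fin d → ℝ) = 0 := by
  ext i; simp [pr]

lemma continuous_pr {d : ℕ} : Continuous (pr : (Fin d → ℝ) → Torus d) :=
  continuous_pi fun i => (AddCircle.continuous_mk' 1).comp (continuous_apply i)

lemma measurable_pr {d : ℕ} : Measurable (pr : (Fin d → ℝ) → Torus d) := continuous_pr.measurable

lemma pr_lf {d : ℕ} (w : Torus d) : pr (lf w) = w := by
  ext i
  exact AddCircle.coe_equivIoc (p := (1:ℝ)) (a := -1/2) 

lemma lf_mem {d : ℕ} (w : Torus d) (i : Fin d) : lf w i ∈ Ioc (-1/2 : ℝ) (1/2) := by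
  have := (AddCircle.equivIoc (1:ℝ) (-1/2) (w i)).2
  norm_num at this ⊢
  exact this

lemma lf_pr {d : ℕ} (x : Fin d → ℝ) (h : ∀ i, x i ∈ Ioc (-1/2 : ℝ) (1/2)) : lf (pr x) = x := by
  ext i
  have := h i
  have h2 : x i ∈ Ioc (-1/2:ℝ) (-1/2 + 1) := by norm_num at this ⊢; exact this
  have := AddCircle.equivIoc_coe_of_mem (p := (1:ℝ)) (a := -1/2) h2
  exact this

lemma measurable_lf {d : ℕ} : Measurable (lf : Torus d → Fin d → ℝ) := by
  refine measurable_pi_iff.2 fun i => ?_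
  have := (AddCircle.measurableEquivIoc (1:ℝ) (-1/2)).measurable
  exact (measurable_subtype_coe.comp this).comp (measurable_pi_apply i)

lemma norm_lf {d : ℕ} (w : Torus d) : ‖lf w‖ = ‖w‖ := by
  have h : ∀ i, ‖lf w i‖ = ‖w i‖ := by
    intro i
    have h1 := lf_mem w i
    conv_rhs => rw [← pr_lf w]
    have : |lf w i| ≤ |(1:ℝ)| / 2 := by
      rw [abs_one, abs_le]; constructor <;> linarith [h1.1, h1.2]
    rw [show ((pr (lf w)) i) = ((lf w i : ℝ) : AddCircle (1:ℝ)) from rfl]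
    rw [(AddCircle.norm_coe_eq_abs_iff (p := (1:ℝ)) one_ne_zero).2 (by assumption)]
    rfl
  rw [Pi.norm_def, Pi.norm_def]
  congr 2
  ext i
  simpa using h i

lemma norm_pr_le {d : ℕ} (x : Fin d → ℝ) : ‖pr x‖ ≤ ‖x‖ := by
  rw [pi_norm_le_iff_of_nonneg (norm_nonneg _)]
  intro i
  refine le_trans ?_ (norm_le_pi_norm x i)
  rw [show ((pr x) i) = ((x i : ℝ) : AddCircle (1:ℝ)) from rfl, AddCircle.norm_eq]
  have := round_le ((1:ℝ)⁻¹ * x i) 0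
  simpa using this

/-- the fundamental cube -/
def cubeC (d : ℕ) (a : ℝ) : Set (Fin d → ℝ) := Set.univ.pi fun _ => Ioc a (a+1)

lemma measurableSet_cubeC (d : ℕ) (a : ℝ) : MeasurableSet (cubeC d a) :=
  MeasurableSet.univ_pi fun _ => measurableSet_Ioc

lemma mp_pr (d : ℕ) (a : ℝ) :
    MeasurePreserving (pr : (Fin d → ℝ) → Torus d) (volume.restrict (cubeC d a)) volume := by
  rw [cubeC, volume_pi, Measure.restrict_pi_pi]
  exact measurePreserving_pi (fun _ => volume.restrict (Ioc a (a+1))) (fun _ => volume) 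
    (fun i => AddCircle.measurePreserving_mk 1 a)

lemma lintegral_torus {d : ℕ} (a : ℝ) (f : Torus d → ℝ≥0∞) (hf : Measurable f) :
    ∫⁻ w, f w = ∫⁻ x in cubeC d a, f (pr x) := by
  rw [← (mp_pr d a).map_eq, lintegral_map hf measurable_pr]

lemma integral_torus {d : ℕ} {F : Type*} [NormedAddCommGroup F] [NormedSpace ℝ F] (a : ℝ)
    (f : Torus d → F) (hf : AEStronglyMeasurable f volume) :
    ∫ w, f w = ∫ x in cubeC d a, f (pr x) := by
  have := (mp_pr d a).map_eq
  rw [← this, integral_map measurable_pr.aemeasurable]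
  rwa [this]

instance circleProb : IsProbabilityMeasure (volume : Measure (AddCircle (1:ℝ))) :=
  ⟨by rw [AddCircle.measure_univ]; simp⟩

instance torusProb (d : ℕ) : IsProbabilityMeasure (volume : Measure (Torus d)) := by
  rw [volume_pi]; infer_instance


lemma cubeC_eq_half (d : ℕ) : cubeC d (-1/2) = {x | ∀ i, x i ∈ Ioc (-1/2:ℝ) (1/2)} := by
  ext x; simp only [cubeC, mem_univ_pi, mem_ofPred_eq]
  norm_num

/-- Scaling formula. -/
lemma lintegral_scale {d : ℕ} {ε R : ℝ} (hε : 0 < ε) (hR : ε * R < 1/2)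
    (F : Torus d → (Fin d → ℝ) → ℝ≥0∞) (hF : Measurable (Function.uncurry F))
    (h0 : ∀ w z, R < ‖z‖ → F w z = 0) :
    ∫⁻ w, ENNReal.ofReal ((ε⁻¹)^d) * F w (ε⁻¹ • lf w) = ∫⁻ z, F (pr (ε • z)) z := by
  have m1 : Measurable fun w : Torus d => F w (ε⁻¹ • lf w) :=
    hF.comp (measurable_id.prodMk ((measurable_const_smul ε⁻¹).comp measurable_lf))
  rw [lintegral_torus (-1/2) _ (m1.const_mul _), 
    setLIntegral_congr_fun (measurableSet_cubeC d _) 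
      (g := fun x => ENNReal.ofReal ((ε⁻¹)^d) * F (pr x) (ε⁻¹ • x))]
  swap
  · intro x hx
    rw [cubeC_eq_half] at hx
    simp only [lf_pr x hx]
  rw [← lintegral_indicator (measurableSet_cubeC d _)]
  have e1 : ∀ x, (cubeC d (-1/2)).indicator (fun x => ENNReal.ofReal ((ε⁻¹)^d) * F (pr x) (ε⁻¹ • x)) x
      = ENNReal.ofReal ((ε⁻¹)^d) * F (pr (ε • (ε⁻¹ • x))) (ε⁻¹ • x) := by
    intro x
    rw [smul_inv_smul₀ hε.ne']
    by_cases hx : x ∈ cubeC d (-1/2)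
    · rw [indicator_of_mem hx]
    · rw [indicator_of_notMem hx, h0, mul_zero]
      by_contra hc
      push Not at hc
      apply hx
      rw [cubeC_eq_half]
      intro i
      have h1 : ‖x‖ ≤ ε * R := by
        rw [norm_smul, norm_inv, Real.norm_of_nonneg hε.le] at hc
        rwa [inv_mul_le_iff₀ hε] at hc
      have h2 := norm_le_pi_norm x i
      rw [Real.norm_eq_abs] at h2
      have := abs_le.1 (h2.trans h1)
      constructor <;> linarith [this.1, this.2]
  simp_rw [e1]
  rw [lintegral_const_mul]
  · have m2 : Measurable fun z : Fin d → ℝ => F (pr (ε • z)) z := 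
      hF.comp ((measurable_pr.comp (measurable_const_smul ε)).prodMk measurable_id)
    have h3 := Measure.map_addHaar_smul (volume : Measure (Fin d → ℝ)) (inv_ne_zero hε.ne')
    have h4 : ∫⁻ x : Fin d → ℝ, F (pr (ε • (ε⁻¹ • x))) (ε⁻¹ • x) = 
       ∫⁻ z, F (pr (ε • z)) z ∂(Measure.map (ε⁻¹ • ·) volume) := by
      rw [lintegral_map m2 (measurable_const_smul _)]
    rw [h4, h3, lintegral_smul_measure, smul_eq_mul, ← mul_assoc, ← ENNReal.ofReal_mul (by positivity)]
    rw [Module.finrank_fintype_fun_eq_card, Fintype.card_fin, abs_of_pos (by positivity), 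
      mul_inv_cancel₀ (by positivity)]
    simp
  · exact hF.comp ((measurable_pr.comp ((measurable_const_smul ε).comp
      (measurable_const_smul ε⁻¹))).prodMk (measurable_const_smul ε⁻¹))

/-- L1 continuity of translations. -/
lemma tendsto_translate {d : ℕ} {f : Torus d → ℝ} (hf : Integrable f volume) :
    Tendsto (fun w => ∫⁻ y, ‖f (y + w) - f y‖ₑ) (𝓝 0) (𝓝 0) := by
  rw [ENNReal.tendsto_nhds_zero]
  intro ε hε
  obtain ⟨δ, hδ0, hδ⟩ : ∃ δ : ℝ, 0 < δ ∧ ENNReal.ofReal δ * 3 ≤ ε := by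
    rcases eq_or_ne ε ⊤ with h | h
    · exact ⟨1, one_pos, by simp [h]⟩
    · refine ⟨ε.toReal / 3, by have := ENNReal.toReal_pos hε.ne' h; positivity, ?_⟩
      rw [← ENNReal.ofReal_ofNat 3, ← ENNReal.ofReal_mul (by positivity), div_mul_cancel₀ _ (by norm_num), 
        ENNReal.ofReal_toReal h]
  obtain ⟨g, hg, hgi⟩ := hf.exists_boundedContinuous_integral_sub_le hδ0
  have hgd : ∫⁻ y, ‖f y - g y‖ₑ ≤ ENNReal.ofReal δ := by
    have := ofReal_integral_norm_eq_lintegral_enorm (hf.sub hgi)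
    simp only [Pi.sub_apply] at this
    rw [← this]
    exact ENNReal.ofReal_le_ofReal hg
  have huc : UniformContinuous g := CompactSpace.uniformContinuous_of_continuous g.continuous
  rw [Metric.uniformContinuous_iff] at huc
  obtain ⟨r, hr, hr2⟩ := huc δ hδ0
  filter_upwards [Metric.ball_mem_nhds (0 : Torus d) hr] with w hw
  have hmeas : AEMeasurable (fun y => ‖f y - g y‖ₑ) volume := 
    (hf.sub hgi).aestronglyMeasurable.enorm
  have mp : MeasurePreserving (fun y : Torus d => y + w) volume volume := measurePreserving_add_right _ _
  calc ∫⁻ y, ‖f (y + w) - f y‖ₑ 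
      ≤ ∫⁻ y, ((‖f (y + w) - g (y+w)‖ₑ + ENNReal.ofReal δ) + ‖f y - g y‖ₑ) := by
        refine lintegral_mono fun y => ?_
        have : f (y+w) - f y = ((f (y + w) - g (y+w)) + (g (y+w) - g y)) + (-(f y - g y)) := by ring
        rw [this]
        refine (enorm_add_le _ _).trans ?_
        rw [enorm_neg]
        gcongr
        refine (enorm_add_le _ _).trans ?_
        gcongr
        have : dist (y + w) y < r := by
          rw [dist_eq_norm]; simpa using hw
        have := hr2 this
        rw [← ofReal_norm]
        refine ENNReal.ofReal_le_ofReal ?_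
        rw [← dist_eq_norm]; exact this.le
    _ = (∫⁻ y, ‖f (y + w) - g (y+w)‖ₑ) + ENNReal.ofReal δ + ∫⁻ y, ‖f y - g y‖ₑ := by
        rw [lintegral_add_right' _ hmeas, lintegral_add_right _ measurable_const]
        simp
    _ ≤ ENNReal.ofReal δ + ENNReal.ofReal δ + ENNReal.ofReal δ := by
        gcongr
        refine le_trans (le_of_eq ?_) hgd
        have hq := mp.map_eq
        conv_rhs => rw [← hq]
        rw [lintegral_map' (by rw [hq]; exact hmeas) mp.measurable.aemeasurable]
    _ = ENNReal.ofReal δ * 3 := by ring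
    _ ≤ ε := hδ
end

noncomputable section

lemma ac_of_dom {X : Type*} [PseudoMetricSpace X] {f : ℝ → X} {θ : ℝ → ℝ} {a b : ℝ} (hab : a ≤ b)
    (hθ : IntervalIntegrable θ volume a b)
    (h : ∀ s ∈ Icc a b, ∀ t ∈ Icc a b, s ≤ t → dist (f t) (f s) ≤ ∫ r in s..t, θ r) :
    AbsolutelyContinuousOnInterval f a b := by
  have hI := hθ.absolutelyContinuousOnInterval_intervalIntegral (c := a) (by simp)
  unfold AbsolutelyContinuousOnInterval at hI ⊢
  have key : ∀ s ∈ Icc a b, ∀ t ∈ Icc a b, s ≤ t → 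
      dist (f s) (f t) ≤ dist (∫ v in a..s, θ v) (∫ v in a..t, θ v) := by
    intro s hs t ht hst
    have e : (∫ v in a..t, θ v) - (∫ v in a..s, θ v) = ∫ r in s..t, θ r := by
      apply intervalIntegral.integral_interval_sub_left
      · exact hθ.mono_set (by rw [uIcc_of_le hab, uIcc_of_le ht.1]; exact Icc_subset_Icc le_rfl ht.2)
      · exact hθ.mono_set (by rw [uIcc_of_le hab, uIcc_of_le hs.1]; exact Icc_subset_Icc le_rfl hs.2)
    rw [dist_comm, dist_comm (∫ v in a..s, θ v), Real.dist_eq, e]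
    exact (h s hs t ht hst).trans (le_abs_self _)
  refine squeeze_zero' (Eventually.of_forall fun E => Finset.sum_nonneg fun _ _ => dist_nonneg) ?_ hI
  refine Eventually.filter_mono inf_le_right ?_
  rw [eventually_principal]
  rintro E ⟨hE, -⟩
  refine Finset.sum_le_sum fun i hi => ?_
  have := hE i hi
  rw [uIcc_of_le hab] at this
  rcases le_total (E.2 i).1 (E.2 i).2 with h' | h'
  · exact key _ this.1 _ this.2 h'
  · rw [dist_comm, dist_comm (∫ v in a..(E.2 i).1, θ v)]
    exact key _ this.2 _ this.1 h'

lemma ftc_chain {F : Type*} [NormedAddCommGroup F] [NormedSpace ℝ F] [CompleteSpace F]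
    {T : ℝ} {β : ℝ → F} (hβ : IntegrableOn β (Ioc 0 T)) (x0 : F)
    (G : F → ℝ) (G' : F → F →L[ℝ] ℝ) (hG : ∀ x, HasFDerivAt G (G' x) x) {C : ℝ} (hC : ∀ x, ‖G' x‖ ≤ C)
    {s t : ℝ} (hs : 0 ≤ s) (hst : s ≤ t) (ht : t ≤ T) :
    G (x0 + ∫ r in Ioc 0 t, β r) - G (x0 + ∫ r in Ioc 0 s, β r) =
      ∫ r in Ioc s t, G' (x0 + ∫ v in Ioc 0 r, β v) (β r) := by
  have hT : 0 ≤ T := hs.trans (hst.trans ht)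
  have hβi : IntervalIntegrable β volume 0 T := (intervalIntegrable_iff_integrableOn_Ioc_of_le hT).2 hβ
  have hsub : ∀ a b, 0 ≤ a → a ≤ b → b ≤ T → IntervalIntegrable β volume a b := fun a b ha hab hb =>
    hβi.mono_set (by rw [uIcc_of_le hT, uIcc_of_le hab]; exact Icc_subset_Icc ha hb)
  set X : ℝ → F := fun t => x0 + ∫ r in (0:ℝ)..t, β r with hX
  have eX : ∀ r, 0 ≤ r → x0 + ∫ v in Ioc 0 r, β v = X r := by
    intro r hr; rw [hX]; simp only; rw [intervalIntegral.integral_of_le hr]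
  have hC0 : 0 ≤ C := (norm_nonneg _).trans (hC 0)
  have hlip : ∀ x y, ‖G y - G x‖ ≤ C * ‖y - x‖ := fun x y =>
    (convex_univ).norm_image_sub_le_of_norm_hasFDerivWithin_le 
      (fun z _ => (hG z).hasFDerivWithinAt) (fun z _ => hC z) (mem_univ x) (mem_univ y)
  have hac : AbsolutelyContinuousOnInterval (fun r => G (X r)) s t := by
    refine ac_of_dom (θ := fun r => C * ‖β r‖) hst ((hsub s t hs hst ht).norm.const_mul C) ?_
    intro p hp q hq hpq
    rw [dist_eq_norm, intervalIntegral.integral_const_mul]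
    refine (hlip _ _).trans ?_
    gcongr
    have : X q - X p = ∫ r in p..q, β r := by
      simp only [hX, add_sub_add_left_eq_sub]
      apply intervalIntegral.integral_interval_sub_left
      · exact hsub _ _ le_rfl (by linarith [hq.1]) (hq.2.trans ht)
      · exact hsub _ _ le_rfl (by linarith [hp.1]) (hp.2.trans ht)
    rw [this]
    exact intervalIntegral.norm_integral_le_integral_norm hpq
  have h1 := hac.integral_deriv_eq_sub
  rw [eX t (hs.trans hst), eX s hs, ← h1, intervalIntegral.integral_of_le hst]
  have h2 := hβi.ae_hasDerivAt_integral
  refine setIntegral_congr_ae measurableSet_Ioc ?_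
  filter_upwards [h2] with r hr hrm
  rw [eX r (hs.trans hrm.1.le)]
  have h3 := hr (by rw [uIcc_of_le hT]; exact ⟨hs.trans hrm.1.le, hrm.2.trans ht⟩) 0 (by simp)
  have h4 : HasDerivAt X (β r) r := h3.const_add x0
  exact ((hG (X r)).comp_hasDerivAt r h4).deriv

/-- `C^1`-type functions on the torus. -/
def TC1 {d : ℕ} (ψ : Torus d → ℝ) : Prop :=
  Continuous ψ ∧ Differentiable ℝ (fun x => ψ (pr x)) ∧ ∃ C, ∀ x, ‖fderiv ℝ (fun x => ψ (pr x)) x‖ ≤ C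

/-- derivative of function on the torus -/
def dT {d : ℕ} (ψ : Torus d → ℝ) (w : Torus d) : (Fin d → ℝ) →L[ℝ] ℝ :=
  fderiv ℝ (fun x => ψ (pr x)) (lf w)

lemma fderiv_pr_congr {d : ℕ} (ψ : Torus d → ℝ) {x y : Fin d → ℝ} (h : pr x = pr y) :
    fderiv ℝ (fun x => ψ (pr x)) x = fderiv ℝ (fun x => ψ (pr x)) y := by
  have h0 : pr (x - y) = 0 := by rw [pr_sub, h, sub_self]
  have := fderiv_comp_add_right (𝕜 := ℝ) (f := fun x => ψ (pr x)) (x := y) (x - y)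
  rw [add_sub_cancel] at this
  rw [← this]
  congr 1
  funext z
  simp [pr_add, h0]

lemma TC1.hasFDerivAt {d : ℕ} {ψ : Torus d → ℝ} (h : TC1 ψ) (x : Fin d → ℝ) :
    HasFDerivAt (fun x => ψ (pr x)) (dT ψ (pr x)) x := by
  rw [dT, fderiv_pr_congr ψ (pr_lf (pr x))]
  exact (h.2.1 x).hasFDerivAt

lemma TC1.bound {d : ℕ} {ψ : Torus d → ℝ} (h : TC1 ψ) : ∃ C, 0 ≤ C ∧ ∀ w, ‖dT ψ w‖ ≤ C := by
  obtain ⟨C, hC⟩ := h.2.2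
  exact ⟨C, (norm_nonneg _).trans (hC 0), fun w => hC _⟩

lemma measurable_dT {d : ℕ} (ψ : Torus d → ℝ) : Measurable (dT ψ) :=
  (measurable_fderiv ℝ _).comp measurable_lf

lemma TC1.bdd {d : ℕ} {ψ : Torus d → ℝ} (h : TC1 ψ) : ∃ C, 0 ≤ C ∧ ∀ w, |ψ w| ≤ C := by
  obtain ⟨C, hC⟩ := (isCompact_range h.1).isBounded.exists_norm_le
  exact ⟨C, (norm_nonneg _).trans (hC _ (mem_range_self 0)), fun w => hC _ (mem_range_self w)⟩

lemma TC1.of_deriv {d : ℕ} {ψ : Torus d → ℝ} (hc : Continuous ψ) 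
    (D : (Fin d → ℝ) → (Fin d → ℝ) →L[ℝ] ℝ) (hD : ∀ x, HasFDerivAt (fun x => ψ (pr x)) (D x) x)
    {C : ℝ} (hC : ∀ x, ‖D x‖ ≤ C) : TC1 ψ :=
  ⟨hc, fun x => (hD x).differentiableAt, C, fun x => by rw [(hD x).fderiv]; exact hC x⟩

lemma TC1.const {d : ℕ} (c : ℝ) : TC1 (fun _ : Torus d => c) :=
  TC1.of_deriv continuous_const (fun _ => 0) (fun x => hasFDerivAt_const c x) (C := 0) (by simp)

lemma TC1.add {d : ℕ} {ψ φ : Torus d → ℝ} (h : TC1 ψ) (k : TC1 φ) : TC1 (fun w => ψ w + φ w) := by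
  obtain ⟨C, _, hC⟩ := h.bound
  obtain ⟨C', _, hC'⟩ := k.bound
  exact TC1.of_deriv (h.1.add k.1) _ (fun x => (h.hasFDerivAt x).add (k.hasFDerivAt x))
    (C := C + C') (fun x => (norm_add_le _ _).trans (add_le_add (hC _) (hC' _)))

lemma TC1.mul {d : ℕ} {ψ φ : Torus d → ℝ} (h : TC1 ψ) (k : TC1 φ) : TC1 (fun w => ψ w * φ w) := by
  obtain ⟨C, C0, hC⟩ := h.bound
  obtain ⟨C', C0', hC'⟩ := k.bound
  obtain ⟨B, B0, hB⟩ := h.bdd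
  obtain ⟨B', B0', hB'⟩ := k.bdd
  refine TC1.of_deriv (h.1.mul k.1) _ (fun x => (h.hasFDerivAt x).mul (k.hasFDerivAt x))
    (C := B * C' + B' * C) (fun x => (norm_add_le _ _).trans ?_)
  rw [norm_smul, norm_smul]
  exact add_le_add (mul_le_mul (hB _) (hC' _) (norm_nonneg _) B0) 
    (mul_le_mul (hB' _) (hC _) (norm_nonneg _) B0')

lemma hasFDerivAt_pair {d : ℕ} {ψ κ : Torus d → ℝ} (h : TC1 ψ) (k : TC1 κ) (p : (Fin d → ℝ) × (Fin d → ℝ)) :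
    HasFDerivAt (fun p : (Fin d → ℝ) × (Fin d → ℝ) => ψ (pr p.1) * κ (pr (p.1 - p.2)))
      (ψ (pr p.1) • (dT κ (pr (p.1 - p.2))).comp 
          (ContinuousLinearMap.fst ℝ _ _ - ContinuousLinearMap.snd ℝ _ _) +
        κ (pr (p.1 - p.2)) • (dT ψ (pr p.1)).comp (ContinuousLinearMap.fst ℝ _ _)) p := by
  have h1 : HasFDerivAt (fun p : (Fin d → ℝ) × (Fin d → ℝ) => ψ (pr p.1)) 
     ((dT ψ (pr p.1)).comp (ContinuousLinearMap.fst ℝ _ _)) p :=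
    (h.hasFDerivAt p.1).comp p hasFDerivAt_fst
  have h2 : HasFDerivAt (fun p : (Fin d → ℝ) × (Fin d → ℝ) => κ (pr (p.1 - p.2))) 
     ((dT κ (pr (p.1 - p.2))).comp (ContinuousLinearMap.fst ℝ _ _ - ContinuousLinearMap.snd ℝ _ _)) p :=
    HasFDerivAt.comp (g := fun x => κ (pr x)) (f := fun p : (Fin d → ℝ) × (Fin d → ℝ) => p.1 - p.2) p
      (k.hasFDerivAt (p.1-p.2)) (hasFDerivAt_fst.fun_sub hasFDerivAt_snd)
  exact h1.mul h2

/-- Evolution of pair quantities along curves. -/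
lemma pair_evolution {d : ℕ} {T : ℝ} {β β' : ℝ → Fin d → ℝ} (hβ : IntegrableOn β (Ioc 0 T))
    (hβ' : IntegrableOn β' (Ioc 0 T)) {γ γ' : ℝ → Torus d}
    (hγ : ∀ t ∈ Icc 0 T, γ t = γ 0 + pr (∫ r in Ioc 0 t, β r))
    (hγ' : ∀ t ∈ Icc 0 T, γ' t = γ' 0 + pr (∫ r in Ioc 0 t, β' r))
    {ψ κ : Torus d → ℝ} (h : TC1 ψ) (k : TC1 κ) {s t : ℝ} (hs : 0 ≤ s) (hst : s ≤ t) (ht : t ≤ T) :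
    ψ (γ t) * κ (γ t - γ' t) - ψ (γ s) * κ (γ s - γ' s) =
     ∫ r in Ioc s t, (ψ (γ r) * dT κ (γ r - γ' r) (β r - β' r) + κ (γ r - γ' r) * dT ψ (γ r) (β r)) := by
  obtain ⟨C, C0, hC⟩ := h.bound
  obtain ⟨C', C0', hC'⟩ := k.bound
  obtain ⟨B, B0, hB⟩ := h.bdd
  obtain ⟨B', B0', hB'⟩ := k.bdd
  have hp : IntegrableOn (fun r => (β r, β' r)) (Ioc 0 T) := Integrable.prodMk hβ hβ'
  have e := ftc_chain hp (lf (γ 0), lf (γ' 0)) _ _ (hasFDerivAt_pair h k) 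
    (C := B * (C' * (1 + 1)) + B' * (C * 1)) ?_ hs hst ht
  · have hpi : ∀ r ∈ Icc 0 T, (∫ v in Ioc 0 r, (β v, β' v)) = (∫ v in Ioc 0 r, β v, ∫ v in Ioc 0 r, β' v) := by
      intro r hr
      exact integral_pair (hβ.mono_set (Ioc_subset_Ioc_right hr.2)) (hβ'.mono_set (Ioc_subset_Ioc_right hr.2))
    have g1 : ∀ r ∈ Icc 0 T, pr (((lf (γ 0), lf (γ' 0)) + ∫ v in Ioc 0 r, (β v, β' v)).1) = γ r := by
      intro r hr
      rw [hpi r hr, hγ r hr, Prod.fst_add, pr_add, pr_lf]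
    have g2 : ∀ r ∈ Icc 0 T, pr (((lf (γ 0), lf (γ' 0)) + ∫ v in Ioc 0 r, (β v, β' v)).2) = γ' r := by
      intro r hr
      rw [hpi r hr, hγ' r hr, Prod.snd_add, pr_add, pr_lf]
    simp only [pr_sub] at e
    rw [g1 t ⟨hs.trans hst, ht⟩, g2 t ⟨hs.trans hst, ht⟩, g1 s ⟨hs, hst.trans ht⟩, 
      g2 s ⟨hs, hst.trans ht⟩] at e
    rw [e]
    refine setIntegral_congr_fun measurableSet_Ioc fun r hr => ?_
    have hr' : r ∈ Icc 0 T := ⟨hs.trans hr.1.le, hr.2.trans ht⟩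
    rw [g1 r hr', g2 r hr']
    simp
  · intro x
    refine (norm_add_le _ _).trans ?_
    rw [norm_smul, norm_smul]
    refine add_le_add (mul_le_mul (hB _) ?_ (norm_nonneg _) B0) (mul_le_mul (hB' _) ?_ (norm_nonneg _) B0')
    · refine (ContinuousLinearMap.opNorm_comp_le _ _).trans (mul_le_mul (hC' _) ?_ (norm_nonneg _) C0')
      exact (norm_sub_le _ _).trans (add_le_add (ContinuousLinearMap.norm_fst_le _ _ _) 
        (ContinuousLinearMap.norm_snd_le _ _ _))
    · refine (ContinuousLinearMap.opNorm_comp_le _ _).trans (mul_le_mul (hC _) ?_ (norm_nonneg _) C0)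
      exact ContinuousLinearMap.norm_fst_le _ _ _

/-- Admissible convolution kernels. -/
structure Adm {d : ℕ} (ρ : (Fin d → ℝ) → ℝ) : Prop where
  contDiff : ContDiff ℝ 1 ρ
  nonneg : ∀ z, 0 ≤ ρ z
  supp : HasCompactSupport ρ
  int : ∫⁻ z, ENNReal.ofReal (ρ z) = 1

lemma Adm.exists_R {d : ℕ} {ρ : (Fin d → ℝ) → ℝ} (h : Adm ρ) :
    ∃ R > 0, ∀ z, R ≤ ‖z‖ → ρ z = 0 ∧ fderiv ℝ ρ z = 0 := by
  obtain ⟨R, hR⟩ := h.supp.isCompact.isBounded.exists_norm_le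
  obtain ⟨R', hR'⟩ := (h.supp.fderiv ℝ).isCompact.isBounded.exists_norm_le
  refine ⟨max (max R R' + 1) 1, by positivity, fun z hz => ⟨?_, ?_⟩⟩
  · apply image_eq_zero_of_notMem_tsupport
    intro hm
    have := hR z hm
    have h2 : max R R' + 1 ≤ ‖z‖ := (le_max_left _ _).trans hz
    linarith [le_max_left R R']
  · apply image_eq_zero_of_notMem_tsupport (f := fderiv ℝ ρ)
    intro hm
    have := hR' z hm
    have h2 : max R R' + 1 ≤ ‖z‖ := (le_max_left _ _).trans hz
    linarith [le_max_right R R']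

lemma Adm.exists_C {d : ℕ} {ρ : (Fin d → ℝ) → ℝ} (h : Adm ρ) :
    ∃ C, 0 ≤ C ∧ ∀ z, ‖fderiv ℝ ρ z‖ ≤ C := by
  have hc : Continuous (fderiv ℝ ρ) := h.contDiff.continuous_fderiv one_ne_zero
  obtain ⟨C, hC⟩ := hc.bounded_above_of_compact_support (h.supp.fderiv ℝ)
  exact ⟨C, (norm_nonneg _).trans (hC 0), hC⟩

/-- rescaled periodic kernel -/
def kap {d : ℕ} (ε : ℝ) (ρ : (Fin d → ℝ) → ℝ) (w : Torus d) : ℝ := (ε⁻¹)^d * ρ (ε⁻¹ • lf w)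

lemma kap_hasFDerivAt {d : ℕ} {ρ : (Fin d → ℝ) → ℝ} (h : Adm ρ) {ε R : ℝ} (hε : 0 < ε) (hR : ε * R < 1/2)
    (h0 : ∀ z, R ≤ ‖z‖ → ρ z = 0 ∧ fderiv ℝ ρ z = 0) (x : Fin d → ℝ) :
    HasFDerivAt (fun x => kap ε ρ (pr x)) ((ε⁻¹)^(d+1) • fderiv ℝ ρ (ε⁻¹ • lf (pr x))) x := by
  by_cases hx : ε * R < ‖pr x‖
  · have hz : ∀ w : Torus d, ε * R < ‖w‖ → ρ (ε⁻¹ • lf w) = 0 ∧ fderiv ℝ ρ (ε⁻¹ • lf w) = 0 := by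
      intro w hw
      apply h0
      rw [norm_smul, norm_inv, Real.norm_of_nonneg hε.le, norm_lf, le_inv_mul_iff₀ hε]
      exact hw.le
    rw [(hz _ hx).2, smul_zero]
    refine (hasFDerivAt_const (0:ℝ) x).congr_of_eventuallyEq ?_
    have : ∀ᶠ y in 𝓝 x, ε * R < ‖pr y‖ := 
      (continuous_pr.norm.tendsto x).eventually (lt_mem_nhds hx)
    filter_upwards [this] with y hy
    simp [kap, (hz _ hy).1]
  · push Not at hx
    set v := x - lf (pr x) with hv
    have hnear : ∀ᶠ y in 𝓝 x, lf (pr y) = y - v := by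
      have hc : Tendsto (fun y => ‖y - v‖) (𝓝 x) (𝓝 ‖lf (pr x)‖) := by
        have : Continuous fun y => ‖y - v‖ := by fun_prop
        have := this.tendsto x
        rwa [hv, sub_sub_cancel] at this
      rw [norm_lf] at hc
      filter_upwards [hc.eventually (gt_mem_nhds (hx.trans_lt hR))] with y hy
      have e1 : pr y = pr (y - v) := by
        rw [pr_sub, hv, pr_sub, pr_lf, sub_self, sub_zero]
      rw [e1]
      apply lf_pr
      intro i
      have h2 := (norm_le_pi_norm (y - v) i).trans_lt hy
      rw [Real.norm_eq_abs] at h2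
      have := abs_lt.1 h2
      constructor <;> linarith [this.1, this.2]
    have hd : HasFDerivAt (fun y => (ε⁻¹)^d * ρ (ε⁻¹ • (y - v))) 
       ((ε⁻¹)^(d+1) • fderiv ℝ ρ (ε⁻¹ • lf (pr x))) x := by
      have e : ε⁻¹ • lf (pr x) = ε⁻¹ • (x - v) := by rw [hv, sub_sub_cancel]
      rw [e]
      have h1 : HasFDerivAt ρ (fderiv ℝ ρ (ε⁻¹ • (x - v))) (ε⁻¹ • (x - v)) := 
        ((h.contDiff.differentiable one_ne_zero) _).hasFDerivAt
      have h2 : HasFDerivAt (fun y => ε⁻¹ • (y - v)) (ε⁻¹ • ContinuousLinearMap.id ℝ (Fin d → ℝ)) x :=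
        ((hasFDerivAt_id x).sub_const v).fun_const_smul _
      have h3 := (h1.comp x h2).const_mul ((ε⁻¹)^d)
      refine h3.congr_fderiv ?_
      rw [ContinuousLinearMap.comp_smul, ContinuousLinearMap.comp_id, smul_smul, pow_succ]
    refine hd.congr_of_eventuallyEq ?_
    filter_upwards [hnear] with y hy
    rw [kap, hy]

lemma continuous_of_comp_pr {d : ℕ} {F : Type*} [TopologicalSpace F] {f : Torus d → F} (h : Continuous fun x => f (pr x)) :
    Continuous f := by
  have hq : IsOpenQuotientMap (pr : (Fin d → ℝ) → Torus d) := 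
    IsOpenQuotientMap.piMap (fun i : Fin d => (QuotientAddGroup.isOpenQuotientMap_mk : 
      IsOpenQuotientMap (QuotientAddGroup.mk : ℝ → AddCircle (1:ℝ))))
  exact hq.isQuotientMap.continuous_iff.2 h

lemma TC1_kap {d : ℕ} {ρ : (Fin d → ℝ) → ℝ} (h : Adm ρ) {ε R : ℝ} (hε : 0 < ε) (hR : ε * R < 1/2)
    (h0 : ∀ z, R ≤ ‖z‖ → ρ z = 0 ∧ fderiv ℝ ρ z = 0) : TC1 (kap (d := d) ε ρ) := by
  obtain ⟨C, C0, hC⟩ := h.exists_C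
  have hd := kap_hasFDerivAt h hε hR h0
  refine TC1.of_deriv (continuous_of_comp_pr ?_) _ hd (C := (ε⁻¹)^(d+1) * C) ?_
  · exact continuous_iff_continuousAt.2 fun x => (hd x).continuousAt
  · intro x
    rw [norm_smul, Real.norm_of_nonneg (by positivity)]
    gcongr
    exact hC _

lemma dT_kap {d : ℕ} {ρ : (Fin d → ℝ) → ℝ} (h : Adm ρ) {ε R : ℝ} (hε : 0 < ε) (hR : ε * R < 1/2)
    (h0 : ∀ z, R ≤ ‖z‖ → ρ z = 0 ∧ fderiv ℝ ρ z = 0) (w : Torus d) :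
    dT (kap (d := d) ε ρ) w = (ε⁻¹)^(d+1) • fderiv ℝ ρ (ε⁻¹ • lf w) := by
  have := (kap_hasFDerivAt h hε hR h0 (lf w)).fderiv
  rw [pr_lf] at this
  exact this

lemma kap_nonneg {d : ℕ} {ρ : (Fin d → ℝ) → ℝ} (h : Adm ρ) {ε : ℝ} (hε : 0 < ε) (w : Torus d) :
    0 ≤ kap ε ρ w := mul_nonneg (by positivity) (h.nonneg _)

lemma measurable_kap {d : ℕ} {ρ : (Fin d → ℝ) → ℝ} (h : Adm ρ) (ε : ℝ) : Measurable (kap (d := d) ε ρ) :=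
  (h.contDiff.continuous.measurable.comp ((measurable_const_smul ε⁻¹).comp measurable_lf)).const_mul _

lemma lintegral_kap {d : ℕ} {ρ : (Fin d → ℝ) → ℝ} (h : Adm ρ) {ε R : ℝ} (hε : 0 < ε) (hR : ε * R < 1/2)
    (h0 : ∀ z, R ≤ ‖z‖ → ρ z = 0 ∧ fderiv ℝ ρ z = 0) :
    ∫⁻ w : Torus d, ENNReal.ofReal (kap ε ρ w) = 1 := by
  rw [← h.int]
  have := lintegral_scale (d := d) hε hR (fun _ z => ENNReal.ofReal (ρ z)) 
    (h.contDiff.continuous.measurable.ennreal_ofReal.comp measurable_snd) 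
    (fun w z hz => by simp [(h0 z hz.le).1])
  rw [← this]
  refine lintegral_congr fun w => ?_
  rw [kap, ENNReal.ofReal_mul (by positivity)]
end

noncomputable section

lemma integrable_kernel_pair {d : ℕ} {h u κ : Torus d → ℝ} (hh : Integrable h volume) (hu : Measurable u)
    (hu1 : ∀ x, |u x| ≤ 1) (hκ : Measurable κ) {C : ℝ} (hC : ∀ w, |κ w| ≤ C) :
    Integrable (fun p : Torus d × Torus d => u p.1 * (h p.2 * κ (p.2 - p.1))) (volume.prod volume) := by
  have h1 : Integrable (fun p : Torus d × Torus d => h p.2) (volume.prod volume) := hh.comp_snd _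
  have h2 : Integrable (fun p : Torus d × Torus d => h p.2 * κ (p.2 - p.1)) (volume.prod volume) := 
    h1.mul_bdd (c := C) (hκ.comp (measurable_snd.sub measurable_fst)).aestronglyMeasurable 
      (Eventually.of_forall fun p => hC _)
  exact h2.bdd_mul (c := 1) (hu.comp measurable_fst).aestronglyMeasurable (Eventually.of_forall fun p => hu1 _) 

lemma mollify_bound {d : ℕ} {h u κ : Torus d → ℝ} (hh : Integrable h volume) (hu : Measurable u)
    (hu1 : ∀ x, |u x| ≤ 1) (hκ : Measurable κ) (hκ0 : ∀ w, 0 ≤ κ w) {C : ℝ} (hC : ∀ w, |κ w| ≤ C)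
    (hκ1 : ∫⁻ w, ENNReal.ofReal (κ w) = 1) :
    ‖(∫ p : Torus d × Torus d, u p.1 * (h p.2 * κ (p.2 - p.1)) ∂(volume.prod volume)) - ∫ x, u x * h x‖ₑ ≤ 
      ∫⁻ w, ENNReal.ofReal (κ w) * ∫⁻ y, ‖h (y + w) - h y‖ₑ := by
  have mp : MeasurePreserving (fun z : Torus d × Torus d => (z.1, z.1 + z.2)) (volume.prod volume) 
      (volume.prod volume) := measurePreserving_prod_add volume volume
  have hi := integrable_kernel_pair hh hu hu1 hκ hC
  have hκi : Integrable κ volume := by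
    refine ⟨hκ.aestronglyMeasurable, ?_⟩
    rw [hasFiniteIntegral_iff_ofReal (Eventually.of_forall hκ0), hκ1]
    exact ENNReal.one_lt_top
  have hκint : ∫ w, κ w = 1 := by
    rw [integral_eq_lintegral_of_nonneg_ae (Eventually.of_forall hκ0) hκ.aestronglyMeasurable, hκ1]; simp
  have huh : Integrable (fun x => u x * h x) volume := 
    hh.bdd_mul (c := 1) hu.aestronglyMeasurable (Eventually.of_forall hu1)
  have hi' : Integrable (fun z : Torus d × Torus d => u z.1 * (h (z.1 + z.2) * κ z.2)) (volume.prod volume) := by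
    have := mp.integrable_comp_of_integrable hi
    refine this.congr (Eventually.of_forall fun z => ?_)
    simp
  have e1 : (∫ p : Torus d × Torus d, u p.1 * (h p.2 * κ (p.2 - p.1)) ∂(volume.prod volume)) = 
      ∫ z : Torus d × Torus d, u z.1 * (h (z.1 + z.2) * κ z.2) ∂(volume.prod volume) := by
    conv_lhs => rw [← mp.map_eq]
    rw [integral_map mp.measurable.aemeasurable (by rw [mp.map_eq]; exact hi.aestronglyMeasurable)]
    simp
  have e2 : ∫ x, u x * h x = ∫ z : Torus d × Torus d, (u z.1 * h z.1) * κ z.2 ∂(volume.prod volume) := by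
    rw [integral_prod_mul (fun x => u x * h x) κ, hκint, mul_one]
  rw [e1, e2, ← integral_sub hi' (huh.mul_prod hκi)]
  refine (enorm_integral_le_lintegral_enorm _).trans ?_
  calc ∫⁻ z : Torus d × Torus d, ‖u z.1 * (h (z.1 + z.2) * κ z.2) - (u z.1 * h z.1) * κ z.2‖ₑ ∂(volume.prod volume)
      ≤ ∫⁻ z : Torus d × Torus d, ENNReal.ofReal (κ z.2) * ‖h (z.1 + z.2) - h z.1‖ₑ ∂(volume.prod volume) := by
        refine lintegral_mono fun z => ?_
        have : u z.1 * (h (z.1 + z.2) * κ z.2) - (u z.1 * h z.1) * κ z.2 = 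
          u z.1 * (κ z.2 * (h (z.1 + z.2) - h z.1)) := by ring
        rw [this, enorm_mul, enorm_mul, Real.enorm_of_nonneg (hκ0 _)]
        have h1 : ‖u z.1‖ₑ ≤ 1 := by
          rw [← ofReal_norm, ENNReal.ofReal_le_one]; exact hu1 _
        calc _ ≤ 1 * (ENNReal.ofReal (κ z.2) * ‖h (z.1 + z.2) - h z.1‖ₑ) := by gcongr
          _ = _ := one_mul _
    _ = ∫⁻ w, ∫⁻ y, ENNReal.ofReal (κ w) * ‖h (y + w) - h y‖ₑ := by
        rw [lintegral_prod_symm]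
        have a1 : AEStronglyMeasurable (fun z : Torus d × Torus d => h (z.1 + z.2)) (volume.prod volume) := by
          exact (hh.comp_snd _).aestronglyMeasurable.comp_measurePreserving mp
        have a2 : AEStronglyMeasurable (fun z : Torus d × Torus d => h z.1) (volume.prod volume) := 
          (hh.comp_fst _).aestronglyMeasurable
        exact ((hκ.comp measurable_snd).ennreal_ofReal.aemeasurable).mul (a1.sub a2).enorm
    _ ≤ _ := by
        refine lintegral_mono fun w => ?_
        rw [lintegral_const_mul' _ _ ENNReal.ofReal_ne_top]

lemma tendsto_eps (n0 : ℝ) : Tendsto (fun n : ℕ => (1 / ((n : ℝ) + 1)) * n0) atTop (𝓝 0) := by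
  have := (tendsto_one_div_add_atTop_nhds_zero_nat (𝕜 := ℝ)).mul_const n0
  simpa using this

/-- the scale `1/(n+1)` -/
def eps (n : ℕ) : ℝ := 1 / ((n : ℝ) + 1)
lemma eps_pos (n : ℕ) : 0 < eps n := by unfold eps; positivity
lemma tendsto_eps_mul (R : ℝ) : Tendsto (fun n : ℕ => eps n * R) atTop (𝓝 0) := tendsto_eps R

lemma mollify_tendsto {d : ℕ} {h u : Torus d → ℝ} (hh : Integrable h volume) (hu : Measurable u)
    (hu1 : ∀ x, |u x| ≤ 1) {ρ : (Fin d → ℝ) → ℝ} (hρ : Adm ρ) :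
    Tendsto (fun n : ℕ => ∫ p : Torus d × Torus d, u p.1 * (h p.2 * kap (eps n) ρ (p.2 - p.1)) ∂(volume.prod volume))
      atTop (𝓝 (∫ x, u x * h x)) := by
  obtain ⟨R, R0, hR⟩ := hρ.exists_R
  rw [tendsto_iff_edist_tendsto_0]
  simp only [edist_eq_enorm_sub]
  rw [ENNReal.tendsto_nhds_zero]
  intro δ hδ
  have ht := (ENNReal.tendsto_nhds_zero.1 (tendsto_translate hh)) δ hδ
  rw [Metric.eventually_nhds_iff] at ht
  obtain ⟨r, r0, hr⟩ := ht
  filter_upwards [(tendsto_eps_mul R).eventually (gt_mem_nhds (show (0:ℝ) < min r (1/2) by positivity))] with n hn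
  have hn1 : eps n * R < 1/2 := hn.trans_le (min_le_right _ _)
  have hn2 : eps n * R < r := hn.trans_le (min_le_left _ _)
  obtain ⟨C, _, hC⟩ := (TC1_kap hρ (eps_pos n) hn1 hR).bdd
  refine (mollify_bound hh hu hu1 (measurable_kap hρ _) (kap_nonneg hρ (eps_pos n)) hC 
    (lintegral_kap hρ (eps_pos n) hn1 hR)).trans ?_
  calc _ ≤ ∫⁻ w : Torus d, ENNReal.ofReal (kap (eps n) ρ w) * δ := by
        refine lintegral_mono fun w => ?_
        by_cases hw : ‖w‖ < r
        · gcongr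
          exact hr (by simpa using hw)
        · have : kap (eps n) ρ w = 0 := by
            rw [kap, (hR _ _).1, mul_zero]
            rw [norm_smul, norm_inv, Real.norm_of_nonneg (eps_pos n).le, norm_lf, le_inv_mul_iff₀ (eps_pos n)]
            push Not at hw; exact hn2.le.trans hw
          simp [this]
    _ = δ := by
        rw [lintegral_mul_const _ (measurable_kap hρ _).ennreal_ofReal, 
          lintegral_kap hρ (eps_pos n) hn1 hR, one_mul]

/-- Densities. -/
lemma exists_density {Ω : Type*} [MeasurableSpace Ω] {d : ℕ} (η : Measure Ω) [IsProbabilityMeasure η]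
    {e : Ω → Torus d} (he : Measurable e) (hmap : Measure.map e η = volume)
    {g : Ω → ℝ} (hg : Measurable g) (hg1 : ∀ γ, |g γ| ≤ 1) :
    ∃ u : Torus d → ℝ, Measurable u ∧ (∀ x, |u x| ≤ 1) ∧ 
      ∀ f : Torus d → ℝ, Measurable f → Integrable f volume → ∫ γ, g γ * f (e γ) ∂η = ∫ x, u x * f x := by
  set η' := η.withDensity (fun γ => ENNReal.ofReal ((1 + g γ)/2)) with hη'
  have hm : Measurable fun γ => ENNReal.ofReal ((1 + g γ)/2) := (((hg.const_add 1).div_const 2)).ennreal_ofReal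
  have hle : η' ≤ η := by
    conv_rhs => rw [← withDensity_one (μ := η)]
    refine withDensity_mono (Eventually.of_forall fun γ => ?_)
    simp only [Pi.one_apply, ENNReal.ofReal_le_one]
    have := abs_le.1 (hg1 γ); linarith [this.2]
  set ν := Measure.map e η' with hν
  have hνle : ν ≤ volume := by rw [← hmap]; exact Measure.map_mono hle he
  have : IsFiniteMeasure η' := ⟨(hle univ).trans_lt (measure_lt_top _ _)⟩
  have : IsFiniteMeasure ν := ⟨(hνle univ).trans_lt (measure_lt_top _ _)⟩
  have hac : ν ≪ volume := Measure.absolutelyContinuous_of_le hνle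
  have hr := Measure.rnDeriv_le_one_of_le hνle
  set q : Torus d → ℝ := fun x => (ν.rnDeriv volume x).toReal with hq
  have hqm : Measurable q := (Measure.measurable_rnDeriv _ _).ennreal_toReal
  have hq1 : ∀ᵐ x, q x ≤ 1 := by
    filter_upwards [hr] with x hx
    exact ENNReal.toReal_le_of_le_ofReal zero_le_one (by simpa using hx)
  refine ⟨fun x => 2 * min (q x) 1 - 1, ((hqm.min measurable_const).const_mul 2).sub_const 1, ?_, ?_⟩
  · intro x
    have h1 : 0 ≤ min (q x) 1 := le_min ENNReal.toReal_nonneg zero_le_one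
    have h2 : min (q x) 1 ≤ 1 := min_le_right _ _
    rw [abs_le]; constructor <;> linarith
  · intro f hf hfi
    have hfe : Integrable (fun γ => f (e γ)) η := by
      have : Integrable f (Measure.map e η) := by rwa [hmap]
      exact this.comp_measurable he
    have i1 : ∫ y, f y ∂ν = ∫ γ, ((1 + g γ)/2) * f (e γ) ∂η := by
      rw [hν, integral_map he.aemeasurable hf.aestronglyMeasurable, hη', 
        integral_withDensity_eq_integral_toReal_smul hm (Eventually.of_forall fun _ => ENNReal.ofReal_lt_top)]
      refine integral_congr_ae (Eventually.of_forall fun γ => ?_)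
      simp only [smul_eq_mul]
      rw [ENNReal.toReal_ofReal]
      have := abs_le.1 (hg1 γ); linarith [this.1]
    have i2 : ∫ y, f y ∂ν = ∫ x, q x * f x := by
      have := integral_rnDeriv_smul (f := f) hac
      rw [← this]; rfl
    have i3 : ∫ γ, f (e γ) ∂η = ∫ x, f x := by
      rw [← hmap, integral_map he.aemeasurable hf.aestronglyMeasurable]
    have hgf : Integrable (fun γ => g γ * f (e γ)) η := 
      hfe.bdd_mul (c := 1) hg.aestronglyMeasurable (Eventually.of_forall hg1)
    have hqf : Integrable (fun x => min (q x) 1 * f x) volume := by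
      refine hfi.bdd_mul (c := 1) (hqm.min measurable_const).aestronglyMeasurable (Eventually.of_forall fun x => ?_)
      rw [Real.norm_of_nonneg (le_min ENNReal.toReal_nonneg zero_le_one)]
      exact min_le_right _ _
    have i4 : ∫ x, q x * f x = ∫ x, min (q x) 1 * f x := by
      refine integral_congr_ae ?_
      filter_upwards [hq1] with x hx
      rw [min_eq_left hx]
    have i5 : ∫ γ, ((1 + g γ)/2) * f (e γ) ∂η = (1/2) * (∫ γ, f (e γ) ∂η) + (1/2) * ∫ γ, g γ * f (e γ) ∂η := by
      rw [← integral_const_mul, ← integral_const_mul, ← integral_add (hfe.const_mul _) (hgf.const_mul _)]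
      refine integral_congr_ae (Eventually.of_forall fun γ => ?_)
      simp only []; ring
    have i6 : ∫ x, (2 * min (q x) 1 - 1) * f x = 2 * (∫ x, min (q x) 1 * f x) - ∫ x, f x := by
      rw [← integral_const_mul, ← integral_sub (hqf.const_mul _) hfi]
      refine integral_congr_ae (Eventually.of_forall fun γ => ?_)
      simp only []; ring
    rw [i6, ← i4, ← i2, i1, i5, i3]; ring
end

noncomputable section
set_option linter.unusedSectionVars false

/-- Abstract incompressible Lagrangian flow. -/
structure LagFlow {Ω : Type*} [MeasurableSpace Ω] {d : ℕ} (T : ℝ) (β : ℝ → Torus d → Fin d → ℝ)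
    (η : Measure Ω) (X : ℝ → Ω → Torus d) : Prop where
  measX : Measurable (Function.uncurry X)
  measβ : Measurable (Function.uncurry β)
  l1 : ∫⁻ t in Ioc 0 T, ∫⁻ x, ‖β t x‖ₑ < ∞
  marg : ∀ t ∈ Icc 0 T, Measure.map (X t) η = volume
  curve : ∀ᵐ ω ∂η, IntegrableOn (fun s => β s (X s ω)) (Ioc 0 T) ∧
    ∀ t ∈ Icc 0 T, X t ω = X 0 ω + pr (∫ s in Ioc 0 t, β s (X s ω))

variable {Ω : Type*} [MeasurableSpace Ω] {d : ℕ} {T : ℝ} {β : ℝ → Torus d → Fin d → ℝ}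
    {η : Measure Ω} [IsProbabilityMeasure η] {X : ℝ → Ω → Torus d}

/-- dissipation -/
def Theta (ψ κ : Torus d → ℝ) (v : Torus d → Fin d → ℝ) : ℝ≥0∞ :=
  ∫⁻ p : Torus d × Torus d, ENNReal.ofReal (ψ p.2) * ‖dT κ (p.2 - p.1) (v p.2 - v p.1)‖ₑ ∂(volume.prod volume)

lemma LagFlow.measXt (h : LagFlow T β η X) (t : ℝ) : Measurable (X t) :=
  h.measX.comp (measurable_const.prodMk measurable_id)

lemma LagFlow.measβt (h : LagFlow T β η X) (t : ℝ) : Measurable (β t) :=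
  h.measβ.comp (measurable_const.prodMk measurable_id)

lemma meas_clm_apply {α : Type*} [MeasurableSpace α] {L : α → (Fin d → ℝ) →L[ℝ] ℝ} {v : α → Fin d → ℝ}
    (hL : Measurable L) (hv : Measurable v) : Measurable fun a => L a (v a) := by
  have hc : Continuous fun p : ((Fin d → ℝ) →L[ℝ] ℝ) × (Fin d → ℝ) => p.1 p.2 := by fun_prop
  exact hc.measurable.comp (hL.prodMk hv)

lemma LagFlow.integrable_snd (h : LagFlow T β η X) {s t : ℝ} (hs : 0 ≤ s) (ht : t ≤ T) :
    Integrable (fun q : ℝ × (Ω × Ω) => ‖β q.1 (X q.1 q.2.2)‖)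
      ((volume.restrict (Ioc s t)).prod (η.prod η)) := by
  have hm : Measurable (fun q : ℝ × (Ω × Ω) => β q.1 (X q.1 q.2.2)) :=
    h.measβ.comp (measurable_fst.prodMk (h.measX.comp (measurable_fst.prodMk (measurable_snd.comp measurable_snd))))
  refine ⟨hm.norm.aestronglyMeasurable, ?_⟩
  rw [hasFiniteIntegral_iff_enorm, lintegral_prod _ hm.norm.enorm.aemeasurable]
  refine lt_of_le_of_lt ?_ h.l1
  refine le_trans ?_ (lintegral_mono_set (Ioc_subset_Ioc hs ht))
  refine setLIntegral_mono_ae' measurableSet_Ioc (Eventually.of_forall fun r hr => ?_)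
  have hr' : r ∈ Icc 0 T := ⟨hs.trans hr.1.le, hr.2.trans ht⟩
  simp only [enorm_norm]
  rw [lintegral_prod]
  · simp only [lintegral_const, measure_univ, mul_one]
    rw [← h.marg r hr', lintegral_map (h.measβt r).enorm (h.measXt r)]
  · exact ((h.measβt r).comp ((h.measXt r).comp measurable_snd)).enorm.aemeasurable

lemma LagFlow.integrable_fst (h : LagFlow T β η X) {s t : ℝ} (hs : 0 ≤ s) (ht : t ≤ T) :
    Integrable (fun q : ℝ × (Ω × Ω) => ‖β q.1 (X q.1 q.2.1)‖)
      ((volume.restrict (Ioc s t)).prod (η.prod η)) := by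
  have hm : Measurable (fun q : ℝ × (Ω × Ω) => β q.1 (X q.1 q.2.1)) :=
    h.measβ.comp (measurable_fst.prodMk (h.measX.comp (measurable_fst.prodMk (measurable_fst.comp measurable_snd))))
  have h2 : MeasurePreserving (fun q : ℝ × (Ω × Ω) => (q.1, q.2.swap)) 
      ((volume.restrict (Ioc s t)).prod (η.prod η)) ((volume.restrict (Ioc s t)).prod (η.prod η)) :=
    (MeasurePreserving.id _).prod (Measure.measurePreserving_swap)
  exact (h2.integrable_comp (h.integrable_snd hs ht).1).2 (h.integrable_snd hs ht)

/-- quadratic functional -/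
def Qf (η : Measure Ω) (g : Ω → ℝ) (e : Ω → Torus d) (H κ : Torus d → ℝ) : ℝ :=
  ∫ p : Ω × Ω, g p.1 * (g p.2 * (H (e p.2) * κ (e p.2 - e p.1))) ∂(η.prod η)

lemma LagFlow.evo_ae (h : LagFlow T β η X) {ψ κ : Torus d → ℝ} (hψ : TC1 ψ) (hκ : TC1 κ) {s t : ℝ} (hs : 0 ≤ s)
    (hst : s ≤ t) (ht : t ≤ T) : ∀ᵐ p ∂(η.prod η), ψ (X t p.2) * κ (X t p.2 - X t p.1) - ψ (X s p.2) * κ (X s p.2 - X s p.1)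
      = ∫ r in Ioc s t, (ψ (X r p.2) * dT κ (X r p.2 - X r p.1) (β r (X r p.2) - β r (X r p.1)) + 
        κ (X r p.2 - X r p.1) * dT ψ (X r p.2) (β r (X r p.2))) := by
  have h1 := Measure.quasiMeasurePreserving_fst (μ := η) (ν := η) |>.ae h.curve
  have h2 := Measure.quasiMeasurePreserving_snd (μ := η) (ν := η) |>.ae h.curve
  filter_upwards [h1, h2] with p hp1 hp2
  exact pair_evolution hp2.1 hp1.1 hp2.2 hp1.2 hψ hκ hs hst ht

lemma LagFlow.evo (h : LagFlow T β η X) {g : Ω → ℝ} (hg : Measurable g) (hg1 : ∀ ω, |g ω| ≤ 1)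
    {ψ κ : Torus d → ℝ} (hψ : TC1 ψ) (hψ0 : ∀ x, 0 ≤ ψ x) (hκ : TC1 κ) {s t : ℝ} (hs : 0 ≤ s)
    (hst : s ≤ t) (ht : t ≤ T) :
    IntegrableOn (fun r => Qf η g (X r) (fun x => dT ψ x (β r x)) κ) (Ioc s t) ∧
    ∃ J : ℝ → ℝ, IntegrableOn J (Ioc s t) ∧ (∀ r ∈ Ioc s t, ‖J r‖ₑ ≤ Theta ψ κ (β r)) ∧ 
    Qf η g (X t) ψ κ - Qf η g (X s) ψ κ = 
      (∫ r in Ioc s t, Qf η g (X r) (fun x => dT ψ x (β r x)) κ) + ∫ r in Ioc s t, J r := by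
  obtain ⟨Cψ, Cψ0, hCψ⟩ := hψ.bdd
  obtain ⟨Cκ, Cκ0, hCκ⟩ := hκ.bdd
  obtain ⟨Dψ, Dψ0, hDψ⟩ := hψ.bound
  obtain ⟨Dκ, Dκ0, hDκ⟩ := hκ.bound
  have mX2 : Measurable (fun q : ℝ × (Ω × Ω) => X q.1 q.2.2) :=
    h.measX.comp (measurable_fst.prodMk (measurable_snd.comp measurable_snd))
  have mX1 : Measurable (fun q : ℝ × (Ω × Ω) => X q.1 q.2.1) :=
    h.measX.comp (measurable_fst.prodMk (measurable_fst.comp measurable_snd))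
  have mb2 : Measurable (fun q : ℝ × (Ω × Ω) => β q.1 (X q.1 q.2.2)) := h.measβ.comp (measurable_fst.prodMk mX2)
  have mb1 : Measurable (fun q : ℝ × (Ω × Ω) => β q.1 (X q.1 q.2.1)) := h.measβ.comp (measurable_fst.prodMk mX1)
  have mg1 : Measurable (fun q : ℝ × (Ω × Ω) => g q.2.1) := hg.comp (measurable_fst.comp measurable_snd)
  have mg2 : Measurable (fun q : ℝ × (Ω × Ω) => g q.2.2) := hg.comp (measurable_snd.comp measurable_snd)
  have mψ := hψ.1.measurable
  have mκ := hκ.1.measurable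
  have i1 := h.integrable_fst hs ht
  have i2 := h.integrable_snd hs ht
  set A : ℝ × (Ω × Ω) → ℝ := fun q => g q.2.1 * (g q.2.2 * 
    (ψ (X q.1 q.2.2) * dT κ (X q.1 q.2.2 - X q.1 q.2.1) (β q.1 (X q.1 q.2.2) - β q.1 (X q.1 q.2.1)))) with hA
  set B : ℝ × (Ω × Ω) → ℝ := fun q => g q.2.1 * (g q.2.2 * 
    (dT ψ (X q.1 q.2.2) (β q.1 (X q.1 q.2.2)) * κ (X q.1 q.2.2 - X q.1 q.2.1))) with hB
  have mA : Measurable A := mg1.mul (mg2.mul ((mψ.comp mX2).mul 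
    (meas_clm_apply ((measurable_dT κ).comp (mX2.sub mX1)) (mb2.sub mb1))))
  have mB : Measurable B := mg1.mul (mg2.mul (
    (meas_clm_apply ((measurable_dT ψ).comp mX2) mb2).mul (mκ.comp (mX2.sub mX1))))
  have gg : ∀ (p : Ω × Ω) (x : ℝ), ‖g p.1 * (g p.2 * x)‖ ≤ ‖x‖ := by
    intro p x
    rw [norm_mul, norm_mul]
    calc ‖g p.1‖ * (‖g p.2‖ * ‖x‖) ≤ 1 * (1 * ‖x‖) := by gcongr <;> exact hg1 _
      _ = ‖x‖ := by ring
  have iA : Integrable A ((volume.restrict (Ioc s t)).prod (η.prod η)) := by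
    refine Integrable.mono' ((i2.add i1).const_mul (Cψ * Dκ)) mA.aestronglyMeasurable (Eventually.of_forall fun q => ?_)
    refine (gg q.2 _).trans ?_
    rw [norm_mul, mul_assoc]
    gcongr
    · exact hCψ _
    · refine (ContinuousLinearMap.le_opNorm _ _).trans ?_
      gcongr
      · exact hDκ _
      · exact norm_sub_le _ _
  have iB : Integrable B ((volume.restrict (Ioc s t)).prod (η.prod η)) := by
    refine Integrable.mono' (i2.const_mul (Cκ * Dψ)) mB.aestronglyMeasurable (Eventually.of_forall fun q => ?_)
    refine (gg q.2 _).trans ?_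
    rw [norm_mul, mul_comm, mul_assoc]
    gcongr
    · exact hCκ _
    · refine (ContinuousLinearMap.le_opNorm _ _).trans ?_
      gcongr
      exact hDψ _
  refine ⟨iB.integral_prod_left, fun r => ∫ p, A (r, p) ∂(η.prod η), iA.integral_prod_left, ?_, ?_⟩
  · intro r hr
    have hr' : r ∈ Icc 0 T := ⟨hs.trans hr.1.le, hr.2.trans ht⟩
    refine (enorm_integral_le_lintegral_enorm _).trans ?_
    have hmp : Measure.map (Prod.map (X r) (X r)) (η.prod η) = (volume : Measure (Torus d)).prod volume := by
      rw [← Measure.map_prod_map _ _ (h.measXt r) (h.measXt r), h.marg r hr']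
    unfold Theta
    rw [← hmp, lintegral_map]
    · refine lintegral_mono fun p => ?_
      refine (enorm_le_iff_norm_le.2 (gg p _)).trans ?_
      rw [enorm_mul]
      simp only [Prod.map_snd, Prod.map_fst]
      rw [Real.enorm_of_nonneg (hψ0 _)]
    · exact (mψ.comp measurable_snd).ennreal_ofReal.mul (meas_clm_apply ((measurable_dT κ).comp (measurable_snd.sub measurable_fst))
        (((h.measβt r).comp measurable_snd).sub ((h.measβt r).comp measurable_fst))).enorm
    · exact (h.measXt r).prodMap (h.measXt r)
  · have iQ : ∀ r, Integrable (fun p : Ω × Ω => g p.1 * (g p.2 * (ψ (X r p.2) * κ (X r p.2 - X r p.1)))) (η.prod η) := by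
      intro r
      have m2 : Measurable fun p : Ω × Ω => X r p.2 := (h.measXt r).comp measurable_snd
      have m1 : Measurable fun p : Ω × Ω => X r p.1 := (h.measXt r).comp measurable_fst
      refine Integrable.mono' (integrable_const (Cψ * Cκ)) ((hg.comp measurable_fst).mul ((hg.comp measurable_snd).mul 
        ((mψ.comp m2).mul (mκ.comp (m2.sub m1))))).aestronglyMeasurable 
        (Eventually.of_forall fun p => ?_)
      refine (gg p _).trans ?_
      rw [norm_mul]
      gcongr
      · exact hCψ _
      · exact hCκ _
    have ie : ∫ r in Ioc s t, Qf η g (X r) (fun x => dT ψ x (β r x)) κ = ∫ r in Ioc s t, ∫ p, B (r,p) ∂(η.prod η) := rfl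
    rw [ie, ← integral_add iB.integral_prod_left iA.integral_prod_left]
    unfold Qf
    rw [← integral_sub (iQ t) (iQ s)]
    have e1 : ∫ r in Ioc s t, ((∫ p, B (r,p) ∂(η.prod η)) + ∫ p, A (r,p) ∂(η.prod η)) =
        ∫ r in Ioc s t, ∫ p, (B + A) (r,p) ∂(η.prod η) := by
      refine integral_congr_ae ?_
      filter_upwards [iA.prod_right_ae, iB.prod_right_ae] with r hA' hB'
      exact (integral_add hB' hA').symm
    have e2 := integral_integral_swap (f := fun r p => (B + A) (r, p)) (μ := volume.restrict (Ioc s t)) (ν := η.prod η)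
      (iB.add iA)
    rw [e1, e2]
    refine integral_congr_ae ?_
    filter_upwards [h.evo_ae hψ hκ hs hst ht] with p hp
    rw [← mul_sub, ← mul_sub, hp, ← integral_const_mul, ← integral_const_mul]
    refine integral_congr_ae (Eventually.of_forall fun r => ?_)
    simp only [hA, hB, Pi.add_apply]
    ring
end

noncomputable section
set_option linter.unusedSectionVars false

variable {Ω : Type*} [MeasurableSpace Ω] {d : ℕ} {T : ℝ} {β : ℝ → Torus d → Fin d → ℝ}
    {η : Measure Ω} [IsProbabilityMeasure η] {X : ℝ → Ω → Torus d}

lemma Adm.exists_bdd {ρ : (Fin d → ℝ) → ℝ} (h : Adm ρ) : ∃ C, 0 ≤ C ∧ ∀ z, |ρ z| ≤ C := by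
  obtain ⟨C, hC⟩ := h.contDiff.continuous.bounded_above_of_compact_support h.supp
  exact ⟨C, (norm_nonneg _).trans (hC 0), hC⟩

lemma kap_bdd {ρ : (Fin d → ℝ) → ℝ} (h : Adm ρ) (ε : ℝ) : ∃ C, 0 ≤ C ∧ ∀ w : Torus d, |kap ε ρ w| ≤ C := by
  obtain ⟨C, C0, hC⟩ := h.exists_bdd
  refine ⟨|ε⁻¹ ^ d| * C, by positivity, fun w => ?_⟩
  rw [kap, abs_mul]
  gcongr
  exact hC _

lemma Qf_eq {e : Ω → Torus d} (he : Measurable e) {g : Ω → ℝ} (hg : Measurable g) (hg1 : ∀ ω, |g ω| ≤ 1)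
    (hmap : Measure.map e η = volume)
    {u : Torus d → ℝ} (hu : Measurable u) (hu1 : ∀ x, |u x| ≤ 1)
    (hug : ∀ f : Torus d → ℝ, Measurable f → Integrable f volume → ∫ γ, g γ * f (e γ) ∂η = ∫ x, u x * f x)
    {H κ : Torus d → ℝ} (hH : Measurable H) (hHi : Integrable H volume) (hκ : Measurable κ) {C : ℝ} (hC : ∀ w, |κ w| ≤ C) :
    Qf η g e H κ = ∫ p : Torus d × Torus d, u p.1 * ((u p.2 * H p.2) * κ (p.2 - p.1)) ∂(volume.prod volume) := by
  have hHe : Integrable (fun ω => H (e ω)) η := by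
    rw [← hmap] at hHi
    exact hHi.comp_measurable he
  have i1 : Integrable (fun p : Ω × Ω => g p.1 * (g p.2 * (H (e p.2) * κ (e p.2 - e p.1)))) (η.prod η) := by
    have h1 : Integrable (fun p : Ω × Ω => H (e p.2)) (η.prod η) := hHe.comp_snd _
    have h2 := h1.mul_bdd (c := C) (g := fun p : Ω × Ω => κ (e p.2 - e p.1))
      (hκ.comp ((he.comp measurable_snd).sub (he.comp measurable_fst))).aestronglyMeasurable 
      (Eventually.of_forall fun p => hC _)
    have h3 := h2.bdd_mul (c := 1) (f := fun p : Ω × Ω => g p.2) (hg.comp measurable_snd).aestronglyMeasurable 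
      (Eventually.of_forall fun p => hg1 _)
    exact h3.bdd_mul (c := 1) (f := fun p : Ω × Ω => g p.1) (hg.comp measurable_fst).aestronglyMeasurable 
      (Eventually.of_forall fun p => hg1 _)
  have huH : Integrable (fun x => u x * H x) volume := hHi.bdd_mul (c := 1) hu.aestronglyMeasurable (Eventually.of_forall hu1)
  have i2 := integrable_kernel_pair huH hu hu1 hκ hC
  unfold Qf
  rw [integral_prod _ i1, integral_prod _ i2]
  have hy : ∀ y, ∫ ω, g ω * (H (e ω) * κ (e ω - y)) ∂η = ∫ x, (u x * H x) * κ (x - y) := by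
    intro y
    rw [hug (fun x => H x * κ (x - y)) (hH.mul (hκ.comp (measurable_id.sub_const y)))
      (hHi.mul_bdd (c := C) (hκ.comp (measurable_id.sub_const y)).aestronglyMeasurable (Eventually.of_forall fun _ => hC _))]
    simp only [mul_assoc]
  simp only [integral_const_mul]
  simp only [hy]
  refine hug (fun y => ∫ x, (u x * H x) * κ (x - y)) ?_ ?_
  · have : StronglyMeasurable (fun p : Torus d × Torus d => (u p.2 * H p.2) * κ (p.2 - p.1)) :=
      (((hu.mul hH).comp measurable_snd).mul (hκ.comp (measurable_snd.sub measurable_fst))).stronglyMeasurable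
    exact this.integral_prod_right'.measurable
  · have h1 : Integrable (fun p : Torus d × Torus d => u p.2 * H p.2) (volume.prod volume) := huH.comp_snd _
    have h2 : Integrable (fun p : Torus d × Torus d => (u p.2 * H p.2) * κ (p.2 - p.1)) (volume.prod volume) :=
      h1.mul_bdd (c := C) (hκ.comp (measurable_snd.sub measurable_fst)).aestronglyMeasurable 
      (Eventually.of_forall fun p => hC _)
    exact h2.integral_prod_left

lemma Qf_tendsto {e : Ω → Torus d} (he : Measurable e) {g : Ω → ℝ} (hg : Measurable g) (hg1 : ∀ ω, |g ω| ≤ 1)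
    (hmap : Measure.map e η = volume)
    {u : Torus d → ℝ} (hu : Measurable u) (hu1 : ∀ x, |u x| ≤ 1)
    (hug : ∀ f : Torus d → ℝ, Measurable f → Integrable f volume → ∫ γ, g γ * f (e γ) ∂η = ∫ x, u x * f x)
    {H : Torus d → ℝ} (hH : Measurable H) (hHi : Integrable H volume) {ρ : (Fin d → ℝ) → ℝ} (hρ : Adm ρ) :
    Tendsto (fun n : ℕ => Qf η g e H (kap (eps n) ρ)) atTop (𝓝 (∫ x, u x * (u x * H x))) := by
  have huH : Integrable (fun x => u x * H x) volume := hHi.bdd_mul (c := 1) hu.aestronglyMeasurable (Eventually.of_forall hu1)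
  refine (mollify_tendsto huH hu hu1 hρ).congr fun n => ?_
  obtain ⟨C, C0, hC⟩ := kap_bdd hρ (eps n)
  exact (Qf_eq he hg hg1 hmap hu hu1 hug hH hHi (measurable_kap hρ _) hC).symm

lemma Qf_bound {e : Ω → Torus d} (he : Measurable e) {g : Ω → ℝ} (hg : Measurable g) (hg1 : ∀ ω, |g ω| ≤ 1)
    (hmap : Measure.map e η = volume)
    {H κ : Torus d → ℝ} (hH : Measurable H) (hHi : Integrable H volume) (hκ : Measurable κ) (hκ0 : ∀ w, 0 ≤ κ w)
    (hκ1 : ∫⁻ w, ENNReal.ofReal (κ w) = 1) :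
    ‖Qf η g e H κ‖ₑ ≤ ∫⁻ x, ‖H x‖ₑ := by
  unfold Qf
  refine (enorm_integral_le_lintegral_enorm _).trans ?_
  have hmp : Measure.map (Prod.map e e) (η.prod η) = (volume : Measure (Torus d)).prod volume := by
    rw [← Measure.map_prod_map _ _ he he, hmap]
  calc ∫⁻ p : Ω × Ω, ‖g p.1 * (g p.2 * (H (e p.2) * κ (e p.2 - e p.1)))‖ₑ ∂(η.prod η) 
      ≤ ∫⁻ p : Ω × Ω, (fun q : Torus d × Torus d => ‖H q.2‖ₑ * ENNReal.ofReal (κ (q.2 - q.1))) (Prod.map e e p) ∂(η.prod η) := by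
        refine lintegral_mono fun p => ?_
        simp only [Prod.map_snd, Prod.map_fst]
        rw [enorm_mul, enorm_mul, enorm_mul, Real.enorm_of_nonneg (hκ0 _)]
        have h1 : ∀ ω, ‖g ω‖ₑ ≤ 1 := fun ω => by
          rw [← ofReal_norm]; exact ENNReal.ofReal_le_one.2 (hg1 ω)
        calc _ ≤ 1 * (1 * (‖H (e p.2)‖ₑ * ENNReal.ofReal (κ (e p.2 - e p.1)))) := by gcongr <;> exact h1 _
          _ = _ := by ring
    _ = ∫⁻ q : Torus d × Torus d, ‖H q.2‖ₑ * ENNReal.ofReal (κ (q.2 - q.1)) ∂(volume.prod volume) := by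
        rw [← hmp, lintegral_map _ (he.prodMap he)]
        exact (hH.comp measurable_snd).enorm.mul (hκ.comp (measurable_snd.sub measurable_fst)).ennreal_ofReal
    _ = ∫⁻ q : Torus d × Torus d, ‖H (q.1 + q.2)‖ₑ * ENNReal.ofReal (κ q.2) ∂(volume.prod volume) := by
        have mp : MeasurePreserving (fun z : Torus d × Torus d => (z.1, z.1 + z.2)) (volume.prod volume) 
          (volume.prod volume) := measurePreserving_prod_add volume volume
        rw [← mp.lintegral_comp]
        · simp
        · exact (hH.comp measurable_snd).enorm.mul (hκ.comp (measurable_snd.sub measurable_fst)).ennreal_ofReal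
    _ = ∫⁻ w, ∫⁻ y, ‖H (y + w)‖ₑ * ENNReal.ofReal (κ w) := by
        rw [lintegral_prod_symm]
        exact ((hH.comp (measurable_fst.add measurable_snd)).enorm.mul (hκ.comp measurable_snd).ennreal_ofReal).aemeasurable
    _ = ∫⁻ w, ENNReal.ofReal (κ w) * ∫⁻ y, ‖H y‖ₑ := by
        refine lintegral_congr fun w => ?_
        have hm : Measurable fun y => ‖H (y + w)‖ₑ := (hH.comp (measurable_add_const w)).enorm
        rw [lintegral_mul_const _ hm, mul_comm, lintegral_add_right_eq_self (fun y => ‖H y‖ₑ) w]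
    _ = _ := by
        rw [lintegral_mul_const _ hκ.ennreal_ofReal, hκ1, one_mul]

lemma meas_Theta (hβ : Measurable (Function.uncurry β)) {ψ : Torus d → ℝ} (hψ : Measurable ψ) (κ : Torus d → ℝ) :
    Measurable fun r => Theta ψ κ (β r) := by
  have h2 : Measurable fun q : ℝ × (Torus d × Torus d) => β q.1 q.2.2 := 
    hβ.comp (measurable_fst.prodMk (measurable_snd.comp measurable_snd))
  have h1 : Measurable fun q : ℝ × (Torus d × Torus d) => β q.1 q.2.1 := 
    hβ.comp (measurable_fst.prodMk (measurable_fst.comp measurable_snd))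
  refine Measurable.lintegral_prod_right' (f := fun q : ℝ × (Torus d × Torus d) => 
    ENNReal.ofReal (ψ q.2.2) * ‖dT κ (q.2.2 - q.2.1) (β q.1 q.2.2 - β q.1 q.2.1)‖ₑ) ?_
  exact (hψ.comp (measurable_snd.comp measurable_snd)).ennreal_ofReal.mul
    (meas_clm_apply ((measurable_dT κ).comp ((measurable_snd.comp measurable_snd).sub (measurable_fst.comp measurable_snd)))
     (h2.sub h1)).enorm
end

noncomputable section
set_option linter.unusedSectionVars false

variable {Ω : Type*} [MeasurableSpace Ω] {d : ℕ} {T : ℝ} {β : ℝ → Torus d → Fin d → ℝ}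
    {η : Measure Ω} [IsProbabilityMeasure η] {X : ℝ → Ω → Torus d}

/-- finite families of cutoffs and kernels -/
structure Fam (d : ℕ) where
  N : ℕ
  ψ : Fin N → Torus d → ℝ
  ρ : Fin N → (Fin d → ℝ) → ℝ
  tc : ∀ k, TC1 (ψ k)
  nonneg : ∀ k x, 0 ≤ ψ k x
  sum : ∀ x, ∑ k, ψ k x = 1
  adm : ∀ k, Adm (ρ k)

def Fam.Th (F : Fam d) (n : ℕ) (v : Torus d → Fin d → ℝ) : ℝ≥0∞ :=
  ∑ k, Theta (F.ψ k) (kap (eps n) (F.ρ k)) v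

lemma Fam.meas_Th (F : Fam d) (n : ℕ) (hβ : Measurable (Function.uncurry β)) :
    Measurable fun r => F.Th n (β r) :=
  Finset.measurable_sum _ fun k _ => meas_Theta hβ (F.tc k).1.measurable _

lemma Fam.dT_sum (F : Fam d) (x : Torus d) : ∑ k, dT (F.ψ k) x = 0 := by
  have h1 : HasFDerivAt (fun y => ∑ k, F.ψ k (pr y)) (∑ k, dT (F.ψ k) (pr (lf x))) (lf x) :=
    HasFDerivAt.fun_sum fun k _ => (F.tc k).hasFDerivAt _
  have h2 : (fun y : Fin d → ℝ => ∑ k, F.ψ k (pr y)) = fun _ => 1 := by funext y; exact F.sum _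
  rw [h2, pr_lf] at h1
  exact h1.unique (hasFDerivAt_const _ _)

lemma Fam.good_eps (F : Fam d) : ∀ᶠ n : ℕ in atTop, ∀ k, TC1 (kap (d := d) (eps n) (F.ρ k)) ∧ 
    ∫⁻ w : Torus d, ENNReal.ofReal (kap (eps n) (F.ρ k) w) = 1 := by
  rw [eventually_all]
  intro k
  obtain ⟨R, R0, hR⟩ := (F.adm k).exists_R
  filter_upwards [(tendsto_eps_mul R).eventually (gt_mem_nhds (by norm_num : (0:ℝ) < 1/2))] with n hn
  exact ⟨TC1_kap (F.adm k) (eps_pos n) hn hR, lintegral_kap (F.adm k) (eps_pos n) hn hR⟩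

lemma fam_limit (h : LagFlow T β η X) {g : Ω → ℝ} (hg : Measurable g) (hg1 : ∀ ω, |g ω| ≤ 1)
    {u : ℝ → Torus d → ℝ} (hu : ∀ t, Measurable (u t)) (hu1 : ∀ t x, |u t x| ≤ 1)
    (hug : ∀ t ∈ Icc 0 T, ∀ f : Torus d → ℝ, Measurable f → Integrable f volume → 
      ∫ ω, g ω * f (X t ω) ∂η = ∫ x, u t x * f x) (F : Fam d) {s t : ℝ} (hs : 0 ≤ s) (hst : s ≤ t) (ht : t ≤ T)
    (G : ℝ → ℝ≥0∞) (hG : ∫⁻ r in Ioc s t, G r ≠ ∞) 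
    (hdom : ∀ᶠ n in atTop, ∀ᵐ r ∂(volume.restrict (Ioc s t)), F.Th n (β r) ≤ G r) :
    ‖(∫ x, u t x * u t x) - ∫ x, u s x * u s x‖ₑ ≤ 
      ∫⁻ r in Ioc s t, limsup (fun n => F.Th n (β r)) atTop := by
  set κ : ℕ → Fin F.N → Torus d → ℝ := fun n k => kap (eps n) (F.ρ k) with hκ
  set Q : ℕ → ℝ → ℝ := fun n t => ∑ k, Qf η g (X t) (F.ψ k) (κ n k) with hQ
  set I : ℕ → ℝ → ℝ := fun n r => ∑ k, Qf η g (X r) (fun x => dT (F.ψ k) x (β r x)) (κ n k) with hI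
  -- limit of Q
  have hsE : s ∈ Icc 0 T := ⟨hs, hst.trans ht⟩
  have htE : t ∈ Icc 0 T := ⟨hs.trans hst, ht⟩
  have ψi : ∀ k, Integrable (F.ψ k) volume := fun k => by
    obtain ⟨C, _, hC⟩ := (F.tc k).bdd
    exact Integrable.mono' (integrable_const C) (F.tc k).1.measurable.aestronglyMeasurable (Eventually.of_forall hC)
  have hQlim : ∀ t ∈ Icc 0 T, Tendsto (fun n => Q n t) atTop (𝓝 (∫ x, u t x * u t x)) := by
    intro t ht
    have h1 : Tendsto (fun n => Q n t) atTop (𝓝 (∑ k, ∫ x, u t x * (u t x * F.ψ k x))) :=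
      tendsto_finsetSum _ fun k _ => Qf_tendsto (h.measXt t) hg hg1 (h.marg t ht) (hu t) (hu1 t) (hug t ht)
        (F.tc k).1.measurable (ψi k) (F.adm k)
    convert h1 using 2
    rw [← integral_finsetSum]
    · refine integral_congr_ae (Eventually.of_forall fun x => ?_)
      simp only
      rw [← Finset.mul_sum, ← Finset.mul_sum, F.sum, mul_one]
    · intro k _
      exact ((ψi k).bdd_mul (c := 1) (hu t).aestronglyMeasurable (Eventually.of_forall (hu1 t))).bdd_mul 
        (c := 1) (hu t).aestronglyMeasurable (Eventually.of_forall (hu1 t))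
  -- integrability of β r
  have hβi : ∀ᵐ r ∂(volume.restrict (Ioc s t)), ∫⁻ x, ‖β r x‖ₑ < ∞ := by
    have : AEMeasurable (fun r => ∫⁻ x, ‖β r x‖ₑ) (volume.restrict (Ioc s t)) :=
      (h.measβ.enorm.lintegral_prod_right' (f := fun q : ℝ × Torus d => ‖β q.1 q.2‖ₑ)).aemeasurable
    exact ae_lt_top' this ((lintegral_mono_set (Ioc_subset_Ioc hs ht)).trans_lt h.l1).ne
  choose D D0 hD using fun k => (F.tc k).bound
  have hHm : ∀ k r, Measurable fun x => dT (F.ψ k) x (β r x) := fun k r => 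
    meas_clm_apply (measurable_dT _) (h.measβt r)
  have hHb : ∀ k r, ∫⁻ x, ‖dT (F.ψ k) x (β r x)‖ₑ ≤ ENNReal.ofReal (D k) * ∫⁻ x, ‖β r x‖ₑ := by
    intro k r
    rw [← lintegral_const_mul _ (h.measβt r).enorm]
    refine lintegral_mono fun x => ?_
    rw [← ofReal_norm, ← ofReal_norm, ← ENNReal.ofReal_mul (D0 k)]
    refine ENNReal.ofReal_le_ofReal ((ContinuousLinearMap.le_opNorm _ _).trans ?_)
    gcongr
    exact hD k x
  have hHi : ∀ r, ∫⁻ x, ‖β r x‖ₑ < ∞ → ∀ k, Integrable (fun x => dT (F.ψ k) x (β r x)) volume := by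
    intro r hr k
    refine ⟨(hHm k r).aestronglyMeasurable, ?_⟩
    exact (hHb k r).trans_lt (ENNReal.mul_lt_top ENNReal.ofReal_lt_top hr)
  have hIlim : ∀ᵐ r ∂(volume.restrict (Ioc s t)), Tendsto (fun n => I n r) atTop (𝓝 0) := by
    filter_upwards [hβi, ae_restrict_mem measurableSet_Ioc] with r hr hrm
    have hrE : r ∈ Icc 0 T := ⟨hs.trans hrm.1.le, hrm.2.trans ht⟩
    have h1 : Tendsto (fun n => I n r) atTop (𝓝 (∑ k, ∫ x, u r x * (u r x * dT (F.ψ k) x (β r x)))) :=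
      tendsto_finsetSum _ fun k _ => Qf_tendsto (h.measXt r) hg hg1 (h.marg r hrE) (hu r) (hu1 r) (hug r hrE)
        (hHm k r) (hHi r hr k) (F.adm k)
    convert h1 using 2
    rw [← integral_finsetSum]
    · symm
      refine integral_eq_zero_of_ae (Eventually.of_forall fun x => ?_)
      simp only
      rw [← Finset.mul_sum, ← Finset.mul_sum]
      have := congrArg (fun L : (Fin d → ℝ) →L[ℝ] ℝ => L (β r x)) (F.dT_sum x)
      simp only [ContinuousLinearMap.sum_apply] at this
      rw [this]; simp
    · intro k _
      exact ((hHi r hr k).bdd_mul (c := 1) (hu r).aestronglyMeasurable (Eventually.of_forall (hu1 r))).bdd_mul 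
        (c := 1) (hu r).aestronglyMeasurable (Eventually.of_forall (hu1 r))
  have evo := fun n (hn : ∀ k, TC1 (κ n k)) k => h.evo hg hg1 (F.tc k) (F.nonneg k) (hn k) hs hst ht
  have hIint : Tendsto (fun n => ∫ r in Ioc s t, I n r) atTop (𝓝 0) := by
    have : Tendsto (fun n => ∫ r in Ioc s t, I n r) atTop (𝓝 (∫ r in Ioc s t, (0:ℝ))) := by
      refine tendsto_integral_filter_of_dominated_convergence 
        (fun r => ((∑ k, ENNReal.ofReal (D k)) * ∫⁻ x, ‖β r x‖ₑ).toReal) ?_ ?_ ?_ hIlim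
      · filter_upwards [F.good_eps] with n hn
        exact (integrable_finsetSum _ fun k _ => (evo n (fun k => (hn k).1) k).1).1
      · filter_upwards [F.good_eps] with n hn
        filter_upwards [hβi, ae_restrict_mem measurableSet_Ioc] with r hr hrm
        have hrE : r ∈ Icc 0 T := ⟨hs.trans hrm.1.le, hrm.2.trans ht⟩
        rw [← ENNReal.ofReal_le_iff_le_toReal, ofReal_norm]
        · refine (enorm_sum_le _ _).trans ?_
          rw [Finset.sum_mul]
          refine Finset.sum_le_sum fun k _ => ?_
          exact (Qf_bound (h.measXt r) hg hg1 (h.marg r hrE) (hHm k r) (hHi r hr k) (measurable_kap (F.adm k) _)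
            (kap_nonneg (F.adm k) (eps_pos n)) (hn k).2).trans (hHb k r)
        · exact (ENNReal.mul_lt_top (ENNReal.sum_lt_top.2 fun _ _ => ENNReal.ofReal_lt_top) hr).ne
      · have hm : Measurable fun r => ∫⁻ x, ‖β r x‖ₑ := 
          h.measβ.enorm.lintegral_prod_right' (f := fun q : ℝ × Torus d => ‖β q.1 q.2‖ₑ)
        refine integrable_toReal_of_lintegral_ne_top (hm.const_mul _).aemeasurable ?_
        rw [lintegral_const_mul _ hm]
        exact (ENNReal.mul_lt_top (ENNReal.sum_lt_top.2 fun _ _ => ENNReal.ofReal_lt_top) 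
          ((lintegral_mono_set (Ioc_subset_Ioc hs ht)).trans_lt h.l1)).ne
    simpa using this
  have hbound : ∀ᶠ n in atTop, ‖Q n t - Q n s - ∫ r in Ioc s t, I n r‖ₑ ≤ ∫⁻ r in Ioc s t, F.Th n (β r) := by
    filter_upwards [F.good_eps] with n hn
    choose hi J hJi hJ hQJ using evo n (fun k => (hn k).1)
    have e1 : Q n t - Q n s - ∫ r in Ioc s t, I n r = ∑ k, ∫ r in Ioc s t, J k r := by
      simp only [hQ, hI]
      rw [integral_finsetSum _ (fun k _ => hi k), ← Finset.sum_sub_distrib, ← Finset.sum_sub_distrib]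
      refine Finset.sum_congr rfl fun k _ => ?_
      rw [hQJ k]; ring
    rw [e1]
    refine (enorm_sum_le _ _).trans ?_
    unfold Fam.Th
    rw [lintegral_finset_sum _ (fun k _ => meas_Theta h.measβ (F.tc k).1.measurable _)]
    refine Finset.sum_le_sum fun k _ => (enorm_integral_le_lintegral_enorm _).trans ?_
    exact setLIntegral_mono_ae' measurableSet_Ioc (Eventually.of_forall fun r hr => hJ k r hr)
  have hlim : Tendsto (fun n => ‖Q n t - Q n s - ∫ r in Ioc s t, I n r‖ₑ) atTop
      (𝓝 ‖(∫ x, u t x * u t x) - ∫ x, u s x * u s x‖ₑ) := by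
    have := (((hQlim t htE).sub (hQlim s hsE)).sub hIint).enorm
    simpa using this
  rw [← hlim.limsup_eq]
  refine (limsup_le_limsup hbound).trans ?_
  obtain ⟨N0, hN0⟩ := eventually_atTop.1 hdom
  rw [← limsup_nat_add _ N0]
  refine (limsup_lintegral_le G (fun n => F.meas_Th _ h.measβ) (fun n => hN0 _ (by lia)) hG).trans ?_
  refine lintegral_mono fun r => ?_
  exact (limsup_nat_add (fun n => F.Th n (β r)) N0).le
end

noncomputable section
set_option linter.unusedSectionVars false

lemma const_of_countable_dom {α : Type*} [Countable α] [Nonempty α] {E : ℝ → ℝ} {b : ℝ} (hb : 0 ≤ b)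
    {θ : α → ℝ → ℝ} (hθ : ∀ a, IntervalIntegrable (θ a) volume 0 b)
    (hE : ∀ a, ∀ s ∈ Icc 0 b, ∀ t ∈ Icc 0 b, s ≤ t → dist (E t) (E s) ≤ ∫ r in s..t, θ a r)
    (hinf : ∀ᵐ r ∂volume.restrict (Ioc 0 b), ∀ δ > 0, ∃ a, θ a r ≤ δ) :
    ∀ t ∈ Icc 0 b, E t = E 0 := by
  have hac : AbsolutelyContinuousOnInterval E 0 b := 
    ac_of_dom hb (hθ (Classical.arbitrary α)) (hE (Classical.arbitrary α))
  have hsub : ∀ a, ∀ s ∈ Icc 0 b, ∀ t ∈ Icc 0 b, IntervalIntegrable (θ a) volume s t := by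
    intro a s hs t ht
    refine (hθ a).mono_set ?_
    rw [uIcc_of_le hb]
    exact uIcc_subset_Icc hs ht
  have hder : ∀ᵐ x, x ∈ uIcc 0 b → HasDerivAt E 0 x := by
    have h1 : ∀ᵐ x, ∀ a, x ∈ uIcc 0 b → ∀ c ∈ uIcc 0 b, HasDerivAt (fun x => ∫ (t : ℝ) in c..x, θ a t) (θ a x) x :=
      ae_all_iff.2 fun a => (hθ a).ae_hasDerivAt_integral
    have h2 : ∀ᵐ x, x ≠ (0:ℝ) := by simp [ae_iff, measure_singleton]
    have h3 : ∀ᵐ x, x ≠ b := by simp [ae_iff, measure_singleton]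
    rw [ae_restrict_iff' measurableSet_Ioc] at hinf
    filter_upwards [h1, h2, h3, hinf] with x hx1 hx0 hxb hx hxm
    rw [uIcc_of_le hb] at hxm hx1
    have hxo : x ∈ Ioo 0 b := ⟨lt_of_le_of_ne hxm.1 (Ne.symm hx0), lt_of_le_of_ne hxm.2 hxb⟩
    rw [hasDerivAt_iff_isLittleO, Asymptotics.isLittleO_iff]
    intro c hc
    obtain ⟨a, ha⟩ := hx ⟨hxo.1, hxo.2.le⟩ (c/2) (by positivity)
    have hd := hx1 a hxm x hxm
    rw [hasDerivAt_iff_isLittleO, Asymptotics.isLittleO_iff] at hd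
    filter_upwards [hd (show 0 < c/2 by positivity), Ioo_mem_nhds hxo.1 hxo.2] with y hy hyo
    have hyI := Ioo_subset_Icc_self hyo
    simp only [intervalIntegral.integral_same, sub_zero, smul_eq_mul, mul_zero] at hy ⊢
    -- ‖E y - E x‖ ≤ |∫ x..y θ|
    have key : ‖E y - E x‖ ≤ (∫ t in x..y, θ a t) * SignType.sign (y - x) := by
      rcases lt_trichotomy x y with hxy | hxy | hxy
      · rw [sign_pos (by linarith)]
        simpa [← dist_eq_norm] using hE a x hxm y hyI hxy.le
      · subst hxy; simp
      · rw [sign_neg (by linarith)]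
        have := hE a y hyI x hxm hxy.le
        rw [intervalIntegral.integral_symm]
        simpa [← dist_eq_norm, dist_comm] using this
    have k2 : ∫ t in x..y, θ a t = ((∫ t in x..y, θ a t) - (y - x) * θ a x) + (y - x) * θ a x := by ring
    have hs : (y - x) * SignType.sign (y - x) = |y - x| := self_mul_sign _
    have k3 : |(((SignType.sign (y - x) : SignType)) : ℝ)| ≤ 1 := by
      rcases lt_trichotomy (y - x) 0 with h | h | h <;> simp [h]
    calc ‖E y - E x‖ ≤ _ := key
      _ = ((∫ t in x..y, θ a t) - (y - x) * θ a x) * SignType.sign (y - x) + 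
          ((y - x) * SignType.sign (y - x)) * θ a x := by ring
      _ ≤ ‖(∫ t in x..y, θ a t) - (y - x) * θ a x‖ * 1 + |y - x| * (c/2) := by
          rw [hs]
          refine add_le_add ((le_abs_self _).trans ?_) (by gcongr)
          rw [abs_mul, Real.norm_eq_abs]
          gcongr
      _ ≤ c/2 * ‖y - x‖ * 1 + |y - x| * (c/2) := by gcongr
      _ = c * ‖y - x‖ := by rw [Real.norm_eq_abs]; ring
  obtain ⟨C, hC⟩ := hac.const_of_ae_hasDerivAt_zero hder
  rw [uIcc_of_le hb] at hC
  intro t ht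
  rw [hC t ht, hC 0 ⟨le_rfl, hb⟩]

variable {Ω : Type*} [MeasurableSpace Ω] {d : ℕ} {T : ℝ} {β : ℝ → Torus d → Fin d → ℝ}
    {η : Measure Ω} [IsProbabilityMeasure η] {X : ℝ → Ω → Torus d}

/-- commutator smallness along a countable class of families -/
def SmallComm (T' : ℝ) (β : ℝ → Torus d → Fin d → ℝ) : Prop :=
  ∃ (Fs : ℕ → Fam d) (S : ℝ → ℝ≥0∞) (C : ℕ → ℝ≥0∞), ∫⁻ r in Ioc 0 T', S r < ∞ ∧ (∀ a, C a < ∞) ∧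
    (∀ a, ∀ᶠ n in atTop, ∀ᵐ r ∂(volume.restrict (Ioc 0 T')), (Fs a).Th n (β r) ≤ C a * S r) ∧
    ∀ᵐ r ∂(volume.restrict (Ioc 0 T')), ∀ δ > 0, ∃ a, limsup (fun n => (Fs a).Th n (β r)) atTop ≤ δ

lemma flow_const (h : LagFlow T β η X) {g : Ω → ℝ} (hg : Measurable g) (hg1 : ∀ ω, |g ω| ≤ 1)
    {u : ℝ → Torus d → ℝ} (hu : ∀ t, Measurable (u t)) (hu1 : ∀ t x, |u t x| ≤ 1)
    (hug : ∀ t ∈ Icc 0 T, ∀ f : Torus d → ℝ, Measurable f → Integrable f volume → 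
      ∫ ω, g ω * f (X t ω) ∂η = ∫ x, u t x * f x) {T' : ℝ} (hT' : 0 ≤ T') (hTT : T' ≤ T) (hS : SmallComm T' β) :
    ∀ t ∈ Icc 0 T', ∫ x, u t x * u t x = ∫ x, u 0 x * u 0 x := by
  obtain ⟨Fs, S, C, hSi, hC, hdom, hinf⟩ := hS
  set θ : ℕ → ℝ → ℝ≥0∞ := fun a r => limsup (fun n => (Fs a).Th n (β r)) atTop with hθ
  have hθm : ∀ a, Measurable (θ a) := fun a => Measurable.limsup fun n => (Fs a).meas_Th n h.measβ
  have hθfin : ∀ a, ∫⁻ r in Ioc 0 T', θ a r ≠ ∞ := by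
    intro a
    have h1 : ∀ᵐ r ∂(volume.restrict (Ioc 0 T')), θ a r ≤ C a * S r := by
      obtain ⟨N0, hN0⟩ := eventually_atTop.1 (hdom a)
      have h2 : ∀ᵐ r ∂(volume.restrict (Ioc 0 T')), ∀ n : ℕ, (Fs a).Th (n + N0) (β r) ≤ C a * S r := 
        ae_all_iff.2 fun n => hN0 _ (by lia)
      filter_upwards [h2] with r hr
      simp only [hθ]
      rw [← limsup_nat_add _ N0]
      exact limsup_le_of_le (h := Eventually.of_forall hr)
    refine ((lintegral_mono_ae h1).trans_lt ?_).ne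
    rw [lintegral_const_mul' _ _ (hC a).ne]
    exact ENNReal.mul_lt_top (hC a) hSi
  have hintg : ∀ a, IntegrableOn (fun r => (θ a r).toReal) (Ioc 0 T') := fun a => 
    integrable_toReal_of_lintegral_ne_top (hθm a).aemeasurable (hθfin a)
  refine const_of_countable_dom (E := fun t => ∫ x, u t x * u t x) (θ := fun a r => (θ a r).toReal) hT' ?_ ?_ ?_
  · intro a
    exact (intervalIntegrable_iff_integrableOn_Ioc_of_le hT').2 (hintg a)
  · intro a s hs t ht hst
    have hle := fam_limit h hg hg1 hu hu1 hug (Fs a) hs.1 hst (ht.2.trans hTT) (fun r => C a * S r) (by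
      rw [lintegral_const_mul' _ _ (hC a).ne]
      exact (ENNReal.mul_lt_top (hC a) ((lintegral_mono_set (Ioc_subset_Ioc hs.1 ht.2)).trans_lt hSi)).ne) (by
      filter_upwards [hdom a] with n hn
      exact ae_restrict_of_ae_restrict_of_subset (Ioc_subset_Ioc hs.1 ht.2) hn)
    have hfin' : ∫⁻ r in Ioc s t, θ a r ≠ ∞ := ((lintegral_mono_set (Ioc_subset_Ioc hs.1 ht.2)).trans_lt (hθfin a).lt_top).ne
    rw [intervalIntegral.integral_of_le hst, integral_toReal (hθm a).aemeasurable (ae_lt_top (hθm a) hfin'), dist_eq_norm,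
      ← ENNReal.ofReal_le_iff_le_toReal hfin', ofReal_norm]
    exact hle
  · filter_upwards [hinf] with r hr δ hδ
    obtain ⟨a, ha⟩ := hr (ENNReal.ofReal δ) (ENNReal.ofReal_pos.2 hδ)
    exact ⟨a, ENNReal.toReal_le_of_le_ofReal hδ.le ha⟩

/-- if `g` is orthogonal to functions of the initial position, then it is orthogonal to functions of any position. -/
lemma flow_zero (h : LagFlow T β η X) {g : Ω → ℝ} (hg : Measurable g) (hg1 : ∀ ω, |g ω| ≤ 1)
    (hg0 : ∀ f : Torus d → ℝ, Measurable f → (∀ x, |f x| ≤ 1) → ∫ ω, g ω * f (X 0 ω) ∂η = 0)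
    {T' : ℝ} (hT' : 0 ≤ T') (hTT : T' ≤ T) (hS : SmallComm T' β) :
    ∀ f : Torus d → ℝ, Measurable f → Integrable f volume → ∀ t ∈ Icc 0 T', ∫ ω, g ω * f (X t ω) ∂η = 0 := by
  have hex : ∀ t, ∃ u : Torus d → ℝ, Measurable u ∧ (∀ x, |u x| ≤ 1) ∧ (t ∈ Icc 0 T →
      ∀ f : Torus d → ℝ, Measurable f → Integrable f volume → ∫ γ, g γ * f (X t γ) ∂η = ∫ x, u x * f x) := by
    intro t
    by_cases ht : t ∈ Icc 0 T
    · obtain ⟨u, h1, h2, h3⟩ := exists_density η (h.measXt t) (h.marg t ht) hg hg1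
      exact ⟨u, h1, h2, fun _ => h3⟩
    · exact ⟨fun _ => 0, measurable_const, by simp, fun h => absurd h ht⟩
  choose u hu hu1 hug using hex
  have hc := flow_const h hg hg1 hu hu1 hug hT' hTT hS
  have h00 : (0:ℝ) ∈ Icc 0 T := ⟨le_rfl, hT'.trans hTT⟩
  have ui : ∀ t, Integrable (u t) volume := fun t =>
    Integrable.mono' (integrable_const 1) (hu t).aestronglyMeasurable (Eventually.of_forall (hu1 t))
  have h0 : ∫ x, u 0 x * u 0 x = 0 := by
    rw [← hug 0 h00 (u 0) (hu 0) (ui 0)]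
    exact hg0 _ (hu 0) (hu1 0)
  intro f hf hfi t ht
  have hz := hc t ht
  rw [h0] at hz
  have hu0 : ∀ᵐ x, u t x = 0 := by
    have i2 : Integrable (fun x => u t x * u t x) volume := 
      (ui t).bdd_mul (c := 1) (hu t).aestronglyMeasurable (Eventually.of_forall (hu1 t))
    have := (integral_eq_zero_iff_of_nonneg (fun x => mul_self_nonneg (u t x)) i2).1 hz
    filter_upwards [this] with x hx
    exact mul_self_eq_zero.1 hx
  rw [hug t ⟨ht.1, ht.2.trans hTT⟩ f hf hfi]
  refine integral_eq_zero_of_ae ?_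
  filter_upwards [hu0] with x hx
  simp [hx]
end

noncomputable section
set_option linter.unusedSectionVars false

/-- validity -/
def Valid {T : ℝ} {d : ℕ} (hT : 0 < T) (b : ℝ → Torus d → Vec d) (η : Measure (PathSpace T d)) : Prop :=
  IsProbabilityMeasure η ∧ ConcentratedOnCurves hT.le b η ∧
      ∀ t : Set.Icc (0 : ℝ) T,
        Measure.map (fun γ : PathSpace T d => γ t) η = (volume : Measure (Torus d))

/-- coordinates of the field -/
def bet {d : ℕ} (b : ℝ → Torus d → Vec d) : ℝ → Torus d → Fin d → ℝ := fun t x => (b t x).ofLp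

lemma meas_bet {d : ℕ} {b : ℝ → Torus d → Vec d} (hb : Measurable (Function.uncurry b)) :
    Measurable (Function.uncurry (bet b)) := by
  have : Continuous (WithLp.ofLp : Vec d → Fin d → ℝ) := PiLp.continuous_ofLp 2 _
  exact this.measurable.comp hb

lemma norm_ofLp_le {d : ℕ} (v : Vec d) : ‖v.ofLp‖ ≤ ‖v‖ := by
  rw [pi_norm_le_iff_of_nonneg (norm_nonneg _)]
  intro i
  exact PiLp.norm_apply_le v i

lemma l1_bet {T : ℝ} {d : ℕ} {b : ℝ → Torus d → Vec d} 
    (hbL1 : ∫⁻ t in Set.Ioo 0 T, ∫⁻ x, (‖b t x‖₊ : ℝ≥0∞) ∂(volume : Measure (Torus d)) < ∞) :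
    ∫⁻ t in Ioc 0 T, ∫⁻ x, ‖bet b t x‖ₑ < ∞ := by
  rw [← setLIntegral_congr (Ioo_ae_eq_Ioc (μ := volume) (a := (0:ℝ)) (b := T))]
  refine lt_of_le_of_lt (lintegral_mono fun t => lintegral_mono fun x => ?_) hbL1
  exact enorm_le_iff_norm_le.2 (norm_ofLp_le _)

lemma ofLp_integral {α : Type*} [MeasurableSpace α] {d : ℕ} (f : α → Vec d) (μ : Measure α) : 
    (∫ s, f s ∂μ).ofLp = ∫ s, (f s).ofLp ∂μ :=
  ((PiLp.continuousLinearEquiv 2 ℝ (fun _ : Fin d => ℝ)).integral_comp_comm f).symm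

lemma Integrable_ofLp {α : Type*} [MeasurableSpace α] {d : ℕ} {f : α → Vec d} {μ : Measure α} (h : Integrable f μ) : 
    Integrable (fun s => (f s).ofLp) μ :=
  ((PiLp.continuousLinearEquiv 2 ℝ (fun _ : Fin d => ℝ)) : Vec d →L[ℝ] (Fin d → ℝ)).integrable_comp h

lemma meas_ext {T : ℝ} {d : ℕ} (hT : 0 ≤ T) : 
    Measurable (Function.uncurry fun t (γ : PathSpace T d) => extendPath hT γ t) := by
  have : Continuous (Function.uncurry fun t (γ : PathSpace T d) => extendPath hT γ t) := by
    have h1 : Continuous fun q : ℝ × PathSpace T d => (q.2, projIcc 0 T hT q.1) := 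
      continuous_snd.prodMk (continuous_projIcc.comp continuous_fst)
    have h2 : Continuous fun q : PathSpace T d × Icc 0 T => q.1 q.2 := ContinuousEval.continuous_eval
    exact h2.comp h1
  exact this.measurable

lemma Valid.lagFlow {T : ℝ} {d : ℕ} {hT : 0 < T} {b : ℝ → Torus d → Vec d} {η : Measure (PathSpace T d)}
    (h : Valid hT b η) (hb : Measurable (Function.uncurry b))
    (hbL1 : ∫⁻ t in Set.Ioo 0 T, ∫⁻ x, (‖b t x‖₊ : ℝ≥0∞) ∂(volume : Measure (Torus d)) < ∞) :
    LagFlow T (bet b) η (fun t γ => extendPath hT.le γ t) where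
  measX := meas_ext hT.le
  measβ := meas_bet hb
  l1 := l1_bet hbL1
  marg := fun t ht => h.2.2 (projIcc 0 T hT.le t)
  curve := by
    filter_upwards [h.2.1] with γ hγ
    refine ⟨Integrable_ofLp hγ.1, fun t ht => ?_⟩
    have := hγ.2 ⟨t, ht⟩
    rw [projT_eq, ofLp_integral] at this
    simp only [extendPath, projIcc_of_mem hT.le ht, projIcc_left]
    exact this

lemma exists_embed (d : ℕ) : ∃ φ : Torus d → ℝ, Measurable φ ∧ Function.Injective φ ∧ ∀ x, |φ x| ≤ 1 := by
  obtain ⟨f, hf⟩ := exists_measurableEmbedding_real (Torus d)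
  refine ⟨fun x => Real.sin (Real.arctan (f x)), Real.measurable_sin.comp (Real.measurable_arctan.comp hf.measurable), ?_, 
    fun x => Real.abs_sin_le_one _⟩
  intro x y hxy
  have h1 := Real.injOn_sin (x₁ := Real.arctan (f x)) ⟨(Real.neg_pi_div_two_lt_arctan _).le, (Real.arctan_lt_pi_div_two _).le⟩
    (x₂ := Real.arctan (f y)) ⟨(Real.neg_pi_div_two_lt_arctan _).le, (Real.arctan_lt_pi_div_two _).le⟩ hxy
  exact hf.injective (Real.arctan_injective h1)

lemma flow_det {Ω : Type*} [MeasurableSpace Ω] {d : ℕ} {T : ℝ} {β : ℝ → Torus d → Fin d → ℝ}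
    {η : Measure Ω} [IsProbabilityMeasure η] {X : ℝ → Ω → Torus d} (h : LagFlow T β η X) 
    (hS : ∀ T', 0 ≤ T' → T' < T → SmallComm T' β) {t : ℝ} (ht : t ∈ Ico 0 T) {φ : Torus d → ℝ} (hφ : Measurable φ)
    (hφ1 : ∀ x, |φ x| ≤ 1) : ∃ u : Torus d → ℝ, Measurable u ∧ ∀ᵐ ω ∂η, φ (X t ω) = u (X 0 ω) := by
  have h00 : (0:ℝ) ∈ Icc 0 T := ⟨le_rfl, ht.1.trans ht.2.le⟩
  obtain ⟨u, hu, hu1, hug⟩ := exists_density η (h.measXt 0) (h.marg 0 h00) (hφ.comp (h.measXt t)) (fun ω => hφ1 _)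
  refine ⟨u, hu, ?_⟩
  have mY : Measurable fun ω => φ (X t ω) := hφ.comp (h.measXt t)
  have mZ : Measurable fun ω => u (X 0 ω) := hu.comp (h.measXt 0)
  have bi : ∀ {f : Ω → ℝ}, Measurable f → (∀ ω, |f ω| ≤ 1) → Integrable f η := fun hf h1 => 
    Integrable.mono' (integrable_const 1) hf.aestronglyMeasurable (Eventually.of_forall h1)
  have bm : ∀ {a b : ℝ}, |a| ≤ 1 → |b| ≤ 1 → |a * b| ≤ 1 := fun ha hb => by
    rw [abs_mul]; exact mul_le_one₀ ha (abs_nonneg _) hb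
  set g : Ω → ℝ := fun ω => (φ (X t ω) - u (X 0 ω)) / 2 with hg
  have gm : Measurable g := (mY.sub mZ).div_const 2
  have g1 : ∀ ω, |g ω| ≤ 1 := fun ω => by
    have h1 := abs_le.1 (hφ1 (X t ω)); have h2 := abs_le.1 (hu1 (X 0 ω))
    rw [abs_le]; constructor <;> simp only [hg] <;> linarith
  have g0 : ∀ f : Torus d → ℝ, Measurable f → (∀ x, |f x| ≤ 1) → ∫ ω, g ω * f (X 0 ω) ∂η = 0 := by
    intro f hf hf1
    have hfi : Integrable f volume := Integrable.mono' (integrable_const 1) hf.aestronglyMeasurable (Eventually.of_forall hf1)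
    have e1 := hug f hf hfi
    have e2 : ∫ ω, u (X 0 ω) * f (X 0 ω) ∂η = ∫ x, u x * f x := by
      rw [← h.marg 0 h00]
      exact (integral_map (f := fun x => u x * f x) (h.measXt 0).aemeasurable (hu.mul hf).aestronglyMeasurable).symm
    have e3 : ∀ ω, g ω * f (X 0 ω) = (1/2) * (φ (X t ω) * f (X 0 ω)) - (1/2) * (u (X 0 ω) * f (X 0 ω)) := fun ω => by
      simp only [hg]; ring
    simp only [e3]
    rw [integral_sub, integral_const_mul, integral_const_mul, e2]
    · simp only [Function.comp] at e1
      rw [e1, sub_self]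
    · exact (bi (mY.mul (hf.comp (h.measXt 0))) fun ω => bm (hφ1 _) (hf1 _)).const_mul _
    · exact (bi (mZ.mul (hf.comp (h.measXt 0))) fun ω => bm (hu1 _) (hf1 _)).const_mul _
  have hφi : Integrable φ volume := Integrable.mono' (integrable_const 1) hφ.aestronglyMeasurable (Eventually.of_forall hφ1)
  have z1 := flow_zero h gm g1 g0 ht.1 ht.2.le (hS t ht.1 ht.2) φ hφ hφi t ⟨ht.1, le_rfl⟩
  have z2 := g0 u hu hu1
  have z3 : ∫ ω, g ω * g ω ∂η = 0 := by
    have e3 : ∀ ω, g ω * g ω = (1/2) * (g ω * φ (X t ω)) - (1/2) * (g ω * u (X 0 ω)) := fun ω => by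
      simp only [hg]; ring
    simp only [e3]
    rw [integral_sub, integral_const_mul, integral_const_mul, z1, z2]
    · simp
    · exact (bi (gm.mul mY) fun ω => bm (g1 _) (hφ1 _)).const_mul _
    · exact (bi (gm.mul mZ) fun ω => bm (g1 _) (hu1 _)).const_mul _
  have z4 := (integral_eq_zero_iff_of_nonneg (fun x => mul_self_nonneg (g x)) (bi (gm.mul gm) fun ω => bm (g1 _) (g1 _))).1 z3
  filter_upwards [z4] with ω hω
  have := mul_self_eq_zero.1 hω
  simp only [hg] at this
  linarith

lemma Valid.det {T : ℝ} {d : ℕ} {hT : 0 < T} {b : ℝ → Torus d → Vec d} {η : Measure (PathSpace T d)}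
    (h : Valid hT b η) (hb : Measurable (Function.uncurry b))
    (hbL1 : ∫⁻ t in Set.Ioo 0 T, ∫⁻ x, (‖b t x‖₊ : ℝ≥0∞) ∂(volume : Measure (Torus d)) < ∞) 
    (hS : ∀ T', 0 ≤ T' → T' < T → SmallComm T' (bet b)) :
    ∃ γY : Torus d → PathSpace T d, Measurable γY ∧ ∀ᵐ γ ∂η, γ = γY (γ ⟨0, Set.left_mem_Icc.2 hT.le⟩) := by
  have := h.1
  obtain ⟨φ, hφ, hφi, hφ1⟩ := exists_embed d
  obtain ⟨D, hDc, hDd⟩ := TopologicalSpace.exists_countable_dense (Ico (0:ℝ) T)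
  have : Countable D := hDc.to_subtype
  set Φ : PathSpace T d → (D → ℝ) := fun γ t => φ (extendPath hT.le γ (t : Ico (0:ℝ) T)) with hΦ
  have mext : ∀ t, Measurable fun γ : PathSpace T d => extendPath hT.le γ t := fun t => 
    (meas_ext hT.le).comp (measurable_const.prodMk measurable_id)
  have Φm : Measurable Φ := measurable_pi_lambda _ fun t => hφ.comp (mext _)
  have Φi : Function.Injective Φ := by
    intro γ γ' hγ
    have h1 : ∀ t : D, extendPath hT.le γ (t : Ico (0:ℝ) T) = extendPath hT.le γ' (t : Ico (0:ℝ) T) := fun t => 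
      hφi (congrFun hγ t)
    have hcont : ∀ γ : PathSpace T d, Continuous fun t : ℝ => extendPath hT.le γ t := fun γ => 
      γ.continuous.comp continuous_projIcc
    have h2 : (fun t : Ico (0:ℝ) T => extendPath hT.le γ t) = fun t : Ico (0:ℝ) T => extendPath hT.le γ' t :=
      Continuous.ext_on hDd ((hcont γ).comp continuous_subtype_val) ((hcont γ').comp continuous_subtype_val) 
        (fun t ht => h1 ⟨t, ht⟩)
    have h3 : EqOn (fun t => extendPath hT.le γ t) (fun t => extendPath hT.le γ' t) (closure (Ico 0 T)) := 
      EqOn.closure (fun t ht => congrFun h2 ⟨t, ht⟩) (hcont γ) (hcont γ')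
    rw [closure_Ico hT.ne] at h3
    ext1 t
    have := h3 t.2
    simpa [extendPath] using this
  have Φe : MeasurableEmbedding Φ := Φm.measurableEmbedding Φi
  have hne : Nonempty (PathSpace T d) := ⟨ContinuousMap.const _ 0⟩
  obtain ⟨Ψ, hΨ, hΨΦ⟩ := Φe.exists_measurable_extend (g := id) measurable_id (fun _ => hne)
  choose U hU hUe using fun t : D => flow_det (h.lagFlow hb hbL1) hS (t := ((t : Ico (0:ℝ) T) : ℝ)) (t : Ico (0:ℝ) T).2 hφ hφ1
  refine ⟨fun y => Ψ fun t => U t y, hΨ.comp (measurable_pi_lambda _ hU), ?_⟩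
  filter_upwards [ae_all_iff.2 hUe] with γ hγ
  have e1 : Φ γ = fun t => U t (γ ⟨0, Set.left_mem_Icc.2 hT.le⟩) := by
    funext t
    have := hγ t
    simp only [extendPath, projIcc_left] at this
    exact this
  rw [← e1]
  exact (congrFun hΨΦ γ).symm

lemma meas_e0 {T : ℝ} {d : ℕ} (t : Icc (0:ℝ) T) : Measurable fun γ : PathSpace T d => γ t :=
  (continuous_eval_const t).measurable

lemma Valid.disint {T : ℝ} {d : ℕ} {hT : 0 < T} {b : ℝ → Torus d → Vec d} {η : Measure (PathSpace T d)}
    (h : Valid hT b η) (hb : Measurable (Function.uncurry b))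
    (hbL1 : ∫⁻ t in Set.Ioo 0 T, ∫⁻ x, (‖b t x‖₊ : ℝ≥0∞) ∂(volume : Measure (Torus d)) < ∞) 
    (hS : ∀ T', 0 ≤ T' → T' < T → SmallComm T' (bet b)) :
    ∃ γY : Torus d → PathSpace T d, Measurable γY ∧
        ∀ k : Torus d → Measure (PathSpace T d),
          IsProbDisintegration η
            (fun γ : PathSpace T d => γ ⟨0, Set.left_mem_Icc.2 hT.le⟩)
            (volume : Measure (Torus d)) k →
          ∀ᵐ y ∂(volume : Measure (Torus d)), k y = Measure.dirac (γY y) := by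
  obtain ⟨γY, hm, hY⟩ := h.det hb hbL1 hS
  refine ⟨γY, hm, fun k hk => ?_⟩
  obtain ⟨hk1, hk2, hk3, hk4⟩ := hk
  set A : Set (PathSpace T d) := {γ | γ = γY (γ ⟨0, Set.left_mem_Icc.2 hT.le⟩)} with hA
  have mA : MeasurableSet A := measurableSet_eq_fun measurable_id (hm.comp (meas_e0 _))
  have h0 : ∫⁻ y, k y Aᶜ = 0 := by
    rw [← hk4 _ mA.compl]
    exact hY
  rw [lintegral_eq_zero_iff (hk2 _ mA.compl)] at h0
  filter_upwards [h0] with y hy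
  have := hk1 y
  have e1 : ∀ᵐ γ ∂(k y), γ = γY y := by
    have a1 : ∀ᵐ γ ∂(k y), γ = γY (γ ⟨0, Set.left_mem_Icc.2 hT.le⟩) := hy
    have a2 : ∀ᵐ γ ∂(k y), γ ⟨0, Set.left_mem_Icc.2 hT.le⟩ = y := hk3 y
    filter_upwards [a1, a2] with γ h1 h2
    rw [h1, h2]
  have e2 : (k y).map id = (k y).map (fun _ => γY y) := Measure.map_congr e1
  rw [Measure.map_id, Measure.map_const] at e2
  rw [e2]; simp

lemma Valid.unique {T : ℝ} {d : ℕ} {hT : 0 < T} {b : ℝ → Torus d → Vec d} {η η' : Measure (PathSpace T d)}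
    (h : Valid hT b η) (h' : Valid hT b η') (hb : Measurable (Function.uncurry b))
    (hbL1 : ∫⁻ t in Set.Ioo 0 T, ∫⁻ x, (‖b t x‖₊ : ℝ≥0∞) ∂(volume : Measure (Torus d)) < ∞) 
    (hS : ∀ T', 0 ≤ T' → T' < T → SmallComm T' (bet b)) : η = η' := by
  have hp := h.1
  have hp' := h'.1
  have hsum : ∀ {α : Type} [MeasurableSpace α] (μ : Measure α), (2⁻¹ : ℝ≥0∞) • (μ + μ) = μ := by
    intro α _ μ
    rw [← two_smul ℝ≥0∞ μ, smul_smul, ENNReal.inv_mul_cancel (by norm_num) (by norm_num), one_smul]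
  have hv : Valid hT b ((2⁻¹ : ℝ≥0∞) • (η + η')) := by
    refine ⟨⟨?_⟩, ?_, ?_⟩
    · simp only [Measure.smul_apply, Measure.add_apply, measure_univ, smul_eq_mul]
      rw [one_add_one_eq_two, ENNReal.inv_mul_cancel (by norm_num) (by norm_num)]
    · unfold ConcentratedOnCurves
      refine Measure.ae_smul_measure ?_ _
      rw [ae_add_measure_iff]
      exact ⟨h.2.1, h'.2.1⟩
    · intro t
      rw [Measure.map_smul, Measure.map_add _ _ (meas_e0 t), h.2.2 t, h'.2.2 t, hsum]
  obtain ⟨γY, hm, hY⟩ := hv.det hb hbL1 hS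
  rw [Measure.ae_ennreal_smul_measure_iff (by norm_num), ae_add_measure_iff] at hY
  have key : ∀ {μ : Measure (PathSpace T d)}, Valid hT b μ → 
      (∀ᵐ γ ∂μ, γ = γY (γ ⟨0, Set.left_mem_Icc.2 hT.le⟩)) → μ = (volume : Measure (Torus d)).map γY := by
    intro μ hμ hae
    rw [← hμ.2.2 ⟨0, Set.left_mem_Icc.2 hT.le⟩, Measure.map_map hm (meas_e0 _)]
    conv_lhs => rw [← Measure.map_id (μ := μ)]
    exact Measure.map_congr hae
  rw [key h hY.1, key h' hY.2]
end

noncomputable section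
open scoped ContDiff
set_option linter.unusedSectionVars false

variable {d : ℕ}

/-- smooth functions on the torus -/
def Tst (ψ : Torus d → ℝ) : Prop := ContDiff ℝ ∞ (fun x => ψ (pr x))

lemma Tst.continuous {ψ : Torus d → ℝ} (h : Tst ψ) : Continuous ψ :=
  continuous_of_comp_pr (ContDiff.continuous h)

lemma lf_norm_le (w : Torus d) : ‖lf w‖ ≤ 1/2 := by
  rw [pi_norm_le_iff_of_nonneg (by norm_num)]
  intro i
  have := lf_mem w i
  rw [Real.norm_eq_abs, abs_le]
  constructor <;> [linarith [this.1]; linarith [this.2]]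

lemma Tst.tc1 {ψ : Torus d → ℝ} (h : Tst ψ) : TC1 ψ := by
  refine ⟨h.continuous, h.differentiable (by simp), ?_⟩
  have hc : Continuous (fderiv ℝ fun x : Fin d → ℝ => ψ (pr x)) := h.continuous_fderiv (by simp)
  obtain ⟨C, hC⟩ := ((isCompact_closedBall (0 : Fin d → ℝ) (1/2)).image hc).isBounded.exists_norm_le
  refine ⟨C, fun x => ?_⟩
  rw [← fderiv_pr_congr ψ (pr_lf (pr x))]
  exact hC _ ⟨_, by simpa using lf_norm_le (pr x), rfl⟩

lemma Tst.comp_add {ψ : Torus d → ℝ} (h : Tst ψ) (a : Fin d → ℝ) : Tst fun x => ψ (x + pr a) := by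
  unfold Tst
  have : (fun x => ψ (pr x + pr a)) = (fun x => ψ (pr x)) ∘ (fun x => x + a) := by
    funext x; simp [pr_add]
  rw [this]
  exact ContDiff.comp h (contDiff_id.add contDiff_const)

lemma fourier_pr (x : Fin d → ℝ) (i : Fin d) : (fourier 1 (pr x i) : ℂ) = Complex.exp ((2 * Real.pi * x i : ℝ) * Complex.I) := by
  have : pr x i = ((x i : ℝ) : AddCircle (1:ℝ)) := rfl
  rw [this, fourier_coe_apply]
  congr 1
  push_cast
  ring

lemma Tst_re (i : Fin d) : Tst fun x : Torus d => (fourier 1 (x i) : ℂ).re := by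
  unfold Tst
  simp only [fourier_pr, Complex.exp_ofReal_mul_I_re]
  fun_prop

lemma Tst_im (i : Fin d) : Tst fun x : Torus d => (fourier 1 (x i) : ℂ).im := by
  unfold Tst
  simp only [fourier_pr, Complex.exp_ofReal_mul_I_im]
  fun_prop

/-- algebra of smooth functions -/
def tstAlg (d : ℕ) : Subalgebra ℝ C(Torus d, ℝ) where
  carrier := {f | Tst f}
  mul_mem' := fun {a b} ha hb => ContDiff.mul (show ContDiff ℝ ∞ (fun x => a (pr x)) from ha) (show ContDiff ℝ ∞ (fun x => b (pr x)) from hb)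
  add_mem' := fun {a b} ha hb => ContDiff.add (show ContDiff ℝ ∞ (fun x => a (pr x)) from ha) (show ContDiff ℝ ∞ (fun x => b (pr x)) from hb)
  algebraMap_mem' := fun r => by
    change ContDiff ℝ ∞ (fun x => _)
    exact contDiff_const

lemma tst_dense (f : C(Torus d, ℝ)) {δ : ℝ} (hδ : 0 < δ) : 
    ∃ ψ : C(Torus d, ℝ), Tst ψ ∧ ∀ x, |ψ x - f x| < δ := by
  have hsep : (tstAlg d).SeparatesPoints := by
    intro x y hxy
    obtain ⟨i, hi⟩ := Function.ne_iff.1 hxy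
    by_contra hcon
    have h1 : ∀ ψ : C(Torus d, ℝ), Tst ψ → ψ x = ψ y := by
      intro ψ hψ
      by_contra hne
      exact hcon ⟨ψ, ⟨ψ, hψ, rfl⟩, hne⟩
    have hre := h1 ⟨_, (Tst_re i).continuous⟩ (Tst_re i)
    have him := h1 ⟨_, (Tst_im i).continuous⟩ (Tst_im i)
    simp only [ContinuousMap.coe_mk] at hre him
    have : (fourier 1 (x i) : ℂ) = fourier 1 (y i) := Complex.ext hre him
    rw [fourier_apply, fourier_apply, one_smul, one_smul] at this
    exact hi (AddCircle.injective_toCircle one_ne_zero (Subtype.ext this))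
  have := ContinuousMap.exists_mem_subalgebra_near_continuousMap_of_separatesPoints (tstAlg d) hsep f δ hδ
  obtain ⟨g, hg⟩ := this
  exact ⟨g, g.2, fun x => ((g : C(Torus d, ℝ)) - f).norm_coe_le_norm x |>.trans_lt hg⟩

lemma mp_unit (d : ℕ) : MeasurePreserving (projT d) (volume.restrict (unitCube d)) (volume : Measure (Torus d)) := by
  have h1 := PiLp.volume_preserving_ofLp (Fin d)
  have h2 : MeasurableSet (univ.pi fun _ : Fin d => Ico (0:ℝ) 1) := MeasurableSet.univ_pi fun _ => measurableSet_Ico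
  have h3 := h1.restrict_preimage h2
  have e1 : (WithLp.ofLp : Vec d → Fin d → ℝ) ⁻¹' (univ.pi fun _ : Fin d => Ico (0:ℝ) 1) = unitCube d := by
    ext x; simp [unitCube]
  rw [e1] at h3
  have e2 : (volume : Measure (Fin d → ℝ)).restrict (univ.pi fun _ : Fin d => Ico (0:ℝ) 1) = 
      volume.restrict (cubeC d 0) := by
    refine Measure.restrict_congr_set ?_
    have a1 := Measure.univ_pi_Ico_ae_eq_Icc (μ := fun _ : Fin d => (volume : Measure ℝ)) (f := fun _ => 0) (g := fun _ => 1)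
    have a2 := Measure.univ_pi_Ioc_ae_eq_Icc (μ := fun _ : Fin d => (volume : Measure ℝ)) (f := fun _ => 0) (g := fun _ => 1)
    have := a1.trans a2.symm
    simp only [cubeC, zero_add]
    exact this
  rw [e2] at h3
  have h4 := (mp_pr d 0).comp h3
  exact h4

lemma unit_integral {F : Torus d → ℝ} (hF : Measurable F) : ∫ x in unitCube d, F (projT d x) = ∫ x, F x := by
  rw [← (mp_unit d).map_eq, integral_map (mp_unit d).measurable.aemeasurable hF.aestronglyMeasurable]

lemma Tst.contDiff_projT {ψ : Torus d → ℝ} (h : Tst ψ) : ContDiff ℝ (⊤ : ℕ∞) fun x => ψ (projT d x) := by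
  have : (fun x : Vec d => ψ (projT d x)) = (fun x => ψ (pr x)) ∘ (PiLp.continuousLinearEquiv 2 ℝ (fun _ : Fin d => ℝ)) := rfl
  rw [this]
  exact ContDiff.comp h (ContinuousLinearEquiv.contDiff _)

lemma fderiv_projT {ψ : Torus d → ℝ} (h : TC1 ψ) (x : Vec d) (i : Fin d) : 
    fderiv ℝ (fun x => ψ (projT d x)) x (EuclideanSpace.single i 1) = dT ψ (projT d x) (Pi.single i 1) := by
  have h1 := (h.hasFDerivAt x.ofLp).comp x (PiLp.continuousLinearEquiv 2 ℝ (fun _ : Fin d => ℝ)).hasFDerivAt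
  have h2 : HasFDerivAt (fun x => ψ (projT d x)) _ x := h1
  rw [h2.fderiv]
  rfl

/-- integration by parts structure at a fixed time -/
structure IBP (v : Torus d → Fin d → ℝ) (Dp Dm : Fin d → Fin d → Measure (Torus d)) : Prop where
  meas : Measurable v
  int : Integrable v volume
  finp : ∀ i j, IsFiniteMeasure (Dp i j)
  finm : ∀ i j, IsFiniteMeasure (Dm i j)
  ibp : ∀ i j (ψ : Torus d → ℝ), Tst ψ → 
    ∫ x, v x j * dT ψ x (Pi.single i 1) = -((∫ y, ψ y ∂(Dp i j)) - ∫ y, ψ y ∂(Dm i j))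
  div : ∀ ψ : Torus d → ℝ, Tst ψ → ∫ x, ∑ i, v x i * dT ψ x (Pi.single i 1) = 0

lemma IBP.of {u : Torus d → Vec d} (hu : Measurable u) (hi : ∫⁻ x, ‖u x‖ₑ < ⊤) {Dp Dm : Fin d → Fin d → Measure (Torus d)} 
    (h : HasBVStructure d u Dp Dm) 
    (hdiv : ∀ φ : Vec d → ℝ, ContDiff ℝ (⊤ : ℕ∞) φ →
      (∀ x y : Vec d, projT d x = projT d y → φ x = φ y) →
      ∫ x in unitCube d, ∑ i, u (projT d x) i * fderiv ℝ φ x (EuclideanSpace.single i 1) = 0) : 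
    IBP (fun x => (u x).ofLp) Dp Dm where
  meas := (PiLp.continuous_ofLp 2 _).measurable.comp hu
  int := Integrable_ofLp ⟨hu.aestronglyMeasurable, hi⟩
  finp := fun i j => ⟨(h.1 i j).1⟩
  finm := fun i j => ⟨(h.1 i j).2⟩
  ibp := by
    intro i j ψ hψ
    have := h.2 i j (fun x => ψ (projT d x)) ψ hψ.contDiff_projT (fun _ => rfl)
    rw [← this]
    simp only [fderiv_projT hψ.tc1]
    symm
    refine unit_integral (F := fun x => (u x).ofLp j * dT ψ x (Pi.single i 1)) ?_
    exact ((measurable_pi_apply j).comp ((PiLp.continuous_ofLp 2 _).measurable.comp hu)).mul 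
      (meas_clm_apply (measurable_dT ψ) measurable_const)
  div := by
    intro ψ hψ
    have := hdiv (fun x => ψ (projT d x)) hψ.contDiff_projT (fun x y hxy => by simp [hxy])
    rw [← this]
    simp only [fderiv_projT hψ.tc1]
    symm
    refine unit_integral (F := fun x => ∑ i, (u x).ofLp i * dT ψ x (Pi.single i 1)) ?_
    exact Finset.measurable_sum _ fun i _ => ((measurable_pi_apply i).comp ((PiLp.continuous_ofLp 2 _).measurable.comp hu)).mul 
      (meas_clm_apply (measurable_dT ψ) measurable_const)
end

noncomputable section
set_option linter.unusedSectionVars false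

variable {d : ℕ}

lemma dual_L1 {μ : Measure (Torus d)} [IsFiniteMeasure μ] {K : Torus d → ℝ} (hK : Integrable K μ) {B : ℝ}
    (h : ∀ ζ : C(Torus d, ℝ), (∀ x, |ζ x| ≤ 1) → ∫ x, ζ x * K x ∂μ ≤ B) : ∫ x, |K x| ∂μ ≤ B := by
  have key : ∀ ε > 0, ∫ x, |K x| ∂μ ≤ B + (2 + μ.real univ) * ε := by
    intro ε hε
    obtain ⟨g, hg, hgi⟩ := hK.exists_boundedContinuous_integral_sub_le hε
    have hpos : ∀ x, 0 < |g x| + ε := fun x => by positivity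
    have hcont : Continuous fun x => g x / (|g x| + ε) :=
      g.continuous.div (g.continuous.abs.add continuous_const) (fun x => (hpos x).ne')
    have hz1 : ∀ x, |g x / (|g x| + ε)| ≤ 1 := by
      intro x
      rw [abs_div, abs_of_pos (hpos x), div_le_one (hpos x)]
      linarith
    have h1 := h ⟨_, hcont⟩ hz1
    simp only [ContinuousMap.coe_mk] at h1
    have hpt : ∀ x, |K x| ≤ g x / (|g x| + ε) * K x + (2 * ‖K x - g x‖ + ε) := by
      intro x
      have e1 : |g x| - ε ≤ g x / (|g x| + ε) * g x := by
        rw [div_mul_eq_mul_div, le_div_iff₀ (hpos x)]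
        have := sq_abs (g x)
        nlinarith [sq_nonneg ε]
      have e2 : |g x / (|g x| + ε) * (K x - g x)| ≤ |K x - g x| := by
        rw [abs_mul]
        exact mul_le_of_le_one_left (abs_nonneg _) (hz1 x)
      have e3 := (abs_le.1 e2).1
      have e4 := abs_sub_abs_le_abs_sub (K x) (g x)
      rw [Real.norm_eq_abs]
      nlinarith
    have i1 : Integrable (fun x => g x / (|g x| + ε) * K x) μ :=
      hK.bdd_mul (c := 1) hcont.aestronglyMeasurable (Eventually.of_forall fun x => hz1 x)
    have i2 : Integrable (fun x => 2 * ‖K x - g x‖ + ε) μ :=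
      ((hK.sub hgi).norm.const_mul 2).add (integrable_const ε)
    calc ∫ x, |K x| ∂μ ≤ ∫ x, (g x / (|g x| + ε) * K x + (2 * ‖K x - g x‖ + ε)) ∂μ :=
          integral_mono hK.abs (i1.add i2) hpt
      _ = ∫ x, g x / (|g x| + ε) * K x ∂μ + (2 * ∫ x, ‖K x - g x‖ ∂μ + μ.real univ * ε) := by
          have i3 : Integrable (fun x => 2 * ‖K x - g x‖) μ := (hK.sub hgi).norm.const_mul 2
          rw [integral_add i1 i2, integral_add i3 (integrable_const ε),
            integral_const_mul, integral_const, smul_eq_mul]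
      _ ≤ _ := by nlinarith
  refine le_of_forall_pos_le_add fun δ hδ => ?_
  have hp : 0 < 2 + μ.real univ := by positivity
  have := key (δ / (2 + μ.real univ)) (by positivity)
  rwa [mul_div_cancel₀ _ hp.ne'] at this

/-- total variation bound measure -/
def muOf (Dp Dm : Fin d → Fin d → Measure (Torus d)) : Measure (Torus d) :=
  ∑ i, ∑ j, (Dp i j + Dm i j)

/-- density matrix -/
def mOf (Dp Dm : Fin d → Fin d → Measure (Torus d)) (x : Torus d) : Fin d → Fin d → ℝ :=
  fun i j => ((Dp i j).rnDeriv (muOf Dp Dm) x).toReal - ((Dm i j).rnDeriv (muOf Dp Dm) x).toReal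

lemma muOf_univ (Dp Dm : Fin d → Fin d → Measure (Torus d)) : 
    muOf Dp Dm univ = ∑ i, ∑ j, (Dp i j univ + Dm i j univ) := by
  simp [muOf, Measure.finsetSum_apply]

lemma le_muOf (Dp Dm : Fin d → Fin d → Measure (Torus d)) (i j : Fin d) : Dp i j + Dm i j ≤ muOf Dp Dm := by
  intro s
  simp only [muOf, Measure.finsetSum_apply]
  refine le_trans ?_ (Finset.single_le_sum (f := fun i => ∑ j, (Dp i j + Dm i j) s) (fun _ _ => zero_le) (Finset.mem_univ i))
  exact Finset.single_le_sum (f := fun j => (Dp i j + Dm i j) s) (fun _ _ => zero_le) (Finset.mem_univ j)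

variable {v : Torus d → Fin d → ℝ} {Dp Dm : Fin d → Fin d → Measure (Torus d)}

lemma IBP.fin (h : IBP v Dp Dm) : IsFiniteMeasure (muOf Dp Dm) := by
  constructor
  rw [muOf_univ]
  have := h.finp
  have := h.finm
  refine ENNReal.sum_lt_top.2 fun i _ => ENNReal.sum_lt_top.2 fun j _ => ?_
  exact ENNReal.add_lt_top.2 ⟨measure_lt_top _ _, measure_lt_top _ _⟩

lemma meas_mOf (Dp Dm : Fin d → Fin d → Measure (Torus d)) : Measurable (mOf Dp Dm) := by
  refine measurable_pi_iff.2 fun i => measurable_pi_iff.2 fun j => ?_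
  unfold mOf
  exact (Measure.measurable_rnDeriv _ _).ennreal_toReal.sub (Measure.measurable_rnDeriv _ _).ennreal_toReal

lemma IBP.bound (h : IBP v Dp Dm) : ∀ᵐ x ∂(muOf Dp Dm), ∀ i j, |mOf Dp Dm x i j| ≤ 1 := by
  have := h.fin
  rw [ae_all_iff]; intro i
  rw [ae_all_iff]; intro j
  have h1 := Measure.rnDeriv_le_one_of_le ((Measure.le_add_right le_rfl).trans (le_muOf Dp Dm i j) : Dp i j ≤ _)
  have h2 := Measure.rnDeriv_le_one_of_le ((Measure.le_add_left le_rfl).trans (le_muOf Dp Dm i j) : Dm i j ≤ _)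
  filter_upwards [h1, h2] with x a b
  have a' : ((Dp i j).rnDeriv (muOf Dp Dm) x).toReal ≤ 1 := ENNReal.toReal_le_of_le_ofReal zero_le_one (by simpa using a)
  have b' : ((Dm i j).rnDeriv (muOf Dp Dm) x).toReal ≤ 1 := ENNReal.toReal_le_of_le_ofReal zero_le_one (by simpa using b)
  have c : 0 ≤ ((Dp i j).rnDeriv (muOf Dp Dm) x).toReal := ENNReal.toReal_nonneg
  have e : 0 ≤ ((Dm i j).rnDeriv (muOf Dp Dm) x).toReal := ENNReal.toReal_nonneg
  rw [mOf, abs_le]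
  constructor <;> linarith

lemma IBP.int_m (h : IBP v Dp Dm) (i j : Fin d) : Integrable (fun x => mOf Dp Dm x i j) (muOf Dp Dm) := by
  have := h.fin
  refine Integrable.of_bound (C := 1) (((measurable_pi_apply j).comp ((measurable_pi_apply i).comp (meas_mOf Dp Dm))).aestronglyMeasurable) ?_
  filter_upwards [h.bound] with x hx using hx i j

lemma IBP.int_eq (h : IBP v Dp Dm) (i j : Fin d) {ψ : Torus d → ℝ} (hψ : Continuous ψ) : 
    (∫ y, ψ y ∂(Dp i j)) - ∫ y, ψ y ∂(Dm i j) = ∫ x, ψ x * mOf Dp Dm x i j ∂(muOf Dp Dm) := by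
  have := h.fin
  have := h.finp
  have := h.finm
  have l1 : Dp i j ≤ muOf Dp Dm := (Measure.le_add_right le_rfl).trans (le_muOf Dp Dm i j)
  have l2 : Dm i j ≤ muOf Dp Dm := (Measure.le_add_left le_rfl).trans (le_muOf Dp Dm i j)
  obtain ⟨C, hC⟩ := (isCompact_range hψ).isBounded.exists_norm_le
  have hC' : ∀ x, ‖ψ x‖ ≤ C := fun x => hC _ (mem_range_self x)
  rw [← integral_rnDeriv_smul (f := ψ) l1.absolutelyContinuous, ← integral_rnDeriv_smul (f := ψ) l2.absolutelyContinuous,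
    ← integral_sub]
  · refine integral_congr_ae (Eventually.of_forall fun x => ?_)
    simp only [mOf, smul_eq_mul]; ring
  · exact (Measure.integrable_toReal_rnDeriv).mul_bdd (c := C) hψ.aestronglyMeasurable (Eventually.of_forall hC')
  · exact (Measure.integrable_toReal_rnDeriv).mul_bdd (c := C) hψ.aestronglyMeasurable (Eventually.of_forall hC')

lemma Tst.dT_bdd {ψ : Torus d → ℝ} (hψ : Tst ψ) : ∃ C, ∀ x (h : Fin d → ℝ), ‖dT ψ x h‖ ≤ C * ‖h‖ := by
  obtain ⟨C, _, hC⟩ := hψ.tc1.bound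
  exact ⟨C, fun x h => ContinuousLinearMap.le_of_opNorm_le _ (hC x) h⟩

lemma IBP.int_dT (h : IBP v Dp Dm) {ψ : Torus d → ℝ} (hψ : Tst ψ) (w : (Fin d → ℝ) →L[ℝ] ℝ) (e : Fin d → ℝ) :
    Integrable (fun x => dT ψ x e * w (v x)) volume := by
  obtain ⟨C, hC⟩ := hψ.dT_bdd
  exact (w.integrable_comp h.int).bdd_mul (c := C * ‖e‖) 
    (meas_clm_apply (measurable_dT ψ) measurable_const).aestronglyMeasurable (Eventually.of_forall fun x => hC x e)

lemma clm_expand (w : (Fin d → ℝ) →L[ℝ] ℝ) (e : Fin d → ℝ) : w e = ∑ i, e i * w (Pi.single i 1) := by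
  conv_lhs => rw [← Finset.univ_sum_single e]
  rw [map_sum]
  refine Finset.sum_congr rfl fun i _ => ?_
  have : (Pi.single i (e i) : Fin d → ℝ) = e i • Pi.single i 1 := by
    rw [← Pi.single_smul]; simp
  rw [this, map_smul, smul_eq_mul]

lemma IBP.gen (h : IBP v Dp Dm) {ψ : Torus d → ℝ} (hψ : Tst ψ) (w : (Fin d → ℝ) →L[ℝ] ℝ) (e : Fin d → ℝ) :
    ∫ x, dT ψ x e * w (v x) = -∫ x, ψ x * w (Matrix.vecMul e (mOf Dp Dm x)) ∂(muOf Dp Dm) := by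
  have hf := h.fin
  obtain ⟨C, hC⟩ := (isCompact_range hψ.continuous).isBounded.exists_norm_le
  have hC' : ∀ x, ‖ψ x‖ ≤ C := fun x => hC _ (mem_range_self x)
  have e1 : ∀ x, dT ψ x e * w (v x) = ∑ i, ∑ j, (e i * w (Pi.single j 1)) * (v x j * dT ψ x (Pi.single i 1)) := by
    intro x
    rw [clm_expand (dT ψ x) e, clm_expand w (v x), Finset.sum_mul_sum]
    refine Finset.sum_congr rfl fun i _ => Finset.sum_congr rfl fun j _ => by ring
  have e2 : ∀ x, ψ x * w (Matrix.vecMul e (mOf Dp Dm x)) = ∑ i, ∑ j, (e i * w (Pi.single j 1)) * (ψ x * mOf Dp Dm x i j) := by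
    intro x
    rw [clm_expand w, Finset.mul_sum, Finset.sum_comm]
    refine Finset.sum_congr rfl fun j _ => ?_
    simp only [Matrix.vecMul, dotProduct]
    rw [Finset.sum_mul, Finset.mul_sum]
    refine Finset.sum_congr rfl fun i _ => by ring
  have i1 : ∀ i j, Integrable (fun x => (e i * w (Pi.single j 1)) * (v x j * dT ψ x (Pi.single i 1))) := by
    intro i j
    have := h.int_dT hψ (ContinuousLinearMap.proj j) (Pi.single i 1)
    refine Integrable.const_mul ?_ _
    simpa [mul_comm] using this
  have i2 : ∀ i j, Integrable (fun x => (e i * w (Pi.single j 1)) * (ψ x * mOf Dp Dm x i j)) (muOf Dp Dm) := by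
    intro i j
    exact ((h.int_m i j).bdd_mul (c := C) hψ.continuous.aestronglyMeasurable (Eventually.of_forall hC')).const_mul _
  simp_rw [e1, e2]
  rw [integral_finsetSum _ (fun i _ => integrable_finsetSum _ fun j _ => i1 i j),
    integral_finsetSum _ (fun i _ => integrable_finsetSum _ fun j _ => i2 i j), ← Finset.sum_neg_distrib]
  refine Finset.sum_congr rfl fun i _ => ?_
  rw [integral_finsetSum _ (fun j _ => i1 i j), integral_finsetSum _ (fun j _ => i2 i j), ← Finset.sum_neg_distrib]
  refine Finset.sum_congr rfl fun j _ => ?_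
  rw [integral_const_mul, integral_const_mul, h.ibp i j ψ hψ, h.int_eq i j hψ.continuous]
  ring

lemma IBP.trace (h : IBP v Dp Dm) : ∀ᵐ x ∂(muOf Dp Dm), Matrix.trace (mOf Dp Dm x) = 0 := by
  have hf := h.fin
  have hi : Integrable (fun x => Matrix.trace (mOf Dp Dm x)) (muOf Dp Dm) := by
    simp only [Matrix.trace, Matrix.diag]
    exact integrable_finsetSum _ fun i _ => h.int_m i i
  have hT : ∀ ψ : Torus d → ℝ, Tst ψ → ∫ x, ψ x * Matrix.trace (mOf Dp Dm x) ∂(muOf Dp Dm) = 0 := by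
    intro ψ hψ
    obtain ⟨C, hC⟩ := (isCompact_range hψ.continuous).isBounded.exists_norm_le
    have hC' : ∀ x, ‖ψ x‖ ≤ C := fun x => hC _ (mem_range_self x)
    have h1 := h.div ψ hψ
    rw [integral_finsetSum] at h1
    · simp_rw [h.ibp _ _ ψ hψ, h.int_eq _ _ hψ.continuous] at h1
      rw [Finset.sum_neg_distrib, neg_eq_zero, ← integral_finsetSum] at h1
      · rw [← h1]
        refine integral_congr_ae (Eventually.of_forall fun x => ?_)
        simp only [Matrix.trace, Finset.mul_sum, Matrix.diag]
      · intro i _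
        exact (h.int_m i i).bdd_mul (c := C) hψ.continuous.aestronglyMeasurable (Eventually.of_forall hC')
    · intro i _
      have := h.int_dT hψ (ContinuousLinearMap.proj i) (Pi.single i 1)
      simpa [mul_comm] using this
  have h0 : ∫ x, |Matrix.trace (mOf Dp Dm x)| ∂(muOf Dp Dm) ≤ 0 := by
    refine dual_L1 hi fun ζ hζ => ?_
    refine le_of_forall_pos_le_add fun δ hδ => ?_
    set I := ∫ x, |Matrix.trace (mOf Dp Dm x)| ∂(muOf Dp Dm)
    have hI : 0 ≤ I := integral_nonneg fun _ => abs_nonneg _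
    obtain ⟨ψ, hψ, hc⟩ := tst_dense ζ (δ := δ / (I + 1)) (by positivity)
    have i1 : Integrable (fun x => ψ x * Matrix.trace (mOf Dp Dm x)) (muOf Dp Dm) :=
      hi.bdd_mul (c := ‖ψ‖) ψ.continuous.aestronglyMeasurable (Eventually.of_forall ψ.norm_coe_le_norm)
    have i2 : Integrable (fun x => ζ x * Matrix.trace (mOf Dp Dm x)) (muOf Dp Dm) :=
      hi.bdd_mul (c := ‖ζ‖) ζ.continuous.aestronglyMeasurable (Eventually.of_forall ζ.norm_coe_le_norm)
    calc ∫ x, ζ x * Matrix.trace (mOf Dp Dm x) ∂(muOf Dp Dm) 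
        ≤ ∫ x, (ψ x * Matrix.trace (mOf Dp Dm x) + δ / (I + 1) * |Matrix.trace (mOf Dp Dm x)|) ∂(muOf Dp Dm) := by
          refine integral_mono i2 (i1.add (hi.abs.const_mul _)) fun x => ?_
          have a1 : (ζ x - ψ x) * Matrix.trace (mOf Dp Dm x) ≤ δ / (I + 1) * |Matrix.trace (mOf Dp Dm x)| := by
            refine (le_abs_self _).trans ?_
            rw [abs_mul]
            refine mul_le_mul_of_nonneg_right ?_ (abs_nonneg _)
            rw [abs_sub_comm]; exact (hc x).le
          simp only
          linarith
      _ = δ / (I + 1) * I := by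
          rw [integral_add i1 (hi.abs.const_mul _), hT ψ hψ, integral_const_mul, zero_add]
      _ ≤ 0 + δ := by
          rw [zero_add, div_mul_eq_mul_div, div_le_iff₀ (by positivity)]
          nlinarith
  have h1 : ∫ x, |Matrix.trace (mOf Dp Dm x)| ∂(muOf Dp Dm) = 0 := le_antisymm h0 (integral_nonneg fun _ => abs_nonneg _)
  rw [integral_eq_zero_iff_of_nonneg (fun _ => abs_nonneg _) hi.abs] at h1
  filter_upwards [h1] with x hx
  simpa using hx
end

noncomputable section
set_option linter.unusedSectionVars false

variable {d : ℕ}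
variable {v : Torus d → Fin d → ℝ} {Dp Dm : Fin d → Fin d → Measure (Torus d)}

lemma IBP.int_M (h : IBP v Dp Dm) (w : (Fin d → ℝ) →L[ℝ] ℝ) (e : Fin d → ℝ) :
    Integrable (fun x => w (Matrix.vecMul e (mOf Dp Dm x))) (muOf Dp Dm) := by
  refine w.integrable_comp (Integrable.of_eval fun j => ?_)
  simp only [Matrix.vecMul, dotProduct]
  exact integrable_finsetSum _ fun i _ => (h.int_m i j).const_mul _

lemma dT_comp_add {ψ : Torus d → ℝ} (h : TC1 ψ) (a : Fin d → ℝ) (x : Torus d) : 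
    dT (fun y => ψ (y + pr a)) x = dT ψ (x + pr a) := by
  have h1 := h.hasFDerivAt (lf x + a)
  have h2 : HasFDerivAt (fun y => ψ (pr y + pr a)) (dT ψ (pr (lf x + a))) (lf x) := by
    have := (hasFDerivAt_comp_add_right (f := fun x => ψ (pr x)) a).2 h1
    simpa only [pr_add] using this
  rw [dT, h2.fderiv, pr_add, pr_lf]

lemma IBP.diff_smooth (h : IBP v Dp Dm) {ξ : Torus d → ℝ} (hξ : Tst ξ) (w : (Fin d → ℝ) →L[ℝ] ℝ) (e : Fin d → ℝ)
    {G : Torus d → ℝ} (hG : Continuous G) (hb : ∀ s ∈ Icc (0:ℝ) 1, ∀ x, |ξ (x - pr (s • e))| ≤ G x) : 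
    |∫ y, ξ y * (w (v (y + pr e)) - w (v y))| ≤ ∫ x, G x * |w (Matrix.vecMul e (mOf Dp Dm x))| ∂(muOf Dp Dm) := by
  have hf := h.fin
  obtain ⟨C, C0, hC⟩ := hξ.tc1.bound
  obtain ⟨B, B0, hB⟩ := hξ.tc1.bdd
  obtain ⟨CG, hCG⟩ := (isCompact_range hG).isBounded.exists_norm_le
  have hCG' : ∀ x, ‖G x‖ ≤ CG := fun x => hCG _ (mem_range_self x)
  have hwv : Integrable (fun y => w (v y)) volume := w.integrable_comp h.int
  set Φ : ℝ → ℝ := fun s => ∫ y, ξ (y + pr (-(s • e))) * w (v y)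
  have hcont : ∀ s : ℝ, Continuous fun y => ξ (y + pr (-(s • e))) := fun s => 
    hξ.continuous.comp (continuous_id.add continuous_const)
  have hder : ∀ s, HasDerivAt Φ (∫ x, ξ (x + pr (-(s • e))) * w (Matrix.vecMul e (mOf Dp Dm x)) ∂(muOf Dp Dm)) s := by
    intro s
    have hd : ∀ y (s : ℝ), HasDerivAt (fun s : ℝ => ξ (y + pr (-(s • e))) * w (v y)) ((-dT ξ (y + pr (-(s • e))) e) * w (v y)) s := by
      intro y s
      have h1 := hξ.tc1.hasFDerivAt (lf y + -(s • e))
      have h2 : HasDerivAt (fun s : ℝ => lf y + -(s • e)) (-e) s := by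
        have := (((hasDerivAt_id s).smul_const e).neg).const_add (lf y)
        simpa using this
      have h3 := h1.comp_hasDerivAt s h2
      have e1 : ∀ s : ℝ, pr (lf y + -(s • e)) = y + pr (-(s • e)) := fun s => by rw [pr_add, pr_lf]
      have h4 : HasDerivAt (fun s : ℝ => ξ (y + pr (-(s • e)))) (-dT ξ (y + pr (-(s • e))) e) s := by
        simpa only [Function.comp_def, e1, map_neg] using h3
      exact h4.mul_const _
    have := hasDerivAt_integral_of_dominated_loc_of_deriv_le (μ := volume) (s := univ) (x₀ := s)
      (F := fun s y => ξ (y + pr (-(s • e))) * w (v y)) (F' := fun s y => (-dT ξ (y + pr (-(s • e))) e) * w (v y))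
      (bound := fun y => C * ‖e‖ * ‖w (v y)‖) univ_mem
      (Eventually.of_forall fun s => (hcont s).aestronglyMeasurable.mul hwv.1)
      (hwv.bdd_mul (c := B) (hcont s).aestronglyMeasurable (Eventually.of_forall fun y => hB _))
      ?_ (Eventually.of_forall fun y s _ => ?_) (hwv.norm.const_mul _) (Eventually.of_forall fun y s _ => hd y s)
    · have h5 := this.2
      have h6 := h.gen (hξ.comp_add (-(s • e))) w e
      have h7 : ∫ y, (-dT ξ (y + pr (-(s • e))) e) * w (v y) = ∫ x, ξ (x + pr (-(s • e))) * w (Matrix.vecMul e (mOf Dp Dm x)) ∂(muOf Dp Dm) := by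
        simp only [dT_comp_add hξ.tc1] at h6
        simp only [neg_mul]
        rw [integral_neg, h6, neg_neg]
      rwa [h7] at h5
    · have : Measurable fun y => dT ξ (y + pr (-(s • e))) e := 
        meas_clm_apply ((measurable_dT ξ).comp (measurable_id.add_const _)) measurable_const
      exact this.neg.aestronglyMeasurable.mul hwv.1
    · rw [norm_mul, norm_neg]
      exact mul_le_mul_of_nonneg_right (ContinuousLinearMap.le_of_opNorm_le _ (hC _) e) (norm_nonneg _)
  have hbd : ∀ s ∈ Ico (0:ℝ) 1, ‖∫ x, ξ (x + pr (-(s • e))) * w (Matrix.vecMul e (mOf Dp Dm x)) ∂(muOf Dp Dm)‖ ≤ 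
      ∫ x, G x * |w (Matrix.vecMul e (mOf Dp Dm x))| ∂(muOf Dp Dm) := by
    intro s hs
    refine (norm_integral_le_integral_norm _).trans ?_
    refine integral_mono_of_nonneg (Eventually.of_forall fun x => norm_nonneg _) 
      ((h.int_M w e).abs.bdd_mul (c := CG) hG.aestronglyMeasurable (Eventually.of_forall hCG')) 
      (Eventually.of_forall fun x => ?_)
    simp only
    rw [norm_mul]
    refine mul_le_mul_of_nonneg_right ?_ (abs_nonneg _)
    have := hb s ⟨hs.1, hs.2.le⟩ x
    have e1 : pr (-(s • e)) = - pr (s • e) := by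
      have := pr_sub 0 (s • e)
      rwa [zero_sub, pr_zero, zero_sub] at this
    rwa [e1, ← sub_eq_add_neg]
  have hmv := norm_image_sub_le_of_norm_deriv_le_segment_01' (fun s _ => (hder s).hasDerivWithinAt) hbd
  have hΦ : Φ 1 - Φ 0 = ∫ y, ξ y * (w (v (y + pr e)) - w (v y)) := by
    have e1 : Φ 1 = ∫ y, ξ y * w (v (y + pr e)) := by
      simp only [Φ, one_smul]
      rw [← integral_add_right_eq_self (fun y => ξ (y + pr (-e)) * w (v y)) (pr e)]
      refine integral_congr_ae (Eventually.of_forall fun y => ?_)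
      simp only
      rw [add_assoc, ← pr_add, add_neg_cancel, pr_zero, add_zero]
    have e0 : Φ 0 = ∫ y, ξ y * w (v y) := by simp [Φ, pr_zero]
    have j1 : Integrable (fun y => w (v (y + pr e))) := hwv.comp_add_right (pr e)
    rw [e1, e0, ← integral_sub]
    · simp only [mul_sub]
    · exact j1.bdd_mul (c := B) hξ.continuous.aestronglyMeasurable (Eventually.of_forall fun y => hB _)
    · exact hwv.bdd_mul (c := B) hξ.continuous.aestronglyMeasurable (Eventually.of_forall fun y => hB _)
  rw [← hΦ]
  exact hmv

lemma IBP.diff_cont (h : IBP v Dp Dm) {ξ : Torus d → ℝ} (hξ : Continuous ξ) (w : (Fin d → ℝ) →L[ℝ] ℝ) (e : Fin d → ℝ)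
    {G : Torus d → ℝ} (hG : Continuous G) (hb : ∀ s ∈ Icc (0:ℝ) 1, ∀ x, |ξ (x - pr (s • e))| ≤ G x) : 
    |∫ y, ξ y * (w (v (y + pr e)) - w (v y))| ≤ ∫ x, G x * |w (Matrix.vecMul e (mOf Dp Dm x))| ∂(muOf Dp Dm) := by
  have hf := h.fin
  have hwv : Integrable (fun y => w (v y)) volume := w.integrable_comp h.int
  have hD : Integrable (fun y => w (v (y + pr e)) - w (v y)) volume := (hwv.comp_add_right (pr e)).sub hwv
  have hM := h.int_M w e
  set P := ∫ y, |w (v (y + pr e)) - w (v y)|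
  set Q := ∫ x, |w (Matrix.vecMul e (mOf Dp Dm x))| ∂(muOf Dp Dm)
  have P0 : 0 ≤ P := integral_nonneg fun _ => abs_nonneg _
  have Q0 : 0 ≤ Q := integral_nonneg fun _ => abs_nonneg _
  refine le_of_forall_pos_le_add fun δ hδ => ?_
  set δ' := δ / (P + Q + 1)
  have hδ' : 0 < δ' := by positivity
  obtain ⟨ψ, hψ, hc⟩ := tst_dense ⟨ξ, hξ⟩ hδ'
  simp only [ContinuousMap.coe_mk] at hc
  obtain ⟨CG, hCG⟩ := (isCompact_range hG).isBounded.exists_norm_le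
  have hCG' : ∀ x, ‖G x‖ ≤ CG := fun x => hCG _ (mem_range_self x)
  obtain ⟨Cx, hCx⟩ := (isCompact_range hξ).isBounded.exists_norm_le
  have hCx' : ∀ x, ‖ξ x‖ ≤ Cx := fun x => hCx _ (mem_range_self x)
  have h1 := h.diff_smooth hψ w e (G := fun x => G x + δ') (hG.add continuous_const) (by
    intro s hs x
    have a1 := hb s hs x
    have a2 := (hc (x - pr (s • e))).le
    have a3 := abs_add_le (ψ (x - pr (s • e)) - ξ (x - pr (s • e))) (ξ (x - pr (s • e)))
    rw [sub_add_cancel] at a3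
    linarith)
  have h2 : ∫ x, (G x + δ') * |w (Matrix.vecMul e (mOf Dp Dm x))| ∂(muOf Dp Dm) = 
      ∫ x, G x * |w (Matrix.vecMul e (mOf Dp Dm x))| ∂(muOf Dp Dm) + δ' * Q := by
    simp only [add_mul]
    rw [integral_add (hM.abs.bdd_mul (c := CG) hG.aestronglyMeasurable (Eventually.of_forall hCG')) (hM.abs.const_mul _), integral_const_mul]
  have i1 : Integrable (fun y => ξ y * (w (v (y + pr e)) - w (v y))) :=
    hD.bdd_mul (c := Cx) hξ.aestronglyMeasurable (Eventually.of_forall hCx')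
  have i2 : Integrable (fun y => ψ y * (w (v (y + pr e)) - w (v y))) :=
    hD.bdd_mul (c := ‖ψ‖) ψ.continuous.aestronglyMeasurable (Eventually.of_forall ψ.norm_coe_le_norm)
  have h3 : |(∫ y, ξ y * (w (v (y + pr e)) - w (v y))) - ∫ y, ψ y * (w (v (y + pr e)) - w (v y))| ≤ δ' * P := by
    rw [← integral_sub i1 i2, ← integral_const_mul]
    refine abs_integral_le_integral_abs.trans ?_
    refine integral_mono_of_nonneg (Eventually.of_forall fun x => abs_nonneg _) (hD.abs.const_mul _) (Eventually.of_forall fun x => ?_)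
    simp only
    rw [← sub_mul, abs_mul]
    refine mul_le_mul_of_nonneg_right ?_ (abs_nonneg _)
    rw [abs_sub_comm]; exact (hc x).le
  have h4 : δ' * P + δ' * Q ≤ δ := by
    rw [← mul_add, div_mul_eq_mul_div, div_le_iff₀ (by positivity)]
    nlinarith
  have h5 := abs_add_le ((∫ y, ξ y * (w (v (y + pr e)) - w (v y))) - ∫ y, ψ y * (w (v (y + pr e)) - w (v y))) (∫ y, ψ y * (w (v (y + pr e)) - w (v y)))
  rw [sub_add_cancel] at h5
  linarith

lemma TC1.lip {ψ : Torus d → ℝ} (h : TC1 ψ) : ∃ L, 0 ≤ L ∧ ∀ x (a : Fin d → ℝ), |ψ (x + pr a) - ψ x| ≤ L * ‖a‖ := by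
  obtain ⟨C, C0, hC⟩ := h.bound
  refine ⟨C, C0, fun x a => ?_⟩
  have := Convex.norm_image_sub_le_of_norm_hasFDerivWithin_le (s := univ) (fun y _ => (h.hasFDerivAt y).hasFDerivWithinAt) (fun y _ => hC (pr y)) 
    convex_univ (mem_univ (lf x)) (mem_univ (lf x + a))
  rw [pr_add, pr_lf, add_sub_cancel_left] at this
  exact this

lemma IBP.diff (h : IBP v Dp Dm) {ψ : Torus d → ℝ} (hψ : Continuous ψ) (h0 : ∀ x, 0 ≤ ψ x) {L : ℝ} (hL : 0 ≤ L)
    (hlip : ∀ x (a : Fin d → ℝ), |ψ (x + pr a) - ψ x| ≤ L * ‖a‖) (w : (Fin d → ℝ) →L[ℝ] ℝ) (e : Fin d → ℝ) :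
    ∫⁻ y, ENNReal.ofReal (ψ (y + pr e)) * ‖w (v (y + pr e) - v y)‖ₑ ≤ 
      ∫⁻ x, (ENNReal.ofReal (ψ x) + ENNReal.ofReal (L * ‖e‖)) * ‖w (Matrix.vecMul e (mOf Dp Dm x))‖ₑ ∂(muOf Dp Dm) := by
  have hf := h.fin
  have hwv : Integrable (fun y => w (v y)) volume := w.integrable_comp h.int
  have hD : Integrable (fun y => w (v (y + pr e)) - w (v y)) volume := (hwv.comp_add_right (pr e)).sub hwv
  have hM := h.int_M w e
  have hψe : Continuous fun y => ψ (y + pr e) := hψ.comp (continuous_id.add continuous_const)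
  obtain ⟨C, hC⟩ := (isCompact_range hψ).isBounded.exists_norm_le
  have hC' : ∀ x, ‖ψ x‖ ≤ C := fun x => hC _ (mem_range_self x)
  have hK : Integrable (fun y => ψ (y + pr e) * (w (v (y + pr e)) - w (v y))) :=
    hD.bdd_mul (c := C) hψe.aestronglyMeasurable (Eventually.of_forall fun _ => hC' _)
  have hGM : Integrable (fun x => (ψ x + L * ‖e‖) * |w (Matrix.vecMul e (mOf Dp Dm x))|) (muOf Dp Dm) :=
    hM.abs.bdd_mul (c := C + ‖L * ‖e‖‖) (hψ.add continuous_const).aestronglyMeasurable 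
      (Eventually.of_forall fun x => (norm_add_le _ _).trans (by gcongr; exact hC' x))
  have key := dual_L1 hK (B := ∫ x, (ψ x + L * ‖e‖) * |w (Matrix.vecMul e (mOf Dp Dm x))| ∂(muOf Dp Dm)) (by
    intro ζ hζ
    have := h.diff_cont (ξ := fun y => ζ y * ψ (y + pr e)) (ζ.continuous.mul hψe) w e (G := fun x => ψ x + L * ‖e‖) 
      (hψ.add continuous_const) (by
      intro s hs x
      rw [abs_mul]
      refine (mul_le_of_le_one_left (abs_nonneg _) (hζ _)).trans ?_
      rw [abs_of_nonneg (h0 _)]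
      have e1 : x - pr (s • e) + pr e = x + pr ((1 - s) • e) := by
        rw [sub_smul, one_smul, pr_sub]; abel
      rw [e1]
      have a1 := (abs_le.1 (hlip x ((1 - s) • e))).2
      have a2 : ‖(1 - s) • e‖ ≤ ‖e‖ := by
        rw [norm_smul, Real.norm_eq_abs, abs_of_nonneg (by linarith [hs.2])]
        exact mul_le_of_le_one_left (norm_nonneg _) (by linarith [hs.1])
      have a3 := mul_le_mul_of_nonneg_left a2 hL
      linarith)
    refine le_trans (le_of_eq ?_) ((le_abs_self _).trans this)
    refine integral_congr_ae (Eventually.of_forall fun y => ?_)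
    simp only; ring)
  have e1 : ∫⁻ y, ENNReal.ofReal (ψ (y + pr e)) * ‖w (v (y + pr e) - v y)‖ₑ = 
      ENNReal.ofReal (∫ y, |ψ (y + pr e) * (w (v (y + pr e)) - w (v y))|) := by
    rw [ofReal_integral_eq_lintegral_ofReal hK.abs (Eventually.of_forall fun _ => abs_nonneg _)]
    refine lintegral_congr fun y => ?_
    rw [abs_mul, ENNReal.ofReal_mul (abs_nonneg _), abs_of_nonneg (h0 _), ← map_sub, ← Real.norm_eq_abs, ofReal_norm]
  have e2 : ∫⁻ x, (ENNReal.ofReal (ψ x) + ENNReal.ofReal (L * ‖e‖)) * ‖w (Matrix.vecMul e (mOf Dp Dm x))‖ₑ ∂(muOf Dp Dm) =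
      ENNReal.ofReal (∫ x, (ψ x + L * ‖e‖) * |w (Matrix.vecMul e (mOf Dp Dm x))| ∂(muOf Dp Dm)) := by
    rw [ofReal_integral_eq_lintegral_ofReal hGM (Eventually.of_forall fun x => mul_nonneg (add_nonneg (h0 x) (by positivity)) (abs_nonneg _))]
    refine lintegral_congr fun x => ?_
    rw [ENNReal.ofReal_mul (add_nonneg (h0 x) (by positivity)), ENNReal.ofReal_add (h0 x) (by positivity), ← Real.norm_eq_abs (w _), ofReal_norm]
  rw [e1, e2]
  exact ENNReal.ofReal_le_ofReal key
end

noncomputable section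
set_option linter.unusedSectionVars false

variable {d : ℕ}
variable {v : Torus d → Fin d → ℝ} {Dp Dm : Fin d → Fin d → Measure (Torus d)}

/-- anisotropic cost -/
def Jc (ρ : (Fin d → ℝ) → ℝ) (A : Fin d → Fin d → ℝ) : ℝ≥0∞ :=
  ∫⁻ z, ‖fderiv ℝ ρ z (Matrix.vecMul z A)‖ₑ

lemma cont_vecMul : Continuous fun p : (Fin d → ℝ) × (Fin d → Fin d → ℝ) => Matrix.vecMul p.1 p.2 := by
  refine continuous_pi fun j => ?_
  simp only [Matrix.vecMul, dotProduct]
  fun_prop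

lemma meas_Jint (ρ : (Fin d → ℝ) → ℝ) : 
    Measurable fun p : (Fin d → ℝ) × (Fin d → Fin d → ℝ) => ‖fderiv ℝ ρ p.1 (Matrix.vecMul p.1 p.2)‖ₑ :=
  (meas_clm_apply ((measurable_fderiv ℝ ρ).comp measurable_fst) cont_vecMul.measurable).enorm

lemma meas_Jc (ρ : (Fin d → ℝ) → ℝ) : Measurable (Jc ρ) :=
  Measurable.lintegral_prod_right' (f := fun p : (Fin d → Fin d → ℝ) × (Fin d → ℝ) => ‖fderiv ℝ ρ p.2 (Matrix.vecMul p.2 p.1)‖ₑ) 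
    ((meas_Jint ρ).comp measurable_swap)

lemma vecMul_le (z : Fin d → ℝ) (A : Fin d → Fin d → ℝ) : ‖Matrix.vecMul z A‖ ≤ d * ‖z‖ * ‖A‖ := by
  rw [pi_norm_le_iff_of_nonneg (by positivity)]
  intro j
  simp only [Matrix.vecMul, dotProduct]
  refine (norm_sum_le _ _).trans ?_
  calc ∑ i, ‖z i * A i j‖ ≤ ∑ _i : Fin d, ‖z‖ * ‖A‖ := by
        refine Finset.sum_le_sum fun i _ => ?_
        rw [norm_mul]
        exact mul_le_mul (norm_le_pi_norm z i) ((norm_le_pi_norm (A i) j).trans (norm_le_pi_norm A i)) (norm_nonneg _) (norm_nonneg _)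
    _ = _ := by simp; ring

lemma Jc_le {ρ : (Fin d → ℝ) → ℝ} (h : Adm ρ) : ∃ C : ℝ, 0 ≤ C ∧ ∀ A, Jc ρ A ≤ ENNReal.ofReal (C * ‖A‖) := by
  have hc : Continuous fun z => ‖fderiv ℝ ρ z‖ * (d * ‖z‖) := 
    (h.contDiff.continuous_fderiv one_ne_zero).norm.mul (continuous_const.mul continuous_norm)
  have hs : HasCompactSupport fun z => ‖fderiv ℝ ρ z‖ * (d * ‖z‖) := (h.supp.fderiv ℝ).norm.mul_right
  have hi := hc.integrable_of_hasCompactSupport hs (μ := volume)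
  refine ⟨∫ z, ‖fderiv ℝ ρ z‖ * (d * ‖z‖), integral_nonneg fun z => by positivity, fun A => ?_⟩
  rw [← integral_mul_const, ofReal_integral_eq_lintegral_ofReal (hi.mul_const _) (Eventually.of_forall fun z => by positivity)]
  refine lintegral_mono fun z => ?_
  rw [← ofReal_norm]
  refine ENNReal.ofReal_le_ofReal ?_
  refine (ContinuousLinearMap.le_opNorm _ _).trans ?_
  calc ‖fderiv ℝ ρ z‖ * ‖Matrix.vecMul z A‖ ≤ ‖fderiv ℝ ρ z‖ * (d * ‖z‖ * ‖A‖) := by gcongr; exact vecMul_le z A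
    _ = _ := by ring

lemma Jc_add (ρ : (Fin d → ℝ) → ℝ) (A B : Fin d → Fin d → ℝ) : Jc ρ (A + B) ≤ Jc ρ A + Jc ρ B := by
  rw [Jc, Jc, Jc, ← lintegral_add_left]
  · refine lintegral_mono fun z => ?_
    have : Matrix.vecMul z (A + B) = Matrix.vecMul z A + Matrix.vecMul z B := Matrix.vecMul_add A B z
    rw [this, map_add]
    exact enorm_add_le _ _
  · exact (meas_Jint ρ).comp (measurable_id.prodMk measurable_const)

lemma Theta_le (h : IBP v Dp Dm) {ψ : Torus d → ℝ} (hψ : Continuous ψ) (h0 : ∀ x, 0 ≤ ψ x) {L : ℝ} (hL : 0 ≤ L)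
    (hlip : ∀ x (a : Fin d → ℝ), |ψ (x + pr a) - ψ x| ≤ L * ‖a‖) {ρ : (Fin d → ℝ) → ℝ} (hρ : Adm ρ)
    {ε R : ℝ} (hε : 0 < ε) (hR : ε * R < 1/2) (hR0 : ∀ z, R ≤ ‖z‖ → ρ z = 0 ∧ fderiv ℝ ρ z = 0) : 
    Theta ψ (kap ε ρ) v ≤ ∫⁻ x, (ENNReal.ofReal (ψ x) + ENNReal.ofReal (L * (ε * R))) * Jc ρ (mOf Dp Dm x) ∂(muOf Dp Dm) := by
  have hf := h.fin
  have hv := h.meas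
  have hmf : Measurable (fderiv ℝ ρ) := measurable_fderiv ℝ ρ
  -- change of variables
  have m1 : Measurable fun p : Torus d × Torus d => ENNReal.ofReal (ψ p.2) * ‖dT (kap ε ρ) (p.2 - p.1) (v p.2 - v p.1)‖ₑ := by
    refine (hψ.measurable.comp measurable_snd).ennreal_ofReal.mul ?_
    exact (meas_clm_apply ((measurable_dT _).comp (measurable_snd.sub measurable_fst)) ((hv.comp measurable_snd).sub (hv.comp measurable_fst))).enorm
  have hmp := measurePreserving_prod_add (volume : Measure (Torus d)) (volume : Measure (Torus d))
  rw [Theta, ← hmp.lintegral_comp m1]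
  have m2 : Measurable fun a : Torus d × Torus d => ENNReal.ofReal (ψ (a.1 + a.2)) * ‖dT (kap ε ρ) (a.1 + a.2 - a.1) (v (a.1 + a.2) - v a.1)‖ₑ := 
    m1.comp hmp.measurable
  simp only
  rw [lintegral_prod_symm _ m2.aemeasurable]
  -- scale
  set F : Torus d → (Fin d → ℝ) → ℝ≥0∞ := fun w z => ∫⁻ x, ENNReal.ofReal (ψ (x + w)) * ‖fderiv ℝ ρ z (v (x + w) - v x)‖ₑ with hF
  have m3 : Measurable fun q : (Torus d × (Fin d → ℝ)) × Torus d => 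
      ENNReal.ofReal (ψ (q.2 + q.1.1)) * ‖fderiv ℝ ρ q.1.2 (v (q.2 + q.1.1) - v q.2)‖ₑ := by
    have a1 : Measurable fun q : (Torus d × (Fin d → ℝ)) × Torus d => q.2 + q.1.1 := measurable_snd.add (measurable_fst.comp measurable_fst)
    refine (hψ.measurable.comp a1).ennreal_ofReal.mul ?_
    exact (meas_clm_apply (hmf.comp (measurable_snd.comp measurable_fst)) ((hv.comp a1).sub (hv.comp measurable_snd))).enorm
  have hFm : Measurable (Function.uncurry F) := Measurable.lintegral_prod_right' m3
  have hFm' : Measurable fun p : Torus d × (Fin d → ℝ) => ‖ε⁻¹‖ₑ * F p.1 p.2 := hFm.const_mul _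
  have e1 : ∀ w : Torus d, ∫⁻ x, ENNReal.ofReal (ψ (x + w)) * ‖dT (kap ε ρ) (x + w - x) (v (x + w) - v x)‖ₑ = 
      ENNReal.ofReal ((ε⁻¹)^d) * (‖ε⁻¹‖ₑ * F w (ε⁻¹ • lf w)) := by
    intro w
    rw [← mul_assoc, hF]
    simp only
    have m4 : Measurable fun x => ENNReal.ofReal (ψ (x + w)) * ‖fderiv ℝ ρ (ε⁻¹ • lf w) (v (x + w) - v x)‖ₑ := 
      m3.comp (measurable_const.prodMk measurable_id : Measurable fun x => ((w, ε⁻¹ • lf w), x))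
    rw [← lintegral_const_mul _ m4]
    refine lintegral_congr fun x => ?_
    rw [add_sub_cancel_left, dT_kap hρ hε hR hR0, _root_.smul_apply, enorm_smul, pow_succ, enorm_mul]
    have : ‖ε⁻¹ ^ d‖ₑ = ENNReal.ofReal (ε⁻¹ ^ d) := Real.enorm_of_nonneg (by positivity)
    rw [this]
    ring
  have e2 : ∫⁻ w, ENNReal.ofReal ((ε⁻¹)^d) * (‖ε⁻¹‖ₑ * F w (ε⁻¹ • lf w)) = ∫⁻ z, ‖ε⁻¹‖ₑ * F (pr (ε • z)) z := by
    refine lintegral_scale hε hR (fun w z => ‖ε⁻¹‖ₑ * F w z) hFm' ?_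
    intro w z hz
    simp [hF, (hR0 z hz.le).2]
  simp only
  rw [lintegral_congr e1, e2]
  -- bound
  have mm := meas_mOf Dp Dm
  have m5 : Measurable fun p : (Fin d → ℝ) × Torus d => (ENNReal.ofReal (ψ p.2) + ENNReal.ofReal (L * (ε * R))) * ‖fderiv ℝ ρ p.1 (Matrix.vecMul p.1 (mOf Dp Dm p.2))‖ₑ := by
    refine ((hψ.measurable.comp measurable_snd).ennreal_ofReal.add_const _).mul ?_
    exact (meas_Jint ρ).comp (measurable_fst.prodMk (mm.comp measurable_snd))
  calc ∫⁻ z, ‖ε⁻¹‖ₑ * F (pr (ε • z)) z ≤ ∫⁻ z, ∫⁻ x, (ENNReal.ofReal (ψ x) + ENNReal.ofReal (L * (ε * R))) * ‖fderiv ℝ ρ z (Matrix.vecMul z (mOf Dp Dm x))‖ₑ ∂(muOf Dp Dm) := by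
        refine lintegral_mono fun z => ?_
        by_cases hz : R ≤ ‖z‖
        · simp [hF, (hR0 z hz).2]
        push Not at hz
        have := h.diff hψ h0 hL hlip (ε⁻¹ • fderiv ℝ ρ z) (ε • z)
        have e3 : ‖ε⁻¹‖ₑ * F (pr (ε • z)) z = ∫⁻ y, ENNReal.ofReal (ψ (y + pr (ε • z))) * ‖(ε⁻¹ • fderiv ℝ ρ z) (v (y + pr (ε • z)) - v y)‖ₑ := by
          have m4 : Measurable fun x => ENNReal.ofReal (ψ (x + pr (ε • z))) * ‖fderiv ℝ ρ z (v (x + pr (ε • z)) - v x)‖ₑ := 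
            m3.comp (measurable_const.prodMk measurable_id : Measurable fun x => ((pr (ε • z), z), x))
          rw [hF]
          simp only
          rw [← lintegral_const_mul _ m4]
          refine lintegral_congr fun x => ?_
          rw [_root_.smul_apply, enorm_smul]
          ring
        rw [e3]
        refine this.trans (lintegral_mono fun x => ?_)
        have e4 : (ε⁻¹ • fderiv ℝ ρ z) (Matrix.vecMul (ε • z) (mOf Dp Dm x)) = fderiv ℝ ρ z (Matrix.vecMul z (mOf Dp Dm x)) := by
          have : Matrix.vecMul (ε • z) (mOf Dp Dm x) = ε • Matrix.vecMul z (mOf Dp Dm x) := Matrix.smul_vecMul _ _ _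
          rw [this, _root_.smul_apply, map_smul, smul_smul, inv_mul_cancel₀ hε.ne', one_smul]
        simp only [e4]
        gcongr
        rw [norm_smul, Real.norm_eq_abs, abs_of_pos hε]
        gcongr
    _ = ∫⁻ x, (∫⁻ z, (ENNReal.ofReal (ψ x) + ENNReal.ofReal (L * (ε * R))) * ‖fderiv ℝ ρ z (Matrix.vecMul z (mOf Dp Dm x))‖ₑ) ∂(muOf Dp Dm) :=
        lintegral_lintegral_swap (f := fun z x => (ENNReal.ofReal (ψ x) + ENNReal.ofReal (L * (ε * R))) * ‖fderiv ℝ ρ z (Matrix.vecMul z (mOf Dp Dm x))‖ₑ) m5.aemeasurable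
    _ = _ := by
        refine lintegral_congr fun x => ?_
        rw [Jc, lintegral_const_mul]
        exact (meas_Jint ρ).comp (measurable_id.prodMk measurable_const)

/-- limiting cost -/
def Fam.cost (F : Fam d) (μ : Measure (Torus d)) (m : Torus d → Fin d → Fin d → ℝ) : ℝ≥0∞ :=
  ∑ k, ∫⁻ x, ENNReal.ofReal (F.ψ k x) * Jc (F.ρ k) (m x) ∂μ

lemma IBP.norm_m (h : IBP v Dp Dm) : ∀ᵐ x ∂(muOf Dp Dm), ‖mOf Dp Dm x‖ ≤ 1 := by
  filter_upwards [h.bound] with x hx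
  rw [pi_norm_le_iff_of_nonneg zero_le_one]; intro i
  rw [pi_norm_le_iff_of_nonneg zero_le_one]; intro j
  exact hx i j

lemma Jc_int (h : IBP v Dp Dm) {ρ : (Fin d → ℝ) → ℝ} {C : ℝ} (C0 : 0 ≤ C) (hC : ∀ A, Jc ρ A ≤ ENNReal.ofReal (C * ‖A‖)) :
    ∀ᵐ x ∂(muOf Dp Dm), Jc ρ (mOf Dp Dm x) ≤ ENNReal.ofReal C := by
  filter_upwards [h.norm_m] with x hx
  exact (hC _).trans (ENNReal.ofReal_le_ofReal (mul_le_of_le_one_right C0 hx))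

lemma Fam.Th_bound (F : Fam d) : ∃ C : ℝ≥0∞, C < ∞ ∧ ∀ᶠ n in atTop, ∀ (v : Torus d → Fin d → ℝ) (Dp Dm : Fin d → Fin d → Measure (Torus d)), 
    IBP v Dp Dm → F.Th n v ≤ C * muOf Dp Dm univ := by
  have key : ∀ k, ∃ C : ℝ≥0∞, C < ∞ ∧ ∀ᶠ n in atTop, ∀ (v : Torus d → Fin d → ℝ) (Dp Dm : Fin d → Fin d → Measure (Torus d)), 
    IBP v Dp Dm → Theta (F.ψ k) (kap (eps n) (F.ρ k)) v ≤ C * muOf Dp Dm univ := by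
    intro k
    obtain ⟨R, R0, hR⟩ := (F.adm k).exists_R
    obtain ⟨L, L0, hL⟩ := (F.tc k).lip
    obtain ⟨B, B0, hB⟩ := (F.tc k).bdd
    obtain ⟨C, C0, hC⟩ := Jc_le (F.adm k)
    refine ⟨(ENNReal.ofReal B + ENNReal.ofReal (L * (1/2))) * ENNReal.ofReal C, ENNReal.mul_lt_top (by simp) (by simp), ?_⟩
    filter_upwards [(tendsto_eps_mul R).eventually (gt_mem_nhds (by norm_num : (0:ℝ) < 1/2))] with n hn v Dp Dm h
    refine (Theta_le h (F.tc k).1 (F.nonneg k) L0 hL (F.adm k) (eps_pos n) hn hR).trans ?_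
    rw [← lintegral_const]
    refine lintegral_mono_ae ?_
    filter_upwards [Jc_int h C0 hC] with x hx
    gcongr
    exact (le_abs_self _).trans (hB x)
  choose C hC hC' using key
  refine ⟨∑ k, C k, ENNReal.sum_lt_top.2 fun k _ => hC k, ?_⟩
  filter_upwards [eventually_all.2 hC'] with n hn v Dp Dm h
  rw [Fam.Th, Finset.sum_mul]
  exact Finset.sum_le_sum fun k _ => hn k v Dp Dm h

lemma Fam.Th_limsup (F : Fam d) (h : IBP v Dp Dm) : 
    limsup (fun n => F.Th n v) atTop ≤ F.cost (muOf Dp Dm) (mOf Dp Dm) := by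
  have hf := h.fin
  have key : ∀ k, ∃ a : ℕ → ℝ≥0∞, Tendsto a atTop (𝓝 (∫⁻ x, ENNReal.ofReal (F.ψ k x) * Jc (F.ρ k) (mOf Dp Dm x) ∂(muOf Dp Dm))) ∧ 
      ∀ᶠ n in atTop, Theta (F.ψ k) (kap (eps n) (F.ρ k)) v ≤ a n := by
    intro k
    obtain ⟨R, R0, hR⟩ := (F.adm k).exists_R
    obtain ⟨L, L0, hL⟩ := (F.tc k).lip
    obtain ⟨C, C0, hC⟩ := Jc_le (F.adm k)
    have mJ : Measurable fun x => Jc (F.ρ k) (mOf Dp Dm x) := (meas_Jc _).comp (meas_mOf Dp Dm)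
    have hJf : ∫⁻ x, Jc (F.ρ k) (mOf Dp Dm x) ∂(muOf Dp Dm) ≠ ∞ := by
      refine ne_top_of_le_ne_top ?_ (lintegral_mono_ae (Jc_int h C0 hC))
      rw [lintegral_const]
      exact ENNReal.mul_ne_top (by simp) (measure_ne_top _ _)
    refine ⟨fun n => ∫⁻ x, ENNReal.ofReal (F.ψ k x) * Jc (F.ρ k) (mOf Dp Dm x) ∂(muOf Dp Dm) + 
      ENNReal.ofReal (L * (eps n * R)) * ∫⁻ x, Jc (F.ρ k) (mOf Dp Dm x) ∂(muOf Dp Dm), ?_, ?_⟩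
    · have t1 : Tendsto (fun n => ENNReal.ofReal (L * (eps n * R))) atTop (𝓝 0) := by
        have := ENNReal.tendsto_ofReal ((tendsto_eps_mul R).const_mul L)
        simpa using this
      have t2 := ENNReal.Tendsto.mul_const t1 (Or.inr hJf)
      have t3 := tendsto_const_nhds (x := ∫⁻ x, ENNReal.ofReal (F.ψ k x) * Jc (F.ρ k) (mOf Dp Dm x) ∂(muOf Dp Dm)) |>.add t2
      simpa using t3
    · filter_upwards [(tendsto_eps_mul R).eventually (gt_mem_nhds (by norm_num : (0:ℝ) < 1/2))] with n hn
      refine (Theta_le h (F.tc k).1 (F.nonneg k) L0 hL (F.adm k) (eps_pos n) hn hR).trans (le_of_eq ?_)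
      simp only [add_mul]
      have mm : Measurable fun x => ENNReal.ofReal (F.ψ k x) * Jc (F.ρ k) (mOf Dp Dm x) := (F.tc k).1.measurable.ennreal_ofReal.mul mJ
      rw [lintegral_add_left mm, lintegral_const_mul _ mJ]
  choose a ha ha' using key
  have t : Tendsto (fun n => ∑ k, a k n) atTop (𝓝 (F.cost (muOf Dp Dm) (mOf Dp Dm))) :=
    tendsto_finsetSum _ fun k _ => ha k
  rw [← t.limsup_eq]
  refine limsup_le_limsup ?_
  filter_upwards [eventually_all.2 ha'] with n hn
  exact Finset.sum_le_sum fun k _ => hn k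
end

noncomputable section
set_option linter.unusedSectionVars false

variable {d : ℕ}

lemma exists_Adm (d : ℕ) : ∃ ρ : (Fin d → ℝ) → ℝ, Adm ρ := by
  let f : ContDiffBump (0 : Fin d → ℝ) := default
  refine ⟨f.normed volume, f.contDiff_normed, fun z => f.nonneg_normed z, f.hasCompactSupport_normed, ?_⟩
  rw [← ofReal_integral_eq_lintegral_ofReal f.integrable_normed (Eventually.of_forall fun z => f.nonneg_normed z), 
    f.integral_normed, ENNReal.ofReal_one]

/-- the linear field of a matrix -/
def linF (A : Fin d → Fin d → ℝ) : (Fin d → ℝ) →L[ℝ] (Fin d → ℝ) :=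
  LinearMap.toContinuousLinearMap (Matrix.vecMulLinear (A : Matrix (Fin d) (Fin d) ℝ))

lemma linF_apply (A : Fin d → Fin d → ℝ) (z : Fin d → ℝ) : linF A z = Matrix.vecMul z A := rfl

/-- determinant of a continuous linear map -/
def detL (L : (Fin d → ℝ) →L[ℝ] (Fin d → ℝ)) : ℝ := LinearMap.det (L : (Fin d → ℝ) →ₗ[ℝ] (Fin d → ℝ))

lemma detL_mul (L L' : (Fin d → ℝ) →L[ℝ] (Fin d → ℝ)) : detL (L * L') = detL L * detL L' := by
  unfold detL
  exact LinearMap.det_comp _ _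

lemma detL_one : detL (1 : (Fin d → ℝ) →L[ℝ] (Fin d → ℝ)) = 1 := LinearMap.det_id

lemma detL_diff : Differentiable ℝ (detL (d := d)) := by
  have : (detL (d := d)) = fun L => ∑ σ : Equiv.Perm (Fin d), ((Equiv.Perm.sign σ : ℤ) : ℝ) * ∏ i, (L (Pi.single i 1) (σ i)) := by
    funext L
    rw [detL, ← LinearMap.det_toMatrix', Matrix.det_apply']
    refine Finset.sum_congr rfl fun σ _ => ?_
    congr 1
  rw [this]
  have h1 : ∀ i j : Fin d, Differentiable ℝ fun L : (Fin d → ℝ) →L[ℝ] (Fin d → ℝ) => L (Pi.single i 1) j := by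
    intro i j
    exact ((ContinuousLinearMap.proj j : (Fin d → ℝ) →L[ℝ] ℝ).comp (ContinuousLinearMap.apply ℝ (Fin d → ℝ) (Pi.single i 1))).differentiable
  fun_prop

lemma detL_one_add (A : Fin d → Fin d → ℝ) (hA : Matrix.trace A = 0) : HasDerivAt (fun s : ℝ => detL (1 + s • linF A)) 0 0 := by
  obtain ⟨p, e⟩ : ∃ p : Polynomial ℝ, ∀ s : ℝ, detL (1 + s • linF A) = 1 + p.eval s * s ^ 2 := by
    let A' : Matrix (Fin d) (Fin d) ℝ := Matrix.transpose A
    have hA' : A'.trace = 0 := by rw [← hA]; exact Matrix.trace_transpose _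
    obtain ⟨p, hp⟩ : ∃ p : Polynomial ℝ, ∀ s : ℝ, (1 + s • A').det = 1 + A'.trace * s + p.eval s * s ^ 2 := 
      ⟨_, fun s => Matrix.det_one_add_smul s A'⟩
    refine ⟨p, fun s => ?_⟩
    have h1 := hp s
    rw [hA', zero_mul, add_zero] at h1
    rw [← h1, detL, ← LinearMap.det_toMatrix']
    congr 1
    ext i j
    rw [LinearMap.toMatrix'_apply]
    have h2 : Matrix.vecMul (Pi.single j 1) A i = Matrix.transpose A i j := by
      have := congrFun (Matrix.single_one_vecMul j (A : Matrix (Fin d) (Fin d) ℝ)) i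
      exact this
    simp [linF_apply, Matrix.one_apply, Pi.single_apply, A', h2]
  have e' : (fun s : ℝ => detL (1 + s • linF A)) = fun s => 1 + p.eval s * s ^ 2 := funext e
  rw [e']
  have h2 := (p.hasDerivAt (0:ℝ)).mul (hasDerivAt_pow 2 (0:ℝ))
  simpa using h2.const_add 1

lemma detL_exp (A : Fin d → Fin d → ℝ) (hA : Matrix.trace A = 0) (s : ℝ) : detL (NormedSpace.exp (s • linF A)) = 1 := by
  let _ : NormedAlgebra ℚ ((Fin d → ℝ) →L[ℝ] (Fin d → ℝ)) := NormedAlgebra.restrictScalars ℚ ℝ _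
  have h0 : HasDerivAt (fun s : ℝ => detL (NormedSpace.exp (s • linF A))) 0 0 := by
    have a1 := hasDerivAt_exp_smul_const (linF A) (0:ℝ)
    rw [zero_smul, NormedSpace.exp_zero, one_mul] at a1
    have hd := (detL_diff (d := d) 1).hasFDerivAt
    have a2 : HasDerivAt (fun s : ℝ => detL (NormedSpace.exp (s • linF A))) (fderiv ℝ detL 1 (linF A)) 0 := by
      refine HasFDerivAt.comp_hasDerivAt (l := detL (d := d)) (l' := fderiv ℝ detL 1) (f := fun s : ℝ => NormedSpace.exp (s • linF A)) (0:ℝ) ?_ a1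
      simpa using hd
    have b1 : HasDerivAt (fun s : ℝ => 1 + s • linF A) (linF A) 0 := by
      simpa using ((hasDerivAt_id (0:ℝ)).smul_const (linF A)).const_add 1
    have b2 : HasDerivAt (fun s : ℝ => detL (1 + s • linF A)) (fderiv ℝ detL 1 (linF A)) 0 := by
      refine HasFDerivAt.comp_hasDerivAt (l := detL (d := d)) (l' := fderiv ℝ detL 1) (f := fun s : ℝ => 1 + s • linF A) (0:ℝ) ?_ b1
      simpa using hd
    rwa [b2.unique (detL_one_add A hA)] at a2
  have hs : ∀ s, HasDerivAt (fun s : ℝ => detL (NormedSpace.exp (s • linF A))) 0 s := by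
    intro s
    have e : ∀ u : ℝ, detL (NormedSpace.exp (u • linF A)) = detL (NormedSpace.exp (s • linF A)) * detL (NormedSpace.exp ((u - s) • linF A)) := by
      intro u
      rw [← detL_mul, ← NormedSpace.exp_add_of_commute, ← add_smul, add_sub_cancel]
      exact (Commute.refl _).smul_left _ |>.smul_right _
    rw [show (fun u : ℝ => detL (NormedSpace.exp (u • linF A))) = _ from funext e]
    have h1 : HasDerivAt (fun u : ℝ => detL (NormedSpace.exp ((u - s) • linF A))) 0 s := by
      have := HasDerivAt.comp_sub_const (f := fun s : ℝ => detL (NormedSpace.exp (s • linF A))) s s (by simpa using h0)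
      exact this
    simpa using h1.const_mul (detL (NormedSpace.exp (s • linF A)))
  have := is_const_of_deriv_eq_zero (fun s => (hs s).differentiableAt) (fun s => (hs s).deriv) s 0
  rw [this, zero_smul, NormedSpace.exp_zero, detL_one]

lemma mp_exp (A : Fin d → Fin d → ℝ) (hA : Matrix.trace A = 0) (s : ℝ) : 
    MeasurePreserving (fun z => NormedSpace.exp (s • linF A) z) (volume : Measure (Fin d → ℝ)) volume := by
  refine ⟨(NormedSpace.exp (s • linF A)).continuous.measurable, ?_⟩
  have h1 : LinearMap.det ((NormedSpace.exp (s • linF A) : (Fin d → ℝ) →L[ℝ] (Fin d → ℝ)) : (Fin d → ℝ) →ₗ[ℝ] (Fin d → ℝ)) = 1 := detL_exp A hA s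
  have := Real.map_linearMap_volume_pi_eq_smul_volume_pi (f := ((NormedSpace.exp (s • linF A) : (Fin d → ℝ) →L[ℝ] (Fin d → ℝ)) : (Fin d → ℝ) →ₗ[ℝ] (Fin d → ℝ))) (by rw [h1]; simp)
  rw [h1] at this
  simpa using this

lemma alberti (A : Fin d → Fin d → ℝ) (hA : Matrix.trace A = 0) {τ : ℝ} (hτ : 0 < τ) : 
    ∃ ρ : (Fin d → ℝ) → ℝ, Adm ρ ∧ Jc ρ A ≤ ENNReal.ofReal (2 / τ) := by
  let _ : NormedAlgebra ℚ ((Fin d → ℝ) →L[ℝ] (Fin d → ℝ)) := NormedAlgebra.restrictScalars ℚ ℝ _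
  obtain ⟨ρ₀, h₀⟩ := exists_Adm d
  set g : ℝ → (Fin d → ℝ) →L[ℝ] (Fin d → ℝ) := fun s => NormedSpace.exp (s • linF A) with hg
  have gc : Continuous g := NormedSpace.exp_continuous.comp (continuous_id.smul continuous_const)
  have gd : ∀ s, HasDerivAt g (g s * linF A) s := fun s => hasDerivAt_exp_smul_const (linF A) s
  have gmp : ∀ s, MeasurePreserving (fun z => g s z) volume volume := fun s => mp_exp A hA s
  have ginv : ∀ s z, g (-s) (g s z) = z := by
    intro s z
    have : g (-s) * g s = 1 := by
      rw [hg]; simp only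
      rw [← NormedSpace.exp_add_of_commute, ← add_smul, neg_add_cancel, zero_smul, NormedSpace.exp_zero]
      exact (Commute.refl _).smul_left _ |>.smul_right _
    calc g (-s) (g s z) = (g (-s) * g s) z := rfl
      _ = z := by rw [this]; rfl
  obtain ⟨B, hB⟩ := ((isCompact_Icc (a := -τ) (b := τ)).image gc).isBounded.exists_norm_le
  have hB' : ∀ s ∈ Icc (-τ) τ, ‖g s‖ ≤ B := fun s hs => hB _ ⟨s, hs, rfl⟩
  have B0 : 0 ≤ B := (norm_nonneg _).trans (hB' 0 ⟨by linarith, hτ.le⟩)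
  obtain ⟨C, C0, hC⟩ := h₀.exists_C
  obtain ⟨R, R0, hR⟩ := h₀.exists_R
  have hd₀ : ∀ z, HasFDerivAt ρ₀ (fderiv ℝ ρ₀ z) z := fun z => (h₀.contDiff.differentiable one_ne_zero z).hasFDerivAt
  have hcd : Continuous (fderiv ℝ ρ₀) := h₀.contDiff.continuous_fderiv one_ne_zero
  have c1 : Continuous fun p : (Fin d → ℝ) × ℝ => g p.2 p.1 := (gc.comp continuous_snd).clm_apply continuous_fst
  have c2 : Continuous fun p : (Fin d → ℝ) × ℝ => ρ₀ (g p.2 p.1) := h₀.contDiff.continuous.comp c1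
  have c3 : Continuous fun p : (Fin d → ℝ) × ℝ => (fderiv ℝ ρ₀ (g p.2 p.1)).comp (g p.2) := 
    (hcd.comp c1).clm_comp (gc.comp continuous_snd)
  set ρ : (Fin d → ℝ) → ℝ := fun z => τ⁻¹ * ∫ s in (0:ℝ)..τ, ρ₀ (g s z) with hρ
  have c2' : ∀ z, Continuous fun s => ρ₀ (g s z) := fun z => c2.comp (continuous_const.prodMk continuous_id)
  have c3' : ∀ z, Continuous fun s => (fderiv ℝ ρ₀ (g s z)).comp (g s) := fun z => c3.comp (continuous_const.prodMk continuous_id)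
  have hder : ∀ z, HasFDerivAt ρ (τ⁻¹ • ∫ s in (0:ℝ)..τ, (fderiv ℝ ρ₀ (g s z)).comp (g s)) z := by
    intro z
    refine HasFDerivAt.const_mul ?_ _
    refine intervalIntegral.hasFDerivAt_integral_of_dominated_of_fderiv_le (s := univ) (F := fun z s => ρ₀ (g s z))
      (F' := fun z s => (fderiv ℝ ρ₀ (g s z)).comp (g s)) (bound := fun _ => C * B) univ_mem 
      (Eventually.of_forall fun z => (c2' z).aestronglyMeasurable) ((c2' z).intervalIntegrable _ _)
      (c3' z).aestronglyMeasurable (Eventually.of_forall fun s hs z _ => ?_) (by simp) 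
      (Eventually.of_forall fun s hs z _ => ?_)
    · rw [uIoc_of_le hτ.le] at hs
      exact (ContinuousLinearMap.opNorm_comp_le _ _).trans (mul_le_mul (hC _) (hB' s ⟨by linarith [hs.1], hs.2⟩) (norm_nonneg _) C0)
    · exact (hd₀ _).comp z (g s).hasFDerivAt
  have hnn : ∀ z, 0 ≤ ρ z := fun z => by
    refine mul_nonneg (by positivity) ?_
    exact intervalIntegral.integral_nonneg hτ.le fun s _ => h₀.nonneg _
  refine ⟨ρ, ⟨?_, hnn, ?_, ?_⟩, ?_⟩
  · refine contDiff_one_iff_hasFDerivAt.2 ⟨_, ?_, hder⟩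
    have := intervalIntegral.continuous_parametric_intervalIntegral_of_continuous' (μ := volume) (f := fun z s => (fderiv ℝ ρ₀ (g s z)).comp (g s)) c3 0 τ
    exact this.const_smul τ⁻¹
  · refine HasCompactSupport.intro (isCompact_closedBall (0 : Fin d → ℝ) (B * R)) fun z hz => ?_
    rw [mem_closedBall_zero_iff, not_le] at hz
    rw [hρ]; simp only
    rw [intervalIntegral.integral_congr (g := fun _ => 0), intervalIntegral.integral_zero, mul_zero]
    intro s hs
    rw [uIcc_of_le hτ.le] at hs
    refine (hR _ ?_).1
    by_contra hlt
    push Not at hlt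
    have : ‖z‖ ≤ B * R := by
      rw [← ginv s z]
      exact ((g (-s)).le_opNorm _).trans (mul_le_mul (hB' _ ⟨by linarith [hs.2], by linarith [hs.1]⟩) hlt.le (norm_nonneg _) B0)
    linarith
  · have m1 : Measurable fun p : (Fin d → ℝ) × ℝ => ENNReal.ofReal (ρ₀ (g p.2 p.1)) := c2.measurable.ennreal_ofReal
    have e1 : ∀ z, ENNReal.ofReal (ρ z) = ENNReal.ofReal τ⁻¹ * ∫⁻ s in Ioc 0 τ, ENNReal.ofReal (ρ₀ (g s z)) := by
      intro z
      rw [hρ]; simp only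
      rw [ENNReal.ofReal_mul (by positivity), intervalIntegral.integral_of_le hτ.le, 
        ofReal_integral_eq_lintegral_ofReal ((c2' z).integrableOn_Ioc) (Eventually.of_forall fun s => h₀.nonneg _)]
    rw [lintegral_congr e1, lintegral_const_mul _ (Measurable.lintegral_prod_right' m1), 
      lintegral_lintegral_swap (f := fun z s => ENNReal.ofReal (ρ₀ (g s z))) m1.aemeasurable]
    have e2 : ∀ s, ∫⁻ z, ENNReal.ofReal (ρ₀ (g s z)) = 1 := by
      intro s
      rw [← h₀.int]
      exact (gmp s).lintegral_comp h₀.contDiff.continuous.measurable.ennreal_ofReal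
    rw [lintegral_congr e2]
    simp only [lintegral_const, one_mul, Measure.restrict_apply MeasurableSet.univ, univ_inter, Real.volume_Ioc, sub_zero]
    rw [← ENNReal.ofReal_mul (by positivity), inv_mul_cancel₀ hτ.ne', ENNReal.ofReal_one]
  · have e1 : ∀ z, fderiv ℝ ρ z (Matrix.vecMul z A) = τ⁻¹ * (ρ₀ (g τ z) - ρ₀ z) := by
      intro z
      rw [(hder z).fderiv, ← linF_apply, _root_.smul_apply, smul_eq_mul, 
        ContinuousLinearMap.intervalIntegral_apply ((c3' z).intervalIntegrable _ _)]
      congr 1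
      have hg0 : g 0 z = z := by simp [hg]
      have key : ∫ s in (0:ℝ)..τ, ((fderiv ℝ ρ₀ (g s z)).comp (g s)) (linF A z) = ρ₀ (g τ z) - ρ₀ (g 0 z) := by
        refine intervalIntegral.integral_eq_sub_of_hasDerivAt (f := fun s => ρ₀ (g s z)) (a := 0) (b := τ) 
          (f' := fun s => ((fderiv ℝ ρ₀ (g s z)).comp (g s)) (linF A z)) ?_ ?_
        · intro s _
          have a1 : HasDerivAt (fun s => g s z) ((g s * linF A) z) s := by
            simpa using (gd s).clm_apply (hasDerivAt_const s z)
          exact (hd₀ _).comp_hasDerivAt s a1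
        · exact ((c3' z).clm_apply continuous_const).intervalIntegrable _ _
      rw [hg0] at key
      exact key
    rw [Jc]
    simp_rw [e1]
    have m0 : Measurable fun z => ENNReal.ofReal (ρ₀ z) := h₀.contDiff.continuous.measurable.ennreal_ofReal
    have m1 : Measurable fun z => ENNReal.ofReal (ρ₀ (g τ z)) := m0.comp (gmp τ).measurable
    calc ∫⁻ z, ‖τ⁻¹ * (ρ₀ (g τ z) - ρ₀ z)‖ₑ ≤ ∫⁻ z, ENNReal.ofReal τ⁻¹ * (ENNReal.ofReal (ρ₀ (g τ z)) + ENNReal.ofReal (ρ₀ z)) := by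
          refine lintegral_mono fun z => ?_
          rw [enorm_mul, Real.enorm_of_nonneg (by positivity : 0 ≤ τ⁻¹)]
          gcongr
          rw [← Real.enorm_of_nonneg (h₀.nonneg _), ← Real.enorm_of_nonneg (h₀.nonneg z)]
          exact enorm_sub_le
      _ = ENNReal.ofReal τ⁻¹ * (1 + 1) := by
          have m2 : Measurable fun z => ENNReal.ofReal (ρ₀ (g τ z)) + ENNReal.ofReal (ρ₀ z) := m1.add m0
          have m3 : ∫⁻ z, ENNReal.ofReal (ρ₀ (g τ z)) = 1 := by
            rw [← h₀.int]
            exact (gmp τ).lintegral_comp m0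
          rw [lintegral_const_mul _ m2, lintegral_add_left m1, h₀.int, m3]
      _ ≤ _ := by
          rw [one_add_one_eq_two, div_eq_inv_mul, ENNReal.ofReal_mul (by positivity)]
          simp
end

noncomputable section
set_option linter.unusedSectionVars false

variable {d : ℕ}

lemma Jc_nhds {ρ : (Fin d → ℝ) → ℝ} (h : Adm ρ) {A : Fin d → Fin d → ℝ} {ε : ℝ≥0∞} (hA : Jc ρ A < ε) :
    ∀ᶠ B in 𝓝 A, Jc ρ B < ε := by
  obtain ⟨C, C0, hC⟩ := Jc_le h
  have h1 : ∀ B, Jc ρ B ≤ Jc ρ A + ENNReal.ofReal (C * ‖B - A‖) := by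
    intro B
    have := Jc_add ρ A (B - A)
    rw [add_sub_cancel] at this
    exact this.trans (add_le_add le_rfl (hC _))
  have h2 : Tendsto (fun B => Jc ρ A + ENNReal.ofReal (C * ‖B - A‖)) (𝓝 A) (𝓝 (Jc ρ A + ENNReal.ofReal (C * ‖A - A‖))) := by
    refine tendsto_const_nhds.add ?_
    have : Continuous fun B : Fin d → Fin d → ℝ => ENNReal.ofReal (C * ‖B - A‖) := ENNReal.continuous_ofReal.comp (by fun_prop)
    exact this.tendsto A
  simp only [sub_self, norm_zero, mul_zero, ENNReal.ofReal_zero, add_zero] at h2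
  filter_upwards [h2.eventually_lt_const hA] with B hB using (h1 B).trans_lt hB

lemma exists_cover (d : ℕ) {ε : ℝ≥0∞} (hε : 0 < ε) : ∃ (N : ℕ) (ρ : ℕ → (Fin d → ℝ) → ℝ), (∀ k, Adm (ρ k)) ∧ 
    ∀ A : Fin d → Fin d → ℝ, Matrix.trace A = 0 → ‖A‖ ≤ 1 → ∃ k < N, Jc (ρ k) A < ε := by
  have h1 : ∀ A : Fin d → Fin d → ℝ, ∃ ρ : (Fin d → ℝ) → ℝ, Adm ρ ∧ (Matrix.trace A = 0 → Jc ρ A < ε) := by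
    intro A
    by_cases hA : Matrix.trace A = 0
    · obtain ⟨n, hn⟩ := ENNReal.exists_inv_nat_lt hε.ne'
      obtain ⟨ρ, hρ, h⟩ := alberti A hA (τ := 2 * (n + 1)) (by positivity)
      refine ⟨ρ, hρ, fun _ => h.trans_lt (lt_of_le_of_lt ?_ hn)⟩
      rw [show (2 / (2 * (n + 1)) : ℝ) = ((n:ℝ) + 1)⁻¹ by field_simp, ENNReal.ofReal_inv_of_pos (by positivity)]
      refine ENNReal.inv_le_inv.2 ?_
      rw [← ENNReal.ofReal_natCast]
      exact ENNReal.ofReal_le_ofReal (by linarith)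
    · obtain ⟨ρ, hρ⟩ := exists_Adm d
      exact ⟨ρ, hρ, fun h => absurd h hA⟩
  choose ρ hρ hJ using h1
  have hK : IsCompact ({A : Fin d → Fin d → ℝ | Matrix.trace A = 0} ∩ Metric.closedBall 0 1) := by
    refine IsCompact.inter_left (isCompact_closedBall _ _) ?_
    have : Continuous fun A : Fin d → Fin d → ℝ => Matrix.trace A := by
      simp only [Matrix.trace, Matrix.diag]
      fun_prop
    exact isClosed_eq this continuous_const
  obtain ⟨t, ht, hcov⟩ := hK.elim_nhds_subcover (fun A => {B | Jc (ρ A) B < ε}) (by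
    intro A hA
    exact Jc_nhds (hρ A) (hJ A hA.1))
  refine ⟨t.toList.length, fun k => ρ (t.toList.getD k 0), fun k => hρ _, fun A hA hA1 => ?_⟩
  have := hcov ⟨hA, by simpa using hA1⟩
  simp only [mem_iUnion] at this
  obtain ⟨B, hB, hAB⟩ := this
  obtain ⟨k, hk, hkB⟩ := List.getElem_of_mem (Finset.mem_toList.2 hB)
  refine ⟨k, hk, ?_⟩
  show Jc (ρ (t.toList.getD k 0)) A < ε
  rw [List.getD_eq_getElem _ _ hk, hkB]
  exact hAB

/-- stick breaking weights -/
def stick (q : ℕ → ℝ) (k : ℕ) : ℝ := q k * ∏ j ∈ Finset.range k, (1 - q j)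

lemma stick_sum (q : ℕ → ℝ) (n : ℕ) : ∑ k ∈ Finset.range n, stick q k = 1 - ∏ j ∈ Finset.range n, (1 - q j) := by
  induction n with
  | zero => simp
  | succ n ih => rw [Finset.sum_range_succ, ih, Finset.prod_range_succ, stick]; ring

lemma stick_nonneg {q : ℕ → ℝ} (h : ∀ j, 0 ≤ q j ∧ q j ≤ 1) (k : ℕ) : 0 ≤ stick q k :=
  mul_nonneg (h k).1 (Finset.prod_nonneg fun j _ => sub_nonneg.2 (h j).2)

lemma stick_le_one {q : ℕ → ℝ} (h : ∀ j, 0 ≤ q j ∧ q j ≤ 1) (k : ℕ) : stick q k ≤ 1 :=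
  mul_le_one₀ (h k).2 (Finset.prod_nonneg fun j _ => sub_nonneg.2 (h j).2) 
    (Finset.prod_le_one (fun j _ => sub_nonneg.2 (h j).2) fun j _ => by linarith [(h j).1])

lemma stick_tc {q : ℕ → Torus d → ℝ} (h : ∀ j, TC1 (q j)) (k : ℕ) : TC1 (fun x => stick (fun j => q j x) k) := by
  unfold stick
  refine (h k).mul ?_
  induction k with
  | zero => simpa using TC1.const 1
  | succ k ih => 
    simp_rw [Finset.prod_range_succ]
    refine ih.mul ?_
    simp_rw [show ∀ x, 1 - q k x = 1 + (-1) * q k x from fun x => by ring]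
    exact (TC1.const 1).add ((TC1.const (-1)).mul (h k))

/-- family from stick breaking -/
def stickFam (N : ℕ) (q : ℕ → Torus d → ℝ) (ρ : ℕ → (Fin d → ℝ) → ℝ) (hq : ∀ j, TC1 (q j)) (h01 : ∀ j x, 0 ≤ q j x ∧ q j x ≤ 1)
    (hN : ∀ x, q N x = 1) (hρ : ∀ j, Adm (ρ j)) : Fam d where
  N := N + 1
  ψ := fun k x => stick (fun j => q j x) k
  ρ := fun k => ρ k
  tc := fun k => stick_tc hq k
  nonneg := fun k x => stick_nonneg (fun j => h01 j x) k
  sum := fun x => by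
    rw [Fin.sum_univ_eq_sum_range (fun k => stick (fun j => q j x) k), stick_sum, Finset.prod_range_succ, hN]; simp
  adm := fun k => hρ k

lemma clamp_tst (f : C(Torus d, ℝ)) (n : ℕ) : ∃ q : Torus d → ℝ, TC1 q ∧ (∀ x, 0 ≤ q x ∧ q x ≤ 1) ∧ 
    ∀ x, ∀ c ∈ Icc (0:ℝ) 1, |q x - c| ≤ |f x - c| + 3 / (n + 3) := by
  set δ : ℝ := 1 / (n + 3) with hδ
  have δ0 : 0 < δ := by positivity
  have δ1 : δ ≤ 1/3 := by rw [hδ]; gcongr; linarith [(Nat.cast_nonneg n : (0:ℝ) ≤ n)]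
  have hcl : Continuous fun x => δ + (1 - 2 * δ) * max 0 (min 1 (f x)) := by fun_prop
  obtain ⟨ψ, hψ, hf⟩ := tst_dense (⟨_, hcl⟩ : C(Torus d, ℝ)) δ0
  simp only [ContinuousMap.coe_mk] at hf
  refine ⟨ψ, hψ.tc1, fun x => ?_, fun x c hc => ?_⟩
  · have h1 : 0 ≤ max 0 (min 1 (f x)) := le_max_left _ _
    have h2 : max 0 (min 1 (f x)) ≤ 1 := max_le zero_le_one (min_le_left _ _)
    have h3 := abs_lt.1 (hf x)
    constructor <;> nlinarith
  · have h1 : 0 ≤ max 0 (min 1 (f x)) := le_max_left _ _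
    have h2 : max 0 (min 1 (f x)) ≤ 1 := max_le zero_le_one (min_le_left _ _)
    have h3 : |max 0 (min 1 (f x)) - c| ≤ |f x - c| := by
      rcases hc with ⟨c0, c1⟩
      rcases le_total (f x) 0 with h | h
      · rw [min_eq_right (h.trans zero_le_one), max_eq_left h, abs_le]
        constructor <;> linarith [neg_abs_le (f x - c), le_abs_self (f x - c), abs_nonneg (f x - c)]
      rcases le_total (f x) 1 with h' | h'
      · rw [min_eq_right h', max_eq_right h]
      · rw [min_eq_left h', max_eq_right zero_le_one, abs_le]
        constructor <;> linarith [neg_abs_le (f x - c), le_abs_self (f x - c), abs_nonneg (f x - c)]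
    have h4 : |ψ x - max 0 (min 1 (f x))| ≤ 3 * δ := by
      have h3 := abs_lt.1 (hf x)
      rw [abs_le]
      constructor <;> nlinarith
    have h5 : 3 / ((n:ℝ) + 3) = 3 * δ := by rw [hδ]; ring
    rw [h5]
    calc |ψ x - c| = |(ψ x - max 0 (min 1 (f x))) + (max 0 (min 1 (f x)) - c)| := by ring_nf
      _ ≤ _ := (abs_add_le _ _).trans (by linarith)

lemma exists_q (d : ℕ) : ∃ D : ℕ → Torus d → ℝ, (∀ i, TC1 (D i)) ∧ (∀ i x, 0 ≤ D i x ∧ D i x ≤ 1) ∧ 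
    ∀ (μ : Measure (Torus d)), IsFiniteMeasure μ → ∀ G, MeasurableSet G → ∀ δ : ℝ≥0∞, 0 < δ → 
      ∃ i, ∫⁻ x, ‖D i x - G.indicator (fun _ => (1:ℝ)) x‖ₑ ∂μ ≤ δ := by
  choose Q hQ h01 hQc using fun p : ℕ × ℕ => clamp_tst (TopologicalSpace.denseSeq C(Torus d, ℝ) p.1) p.2
  refine ⟨fun i => Q i.unpair, fun i => hQ _, fun i => h01 _, fun μ hμ G hG δ hδ => ?_⟩
  obtain ⟨δ', hδ', hlt⟩ : ∃ δ' : ℝ, 0 < δ' ∧ ENNReal.ofReal δ' * (1 + μ univ + μ univ) ≤ δ := by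
    rcases eq_or_ne δ ⊤ with h | h
    · exact ⟨1, one_pos, by rw [h]; exact le_top⟩
    refine ⟨(δ / (1 + μ univ + μ univ)).toReal, ENNReal.toReal_pos ?_ ?_, ?_⟩
    · exact (ENNReal.div_pos hδ.ne' (by simp [measure_ne_top])).ne'
    · exact ENNReal.div_ne_top h (by simp)
    · rw [ENNReal.ofReal_toReal (ENNReal.div_ne_top h (by simp)), ENNReal.div_mul_cancel (by simp) (by simp [measure_ne_top])]
  have hi : Integrable (G.indicator fun _ => (1:ℝ)) μ := (integrable_const 1).indicator hG
  obtain ⟨f, hf, -⟩ := hi.exists_boundedContinuous_lintegral_sub_le (ENNReal.ofReal_pos.2 hδ').ne'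
  obtain ⟨i, hfi⟩ := (TopologicalSpace.denseRange_denseSeq C(Torus d, ℝ)).exists_dist_lt f.toContinuousMap hδ'
  obtain ⟨n, hn⟩ := exists_nat_gt (3 / δ')
  refine ⟨Nat.pair i n, ?_⟩
  simp only [Nat.unpair_pair]
  have hpt : ∀ x, ‖Q (i, n) x - G.indicator (fun _ => (1:ℝ)) x‖ₑ ≤ ‖G.indicator (fun _ => (1:ℝ)) x - f x‖ₑ + (ENNReal.ofReal δ' + ENNReal.ofReal δ') := by
    intro x
    have hc : G.indicator (fun _ => (1:ℝ)) x ∈ Icc (0:ℝ) 1 := by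
      by_cases h : x ∈ G <;> simp [h]
    have h1 := hQc (i, n) x _ hc
    have h2 : |TopologicalSpace.denseSeq C(Torus d, ℝ) i x - f x| ≤ δ' := by
      rw [abs_sub_comm, ← Real.dist_eq]
      exact (ContinuousMap.dist_apply_le_dist (f := f.toContinuousMap) x).trans hfi.le
    have h3 : 3 / ((n:ℝ) + 3) ≤ δ' := by
      rw [div_le_iff₀ (by positivity)]
      rw [div_lt_iff₀ hδ'] at hn
      nlinarith
    rw [← ofReal_norm, ← ofReal_norm, ← ENNReal.ofReal_add hδ'.le hδ'.le, ← ENNReal.ofReal_add (norm_nonneg _) (by positivity)]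
    refine ENNReal.ofReal_le_ofReal ?_
    simp only [Real.norm_eq_abs]
    have h4 := abs_sub_le (TopologicalSpace.denseSeq C(Torus d, ℝ) i x) (f x) (G.indicator (fun _ => (1:ℝ)) x)
    rw [abs_sub_comm (f x)] at h4
    simp only at h1
    linarith
  calc _ ≤ _ := lintegral_mono hpt
    _ = (∫⁻ x, ‖G.indicator (fun _ => (1:ℝ)) x - f x‖ₑ ∂μ) + (ENNReal.ofReal δ' + ENNReal.ofReal δ') * μ univ := by
      rw [lintegral_add_right _ measurable_const, lintegral_const]
    _ ≤ ENNReal.ofReal δ' + (ENNReal.ofReal δ' + ENNReal.ofReal δ') * μ univ := by gcongr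
    _ = ENNReal.ofReal δ' * (1 + μ univ + μ univ) := by ring
    _ ≤ δ := hlt
end

noncomputable section
set_option linter.unusedSectionVars false

variable {d : ℕ}

lemma ae_of_fast {α : Type*} [MeasurableSpace α] {μ : Measure α} (f : ℕ → α → ℝ) (g : α → ℝ) (hf : ∀ n, Measurable (f n)) (hg : Measurable g)
    (h : ∀ n, ∫⁻ x, ‖f n x - g x‖ₑ ∂μ ≤ (1/2) ^ n) : ∀ᵐ x ∂μ, Tendsto (fun n => f n x) atTop (𝓝 (g x)) := by
  have m : ∀ n, Measurable fun x => ‖f n x - g x‖ₑ := fun n => ((hf n).sub hg).enorm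
  have h1 : ∫⁻ x, ∑' n, ‖f n x - g x‖ₑ ∂μ ≠ ⊤ := by
    rw [lintegral_tsum fun n => (m n).aemeasurable]
    refine ne_top_of_le_ne_top ?_ (ENNReal.tsum_le_tsum h)
    rw [ENNReal.tsum_geometric]
    simp
  filter_upwards [ae_lt_top (Measurable.ennreal_tsum m) h1] with x hx
  have h2 := ENNReal.tendsto_atTop_zero_of_tsum_ne_top hx.ne
  rw [tendsto_iff_edist_tendsto_0]
  simpa [edist_eq_enorm_sub] using h2

/-- stick-breaking cut-offs -/
def qS (N : ℕ) (D : ℕ → Torus d → ℝ) (i : Fin N → ℕ) (j : ℕ) (x : Torus d) : ℝ := if h : j < N then D (i ⟨j, h⟩) x else 1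

lemma qS1 {N : ℕ} {D : ℕ → Torus d → ℝ} (hD : ∀ i, TC1 (D i)) (i : Fin N → ℕ) (j : ℕ) : TC1 (qS N D i j) := by
  by_cases h : j < N
  · have : qS N D i j = D (i ⟨j, h⟩) := by funext x; simp [qS, h]
    rw [this]; exact hD _
  · have : qS N D i j = fun _ => 1 := by funext x; simp [qS, h]
    rw [this]; exact TC1.const 1

lemma qS2 {N : ℕ} {D : ℕ → Torus d → ℝ} (hD : ∀ i x, 0 ≤ D i x ∧ D i x ≤ 1) (i : Fin N → ℕ) (j : ℕ) (x : Torus d) : 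
    0 ≤ qS N D i j x ∧ qS N D i j x ≤ 1 := by
  by_cases h : j < N
  · simpa [qS, h] using hD _ x
  · simp [qS, h]

lemma qS3 {N : ℕ} (D : ℕ → Torus d → ℝ) (i : Fin N → ℕ) (x : Torus d) : qS N D i N x = 1 := by simp [qS]

lemma cost_small {D : ℕ → Torus d → ℝ} (hD : ∀ i, TC1 (D i)) (hD01 : ∀ i x, 0 ≤ D i x ∧ D i x ≤ 1)
    (hDd : ∀ (μ : Measure (Torus d)), IsFiniteMeasure μ → ∀ G, MeasurableSet G → ∀ δ : ℝ≥0∞, 0 < δ → 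
      ∃ i, ∫⁻ x, ‖D i x - G.indicator (fun _ => (1:ℝ)) x‖ₑ ∂μ ≤ δ)
    {N : ℕ} {ρ : ℕ → (Fin d → ℝ) → ℝ} (hρ : ∀ k, Adm (ρ k)) {ε : ℝ≥0∞} 
    (hcov : ∀ A : Fin d → Fin d → ℝ, Matrix.trace A = 0 → ‖A‖ ≤ 1 → ∃ k < N, Jc (ρ k) A < ε)
    {v : Torus d → Fin d → ℝ} {Dp Dm : Fin d → Fin d → Measure (Torus d)} (h : IBP v Dp Dm) 
    (F : (Fin N → ℕ) → Fam d) (hF : F = fun i => stickFam N (qS N D i) ρ (qS1 hD i) (qS2 hD01 i) (qS3 D i) hρ) 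
    {δ : ℝ≥0∞} (hn : ε * muOf Dp Dm univ < δ) : 
    ∃ i, (F i).cost (muOf Dp Dm) (mOf Dp Dm) ≤ δ := by
  have hfin := h.fin
  have mm := meas_mOf Dp Dm
  obtain ⟨G, hGd⟩ : ∃ G : ℕ → Set (Torus d), G = fun j => {x | Jc (ρ j) (mOf Dp Dm x) < ε} := ⟨_, rfl⟩
  have hGm : ∀ j x, x ∈ G j ↔ Jc (ρ j) (mOf Dp Dm x) < ε := fun j x => by rw [hGd]; rfl
  have hG : ∀ j, MeasurableSet (G j) := fun j => by
    rw [hGd]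
    exact measurableSet_lt ((meas_Jc _).comp mm) measurable_const
  have hl0 : ∀ l : ℕ, (0:ℝ≥0∞) < (1/2)^l := fun l => ENNReal.pow_pos (by simp) l
  have hex := fun (l : ℕ) (j : Fin (N)) => hDd (muOf Dp Dm) hfin (G j) (hG j) ((1/2)^l) (hl0 l)
  choose i hi using hex
  obtain ⟨Q, hQ1, hQ2⟩ : ∃ Q : ℕ → Torus d → ℝ, (∀ j < N, Q j = (G j).indicator (fun _ => (1:ℝ))) ∧ ∀ j, ¬ j < N → Q j = fun _ => 1 := 
    ⟨fun j => if j < N then (G j).indicator (fun _ => (1:ℝ)) else fun _ => 1, fun j hj => if_pos hj, fun j hj => if_neg hj⟩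
  have hQ01 : ∀ j x, 0 ≤ Q j x ∧ Q j x ≤ 1 := by
    intro j x
    by_cases h : j < N
    · by_cases hx : x ∈ G j
      · simp [hQ1 j h, hx]
      · simp [hQ1 j h, hx]
    · simp [hQ2 j h]
  have hconv : ∀ᵐ x ∂(muOf Dp Dm), ∀ j, Tendsto (fun l => qS N D (i l) j x) atTop (𝓝 (Q j x)) := by
    rw [ae_all_iff]
    intro j
    by_cases hj : j < N
    · have := ae_of_fast (μ := (muOf Dp Dm)) (fun l => D (i l ⟨j, hj⟩)) ((G j).indicator fun _ => (1:ℝ)) (fun l => (hD _).1.measurable) 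
        (measurable_const.indicator (hG j)) (fun l => hi l ⟨j, hj⟩)
      rw [hQ1 j hj]
      simpa [qS, hj] using this
    · exact Eventually.of_forall fun x => by simp [qS, hQ2 j hj, hj]
  have hst : ∀ᵐ x ∂(muOf Dp Dm), ∀ k, Tendsto (fun l => stick (fun j => qS N D (i l) j x) k) atTop (𝓝 (stick (fun j => Q j x) k)) := by
    filter_upwards [hconv] with x hx k
    exact (hx k).mul (tendsto_finsetProd _ fun j _ => tendsto_const_nhds.sub (hx j))
  have hc : ∀ i, (F i).cost (muOf Dp Dm) (mOf Dp Dm) = ∑ k : Fin (N + 1), ∫⁻ x, ENNReal.ofReal (stick (fun j => qS N D i j x) k) * Jc (ρ k) (mOf Dp Dm x) ∂(muOf Dp Dm) := by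
    intro i
    rw [hF]
    rfl
  have hlim : Tendsto (fun l => (F (i l)).cost (muOf Dp Dm) (mOf Dp Dm)) atTop (𝓝 (∑ k : Fin (N + 1), ∫⁻ x, ENNReal.ofReal (stick (fun j => Q j x) k) * Jc (ρ k) (mOf Dp Dm x) ∂(muOf Dp Dm))) := by
    rw [show (fun l => (F (i l)).cost (muOf Dp Dm) (mOf Dp Dm)) = _ from funext fun l => hc (i l)]
    refine tendsto_finsetSum _ fun k _ => ?_
    obtain ⟨C, C0, hC⟩ := Jc_le (hρ k)
    have hCi := Jc_int h C0 hC
    have mJ : Measurable fun x => Jc (ρ k) (mOf Dp Dm x) := (meas_Jc _).comp mm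
    refine tendsto_lintegral_of_dominated_convergence (fun _ => ENNReal.ofReal C) (fun l => ?_) (fun l => ?_) ?_ ?_
    · exact ((stick_tc (qS1 hD (i l)) k).1.measurable.ennreal_ofReal).mul mJ
    · filter_upwards [hCi] with x hx
      calc _ ≤ 1 * ENNReal.ofReal C := by
            refine mul_le_mul' ?_ hx
            rw [← ENNReal.ofReal_one]
            exact ENNReal.ofReal_le_ofReal (stick_le_one (fun j => qS2 hD01 (i l) j x) k)
        _ = _ := one_mul _
    · rw [lintegral_const]; exact ENNReal.mul_ne_top ENNReal.ofReal_ne_top (measure_ne_top _ _)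
    · filter_upwards [hst, hCi] with x hx hx2
      refine ENNReal.Tendsto.mul_const ?_ (Or.inr (ne_top_of_le_ne_top ENNReal.ofReal_ne_top hx2))
      exact ENNReal.tendsto_ofReal (hx k)
  have hbd : (∑ k : Fin (N + 1), ∫⁻ x, ENNReal.ofReal (stick (fun j => Q j x) k) * Jc (ρ k) (mOf Dp Dm x) ∂(muOf Dp Dm)) ≤ ε * (muOf Dp Dm) univ := by
    have mQ : ∀ j, Measurable (Q j) := by
      intro j
      by_cases hj : j < N
      · rw [hQ1 j hj]
        exact measurable_const.indicator (hG j)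
      · rw [hQ2 j hj]
        exact measurable_const
    rw [← lintegral_finsetSum]
    · rw [← lintegral_const]
      refine lintegral_mono_ae ?_
      filter_upwards [h.norm_m, h.trace] with x hx1 hx2
      obtain ⟨j0, hj0, hJ0⟩ := hcov (mOf Dp Dm x) hx2 hx1
      calc ∑ k : Fin (N + 1), ENNReal.ofReal (stick (fun j => Q j x) k) * Jc (ρ k) (mOf Dp Dm x) 
          ≤ ∑ k : Fin (N + 1), ENNReal.ofReal (stick (fun j => Q j x) k) * ε := by
            refine Finset.sum_le_sum fun k _ => ?_
            by_cases hk : (k : ℕ) < N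
            · by_cases hxk : x ∈ G k
              · exact mul_le_mul' le_rfl (le_of_lt ((hGm _ _).1 hxk))
              · simp [stick, hQ1 _ hk, hxk]
            · have : stick (fun j => Q j x) k = 0 := by
                have hx0 : x ∈ G j0 := (hGm _ _).2 hJ0
                have hz : (1 - Q j0 x) = 0 := by simp [hQ1 j0 hj0, hx0]
                have hjk : j0 ∈ Finset.range k := Finset.mem_range.2 (by omega)
                have hp : ∏ j ∈ Finset.range k, (1 - Q j x) = 0 := Finset.prod_eq_zero hjk hz
                rw [stick, hp, mul_zero]
              rw [this]; simp
        _ = ENNReal.ofReal (∑ k : Fin (N + 1), stick (fun j => Q j x) k) * ε := by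
            rw [← Finset.sum_mul, ENNReal.ofReal_sum_of_nonneg (f := fun k : Fin (N + 1) => stick (fun j => Q j x) k) fun k _ => stick_nonneg (fun j => hQ01 j x) k]
        _ = ε := by
            rw [Fin.sum_univ_eq_sum_range (fun k => stick (fun j => Q j x) k), stick_sum, Finset.prod_range_succ]
            simp [hQ2 N (lt_irrefl N)]
    · intro k _
      have : Measurable fun x => stick (fun j => Q j x) k := by
        unfold stick
        exact (mQ k).mul (Finset.measurable_fun_prod _ fun j _ => measurable_const.sub (mQ j))
      exact this.ennreal_ofReal.mul ((meas_Jc _).comp mm)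
  obtain ⟨l, hl⟩ := (hlim.eventually_lt_const (hbd.trans_lt hn)).exists
  exact ⟨_, hl.le⟩

lemma exists_fams (d : ℕ) : ∃ Fs : ℕ → Fam d, ∀ (v : Torus d → Fin d → ℝ) (Dp Dm : Fin d → Fin d → Measure (Torus d)), 
    IBP v Dp Dm → ∀ δ : ℝ≥0∞, 0 < δ → ∃ a, (Fs a).cost (muOf Dp Dm) (mOf Dp Dm) ≤ δ := by
  obtain ⟨D, hD, hD01, hDd⟩ := exists_q d
  have hcov0 : ∀ n : ℕ, (0:ℝ≥0∞) < ((n:ℝ≥0∞) + 1)⁻¹ := fun n => by simp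
  choose N ρ hρ hcov using fun n : ℕ => exists_cover d (hcov0 n)
  let F : (Σ n, Fin (N n) → ℕ) → Fam d := fun p => stickFam (N p.1) (qS (N p.1) D p.2) (ρ p.1) (qS1 hD _) (qS2 hD01 _) (qS3 D _) (hρ _)
  have : Nonempty (Σ n, Fin (N n) → ℕ) := ⟨⟨0, fun _ => 0⟩⟩
  obtain ⟨e, he⟩ := exists_surjective_nat (Σ n, Fin (N n) → ℕ)
  refine ⟨fun a => F (e a), fun v Dp Dm h δ hδ => ?_⟩
  suffices hs : ∃ p, (F p).cost (muOf Dp Dm) (mOf Dp Dm) ≤ δ by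
    obtain ⟨p, hp⟩ := hs
    obtain ⟨a, rfl⟩ := he p
    exact ⟨a, hp⟩
  have hfin := h.fin
  obtain ⟨n, hn⟩ : ∃ n : ℕ, ((n:ℝ≥0∞) + 1)⁻¹ * muOf Dp Dm univ < δ := by
    have h1 : Tendsto (fun n : ℕ => (((n + 1 : ℕ) : ℝ≥0∞))⁻¹ * muOf Dp Dm univ) atTop (𝓝 (0 * muOf Dp Dm univ)) := 
      ENNReal.Tendsto.mul_const (ENNReal.tendsto_inv_nat_nhds_zero.comp (tendsto_add_atTop_nat 1)) (Or.inr (measure_ne_top _ _))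
    rw [zero_mul] at h1
    obtain ⟨n, hn⟩ := (h1.eventually_lt_const hδ).exists
    exact ⟨n, by simpa using hn⟩
  obtain ⟨i, hi⟩ := cost_small hD hD01 hDd (hρ n) (hcov n) h _ rfl hn
  exact ⟨⟨n, i⟩, hi⟩

lemma smallComm {T : ℝ} {b : ℝ → Torus d → Vec d} (hb : Measurable (Function.uncurry b))
    (hdiv : DivergenceFree T d b) (hBV : MemL1locBVIco T d b)
    (hbL1 : ∫⁻ t in Set.Ioo 0 T, ∫⁻ x, (‖b t x‖₊ : ℝ≥0∞) ∂(volume : Measure (Torus d)) < ∞) 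
    {T' : ℝ} (h0 : 0 ≤ T') (hT' : T' < T) : SmallComm T' (bet b) := by
  obtain ⟨Dp, Dm, hst, hintg⟩ := hBV
  obtain ⟨Fs, hFs⟩ := exists_fams d
  choose C hC hCb using fun a => (Fs a).Th_bound
  have hsub : Ioc 0 T' ⊆ Ioo 0 T := fun t ht => ⟨ht.1, ht.2.trans_lt hT'⟩
  have hibp : ∀ᵐ r ∂(volume.restrict (Ioc 0 T')), IBP (bet b r) (Dp r) (Dm r) := by
    have a1 := ae_restrict_of_ae_restrict_of_subset hsub hdiv
    have a2 := ae_restrict_of_ae_restrict_of_subset (hsub.trans Ioo_subset_Ico_self) hst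
    have m : Measurable fun t => ∫⁻ x, (‖b t x‖₊ : ℝ≥0∞) ∂(volume : Measure (Torus d)) := 
      Measurable.lintegral_prod_right' (f := fun p : ℝ × Torus d => (‖b p.1 p.2‖₊ : ℝ≥0∞)) hb.enorm
    have a3 := ae_restrict_of_ae_restrict_of_subset hsub (ae_lt_top m hbL1.ne)
    filter_upwards [a1, a2, a3] with r r1 r2 r3
    exact IBP.of (hb.comp (measurable_const.prodMk measurable_id)) r3 r2 r1
  refine ⟨Fs, fun r => muOf (Dp r) (Dm r) univ, C, ?_, hC, fun a => ?_, ?_⟩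
  · rcases h0.eq_or_lt with h | h
    · rw [← h]; simp
    have := hintg ((T - T') / 2) ⟨by linarith, by linarith⟩
    simp_rw [muOf_univ]
    refine lt_of_le_of_lt (lintegral_mono_set fun t ht => ?_) this
    exact ⟨ht.1.le, by linarith [ht.2]⟩
  · filter_upwards [hCb a] with n hn
    filter_upwards [hibp] with r hr
    exact hn _ _ _ hr
  · filter_upwards [hibp] with r hr δ hδ
    obtain ⟨a, ha⟩ := hFs _ _ _ hr δ hδ
    exact ⟨a, ((Fs a).Th_limsup hr).trans ha⟩
end

noncomputable section
set_option linter.unusedSectionVars false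
variable {d : ℕ} {T : ℝ}

/-- all time marginals are Lebesgue -/
def Marg (η : Measure (PathSpace T d)) : Prop :=
  ∀ t : Set.Icc (0 : ℝ) T, Measure.map (fun γ : PathSpace T d => γ t) η = (volume : Measure (Torus d))

lemma cont_ext (hT : 0 ≤ T) : 
    Continuous (Function.uncurry fun t (γ : PathSpace T d) => extendPath hT γ t) := by
  have h1 : Continuous fun q : ℝ × PathSpace T d => (q.2, projIcc 0 T hT q.1) := 
    continuous_snd.prodMk (continuous_projIcc.comp continuous_fst)
  have h2 : Continuous fun q : PathSpace T d × Icc 0 T => q.1 q.2 := ContinuousEval.continuous_eval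
  exact h2.comp h1

lemma lint_marg (hT : 0 ≤ T) {η : Measure (PathSpace T d)} [SFinite η] (h : Marg η) {f : ℝ → Torus d → ℝ≥0∞}
    (hf : Measurable (Function.uncurry f)) :
    ∫⁻ γ, (∫⁻ s in Ioc 0 T, f s (extendPath hT γ s)) ∂η = ∫⁻ s in Ioc 0 T, ∫⁻ x, f s x := by
  have m1 : Measurable (Function.uncurry fun (γ : PathSpace T d) (s : ℝ) => f s (extendPath hT γ s)) := by
    have : Measurable fun q : PathSpace T d × ℝ => (q.2, extendPath hT q.1 q.2) := 
      measurable_snd.prodMk ((meas_ext hT).comp measurable_swap)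
    exact hf.comp this
  rw [lintegral_lintegral_swap m1.aemeasurable]
  refine lintegral_congr fun s => ?_
  have m2 : Measurable fun x => f s x := hf.comp (measurable_const.prodMk measurable_id)
  rw [← h (projIcc 0 T hT s), lintegral_map m2 (meas_e0 _)]
  rfl

/-- an approximate flow -/
structure Appr (hT : 0 ≤ T) (b : ℝ → Torus d → Fin d → ℝ) (ε : ℝ) (β : ℝ → Torus d → Fin d → ℝ)
    (η : Measure (PathSpace T d)) : Prop where
  prob : IsProbabilityMeasure η
  marg : Marg η
  meas : Measurable (Function.uncurry β)
  close : ∫⁻ s in Ioc 0 T, ∫⁻ x, ‖β s x - b s x‖ₑ ≤ ENNReal.ofReal ε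
  curve : ∀ᵐ γ ∂η, ∀ t : Icc (0:ℝ) T, ‖γ t - γ ⟨0, Set.left_mem_Icc.2 hT⟩ - 
    pr (∫ s in Ioc (0:ℝ) t, β s (extendPath hT γ s))‖ₑ ≤ ENNReal.ofReal ε

/-- defect at time `t` -/
def defect (hT : 0 ≤ T) (c : ℝ → Torus d → Fin d → ℝ) (t : Icc (0:ℝ) T) (γ : PathSpace T d) : Torus d :=
  γ t - γ ⟨0, Set.left_mem_Icc.2 hT⟩ - pr (∫ s in Ioc (0:ℝ) t, c s (extendPath hT γ s))

/-- distance along path -/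
def dst (hT : 0 ≤ T) (c c' : ℝ → Torus d → Fin d → ℝ) (γ : PathSpace T d) : ℝ≥0∞ :=
  ∫⁻ s in Ioc 0 T, ‖c s (extendPath hT γ s) - c' s (extendPath hT γ s)‖ₑ

lemma enorm_pr_le (x : Fin d → ℝ) : ‖pr x‖ₑ ≤ ‖x‖ₑ := enorm_le_iff_norm_le.2 (norm_pr_le x)

lemma along_meas (hT : 0 ≤ T) {c : ℝ → Torus d → Fin d → ℝ} (hc : Measurable (Function.uncurry c)) (γ : PathSpace T d) :
    Measurable fun s => c s (extendPath hT γ s) := 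
  hc.comp (measurable_id.prodMk ((meas_ext hT).comp (measurable_id.prodMk measurable_const)))

lemma defect_le (hT : 0 ≤ T) {c c' : ℝ → Torus d → Fin d → ℝ} (hc : Measurable (Function.uncurry c))
    (hc' : Measurable (Function.uncurry c')) (γ : PathSpace T d) 
    (hi : IntegrableOn (fun s => c s (extendPath hT γ s)) (Ioc 0 T)) (t : Icc (0:ℝ) T) :
    ‖defect hT c t γ‖ₑ ≤ ‖defect hT c' t γ‖ₑ + dst hT c c' γ := by
  by_cases hF : dst hT c c' γ = ∞
  · rw [hF, add_top]; exact le_top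
  have hd : IntegrableOn (fun s => c s (extendPath hT γ s) - c' s (extendPath hT γ s)) (Ioc 0 T) := 
    ⟨((along_meas hT hc γ).sub (along_meas hT hc' γ)).aestronglyMeasurable, lt_top_iff_ne_top.2 hF⟩
  have hsub : Ioc (0:ℝ) t ⊆ Ioc 0 T := Ioc_subset_Ioc_right t.2.2
  have hi' : IntegrableOn (fun s => c' s (extendPath hT γ s)) (Ioc 0 T) := by
    have := hi.sub hd
    refine this.congr (Eventually.of_forall fun s => ?_)
    simp
  have e : defect hT c t γ = defect hT c' t γ - pr (∫ s in Ioc (0:ℝ) t, (c s (extendPath hT γ s) - c' s (extendPath hT γ s))) := by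
    rw [integral_sub (hi.mono_set hsub) (hi'.mono_set hsub), pr_sub, defect, defect]; abel
  rw [e]
  refine (enorm_sub_le).trans (add_le_add le_rfl ((enorm_pr_le _).trans ?_))
  refine (enorm_integral_le_lintegral_enorm _).trans (lintegral_mono_set hsub)

lemma dst_comm (hT : 0 ≤ T) (c c' : ℝ → Torus d → Fin d → ℝ) (γ : PathSpace T d) : dst hT c c' γ = dst hT c' c γ := by
  unfold dst
  refine lintegral_congr fun s => ?_
  rw [← enorm_neg, neg_sub]

lemma lint_dst (hT : 0 ≤ T) {η : Measure (PathSpace T d)} [SFinite η] (h : Marg η) {c c' : ℝ → Torus d → Fin d → ℝ}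
    (hc : Measurable (Function.uncurry c)) (hc' : Measurable (Function.uncurry c')) :
    ∫⁻ γ, dst hT c c' γ ∂η = ∫⁻ s in Ioc 0 T, ∫⁻ x, ‖c s x - c' s x‖ₑ := by
  have m : Measurable (Function.uncurry fun s x => ‖c s x - c' s x‖ₑ) := (hc.sub hc').enorm
  exact lint_marg hT h m

lemma meas_dst (hT : 0 ≤ T) {c c' : ℝ → Torus d → Fin d → ℝ}
    (hc : Measurable (Function.uncurry c)) (hc' : Measurable (Function.uncurry c')) :
    Measurable (dst hT c c') := by
  have m1 : Measurable (Function.uncurry fun (γ : PathSpace T d) (s : ℝ) => 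
      ‖c s (extendPath hT γ s) - c' s (extendPath hT γ s)‖ₑ) := by
    have : Measurable fun q : PathSpace T d × ℝ => (q.2, extendPath hT q.1 q.2) := 
      measurable_snd.prodMk ((meas_ext hT).comp measurable_swap)
    exact ((hc.comp this).sub (hc'.comp this)).enorm
  exact m1.lintegral_prod_right'

lemma meas_defect (hT : 0 ≤ T) {c : ℝ → Torus d → Fin d → ℝ} (hc : Measurable (Function.uncurry c)) (t : Icc (0:ℝ) T) :
    Measurable (defect hT c t) := by
  have m1 : Measurable (Function.uncurry fun (γ : PathSpace T d) (s : ℝ) => c s (extendPath hT γ s)) := by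
    have : Measurable fun q : PathSpace T d × ℝ => (q.2, extendPath hT q.1 q.2) := 
      measurable_snd.prodMk ((meas_ext hT).comp measurable_swap)
    exact hc.comp this
  have m2 : StronglyMeasurable fun γ : PathSpace T d => ∫ s in Ioc (0:ℝ) t, c s (extendPath hT γ s) := 
    m1.stronglyMeasurable.integral_prod_right'
  exact ((meas_e0 t).sub (meas_e0 _)).sub (measurable_pr.comp m2.measurable)

lemma along_int (hT : 0 ≤ T) {c : ℝ → Torus d → Fin d → ℝ} (hc : Continuous (Function.uncurry c)) {R : ℝ}
    (hR : ∀ s x, ‖c s x‖ ≤ R) (γ : PathSpace T d) (a : ℝ) (a' : ℝ) :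
    IntegrableOn (fun s => c s (extendPath hT γ s)) (Ioc a a') := by
  refine Integrable.mono' (integrable_const R) (along_meas hT hc.measurable γ).aestronglyMeasurable (Eventually.of_forall fun s => hR _ _)

lemma cont_defect (hT : 0 ≤ T) {c : ℝ → Torus d → Fin d → ℝ} (hc : Continuous (Function.uncurry c)) {R : ℝ}
    (hR : ∀ s x, ‖c s x‖ ≤ R) (t : Icc (0:ℝ) T) : Continuous (defect hT c t) := by
  have e : ∀ t : Icc (0:ℝ) T, Continuous fun γ : PathSpace T d => γ t := fun t => ContinuousEvalConst.continuous_eval_const t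
  refine ((e t).sub (e _)).sub (continuous_pr.comp ?_)
  refine continuous_of_dominated (bound := fun _ => R) (fun γ => (along_meas hT hc.measurable γ).aestronglyMeasurable) 
    (fun γ => Eventually.of_forall fun s => hR _ _) (integrable_const R) (Eventually.of_forall fun s => ?_)
  have : Continuous fun γ : PathSpace T d => extendPath hT γ s := e _
  exact hc.comp (continuous_const.prodMk this)

lemma exists_cb {b : ℝ → Torus d → Fin d → ℝ} (hb : Measurable (Function.uncurry b)) 
    (hl : ∫⁻ t in Ioc 0 T, ∫⁻ x, ‖b t x‖ₑ < ∞) {δ : ℝ≥0∞} (hδ : δ ≠ 0) :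
    ∃ c : ℝ → Torus d → Fin d → ℝ, Continuous (Function.uncurry c) ∧ (∃ R, 0 ≤ R ∧ ∀ s x, ‖c s x‖ ≤ R) ∧
      ∫⁻ t in Ioc 0 T, ∫⁻ x, ‖b t x - c t x‖ₑ ≤ δ := by
  have hi : Integrable (Function.uncurry b) ((volume.restrict (Ioc 0 T)).prod (volume : Measure (Torus d))) := by
    refine ⟨hb.aestronglyMeasurable, ?_⟩
    rw [hasFiniteIntegral_iff_enorm, lintegral_prod _ hb.enorm.aemeasurable]
    exact hl
  obtain ⟨g, hg, -⟩ := hi.exists_boundedContinuous_lintegral_sub_le hδ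
  refine ⟨fun s x => g (s, x), g.continuous, ⟨‖g‖, norm_nonneg _, fun s x => g.norm_coe_le_norm _⟩, ?_⟩
  have m : Measurable fun x => ‖Function.uncurry b x - g x‖ₑ := (hb.sub g.continuous.measurable).enorm
  rw [lintegral_prod _ m.aemeasurable] at hg
  exact hg

/-- paths with a given modulus -/
def modSet (T : ℝ) (d : ℕ) (h δ : ℝ) : Set (PathSpace T d) :=
  {γ | ∀ s t : Icc (0:ℝ) T, |(t:ℝ) - s| ≤ h → ‖γ t - γ s‖ ≤ δ}

lemma isClosed_modSet (h δ : ℝ) : IsClosed (modSet T d h δ) := by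
  have e : ∀ t : Icc (0:ℝ) T, Continuous fun γ : PathSpace T d => γ t := fun t => ContinuousEvalConst.continuous_eval_const t
  have : modSet T d h δ = ⋂ s : Icc (0:ℝ) T, ⋂ t : Icc (0:ℝ) T, ⋂ _ : |(t:ℝ) - s| ≤ h, {γ | ‖γ t - γ s‖ ≤ δ} := by
    ext γ; simp only [modSet, mem_ofPred_eq, mem_iInter]
  rw [this]
  exact isClosed_iInter fun s => isClosed_iInter fun t => isClosed_iInter fun _ => 
    isClosed_le ((e t).sub (e s)).norm continuous_const

lemma modSet_anti {h h' δ : ℝ} (hh : h ≤ h') : modSet T d h' δ ⊆ modSet T d h δ := 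
  fun γ hγ s t hst => hγ s t (hst.trans hh)

lemma exists_modSet (γ : PathSpace T d) {δ : ℝ} (hδ : 0 < δ) : ∃ h > 0, γ ∈ modSet T d h δ := by
  have := CompactSpace.uniformContinuous_of_continuous γ.continuous
  obtain ⟨h, hh, H⟩ := Metric.uniformContinuous_iff.1 this δ hδ
  refine ⟨h/2, by positivity, fun s t hst => ?_⟩
  rw [← dist_eq_norm]
  refine (H ?_).le
  rw [Subtype.dist_eq, Real.dist_eq]; linarith

lemma single_mod (η : Measure (PathSpace T d)) [IsProbabilityMeasure η] {δ : ℝ} (hδ : 0 < δ) {ε : ℝ≥0∞} (hε : 0 < ε) :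
    ∃ h > 0, η (modSet T d h δ)ᶜ ≤ ε := by
  have h1 : ⋂ n : ℕ, (modSet T d (eps n) δ)ᶜ = ∅ := by
    rw [← compl_iUnion, compl_empty_iff, eq_univ_iff_forall]
    intro γ
    obtain ⟨h, hh, H⟩ := exists_modSet γ hδ
    obtain ⟨n, hn⟩ := exists_nat_one_div_lt hh
    exact mem_iUnion.2 ⟨n, modSet_anti hn.le H⟩
  have h2 := tendsto_measure_iInter_atTop (μ := η) (s := fun n : ℕ => (modSet T d (eps n) δ)ᶜ) 
    (fun n => (isClosed_modSet _ _).measurableSet.compl.nullMeasurableSet) 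
    (fun n m hnm => compl_subset_compl.2 (modSet_anti (by unfold eps; gcongr))) ⟨0, measure_ne_top _ _⟩
  rw [h1, measure_empty] at h2
  obtain ⟨n, hn⟩ := (h2.eventually (ge_mem_nhds hε)).exists
  exact ⟨eps n, eps_pos n, hn⟩

lemma finite_mod (η : ℕ → Measure (PathSpace T d)) (hη : ∀ n, IsProbabilityMeasure (η n)) {δ : ℝ} (hδ : 0 < δ) {ε : ℝ≥0∞} (hε : 0 < ε)
    (N : ℕ) : ∃ h > 0, ∀ n < N, η n (modSet T d h δ)ᶜ ≤ ε := by
  induction N with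
  | zero => exact ⟨1, one_pos, fun n hn => absurd hn (by omega)⟩
  | succ N ih =>
    obtain ⟨h, hh, H⟩ := ih
    obtain ⟨h', hh', H'⟩ := single_mod (η N) hδ hε
    refine ⟨min h h', lt_min hh hh', fun n hn => ?_⟩
    rcases Nat.lt_succ_iff_lt_or_eq.1 hn with h1 | rfl
    · exact (measure_mono (compl_subset_compl.2 (modSet_anti (min_le_left _ _)))).trans (H n h1)
    · exact (measure_mono (compl_subset_compl.2 (modSet_anti (min_le_right _ _)))).trans H'

end

noncomputable section
set_option linter.unusedSectionVars false
variable {d : ℕ} {T : ℝ}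

lemma compact_mod {h : ℕ → ℝ} (hh : ∀ k, 0 < h k) : IsCompact (⋂ k, modSet T d (h k) (eps k)) := by
  set S := ⋂ k, modSet T d (h k) (eps k) with hS
  have key : ∀ (f : Icc (0:ℝ) T → Torus d), (∀ k, ∀ s t : Icc (0:ℝ) T, |(t:ℝ) - s| ≤ h k → ‖f t - f s‖ ≤ eps k) → 
      Continuous f := by
    intro f hf
    rw [Metric.continuous_iff]
    intro t ε hε
    obtain ⟨k, hk⟩ := exists_nat_one_div_lt hε
    refine ⟨h k, hh k, fun s hs => ?_⟩
    rw [dist_eq_norm]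
    refine (hf k t s ?_).trans_lt hk
    rw [Subtype.dist_eq, Real.dist_eq] at hs; exact hs.le
  have him : Set.image ContinuousMap.toFun S = {f | ∀ k, ∀ s t : Icc (0:ℝ) T, |(t:ℝ) - s| ≤ h k → ‖f t - f s‖ ≤ eps k} := by
    ext f
    simp only [mem_image, mem_ofPred_eq]
    constructor
    · rintro ⟨γ, hγ, rfl⟩ k
      exact mem_iInter.1 hγ k
    · intro hf
      exact ⟨⟨f, key f hf⟩, mem_iInter.2 fun k => hf k, rfl⟩
  refine ArzelaAscoli.isCompact_of_equicontinuous S ?_ ?_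
  · rw [him]
    refine IsClosed.isCompact ?_
    simp only [Set.ofPred_forall]
    exact isClosed_iInter fun k => isClosed_iInter fun s => isClosed_iInter fun t => isClosed_iInter fun _ => 
      isClosed_le ((continuous_apply t).sub (continuous_apply s)).norm continuous_const
  · intro t
    rw [Metric.equicontinuousAt_iff]
    intro ε hε
    obtain ⟨k, hk⟩ := exists_nat_one_div_lt hε
    refine ⟨h k, hh k, fun s hs γ => ?_⟩
    rw [dist_comm, dist_eq_norm]
    refine ((mem_iInter.1 γ.2 k) t s ?_).trans_lt hk |>.trans_eq' ?_
    · rw [Subtype.dist_eq, Real.dist_eq] at hs; exact hs.le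
    · rw [norm_sub_rev]

lemma enorm_tri3 {E : Type*} [NormedAddCommGroup E] (u v w : E) : ‖w - u‖ₑ ≤ ‖u - v‖ₑ + ‖v - w‖ₑ := by
  have e : w - u = -((u - v) + (v - w)) := by abel
  rw [e, enorm_neg]
  exact enorm_add_le _ _

lemma lint_tri {β b c : ℝ → Torus d → Fin d → ℝ} (hβ : Measurable (Function.uncurry β)) 
    (hb : Measurable (Function.uncurry b)) :
    ∫⁻ s in Ioc 0 T, ∫⁻ x, ‖c s x - β s x‖ₑ ≤ (∫⁻ s in Ioc 0 T, ∫⁻ x, ‖β s x - b s x‖ₑ) + 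
      ∫⁻ t in Ioc 0 T, ∫⁻ x, ‖b t x - c t x‖ₑ := by
  have m0 : Measurable fun q : ℝ × Torus d => β q.1 q.2 - b q.1 q.2 := Measurable.sub (f := fun q : ℝ × Torus d => β q.1 q.2) (g := fun q : ℝ × Torus d => b q.1 q.2) hβ hb
  have m1 : Measurable fun q : ℝ × Torus d => ‖β q.1 q.2 - b q.1 q.2‖ₑ := m0.enorm
  have m2 : Measurable fun s => ∫⁻ x, ‖β s x - b s x‖ₑ := m1.lintegral_prod_right'
  have m3' : ∀ s : ℝ, Measurable fun x : Torus d => ‖β s x - b s x‖ₑ := fun s => by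
    have h1 : Measurable fun x : Torus d => β s x := hβ.comp (measurable_prodMk_left (x := s))
    have h2 : Measurable fun x : Torus d => b s x := hb.comp (measurable_prodMk_left (x := s))
    exact (h1.sub h2).enorm
  calc ∫⁻ s in Ioc 0 T, ∫⁻ x, ‖c s x - β s x‖ₑ ≤ ∫⁻ s in Ioc 0 T, ((∫⁻ x, ‖β s x - b s x‖ₑ) + ∫⁻ x, ‖b s x - c s x‖ₑ) := by
        refine lintegral_mono fun s => ?_
        have m3 : Measurable fun x => ‖β s x - b s x‖ₑ := m3' s
        calc ∫⁻ x, ‖c s x - β s x‖ₑ ≤ ∫⁻ x, (‖β s x - b s x‖ₑ + ‖b s x - c s x‖ₑ) := 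
              lintegral_mono fun x => enorm_tri3 (β s x) (b s x) (c s x)
          _ = _ := lintegral_add_left m3 _
    _ = _ := lintegral_add_left m2 _

lemma Appr.dst_le {hT : 0 ≤ T} {b β c : ℝ → Torus d → Fin d → ℝ} {ε : ℝ} {η : Measure (PathSpace T d)} 
    (h : Appr hT b ε β η) (hb : Measurable (Function.uncurry b)) (hc : Measurable (Function.uncurry c)) :
    ∫⁻ γ, dst hT c β γ ∂η ≤ ENNReal.ofReal ε + ∫⁻ t in Ioc 0 T, ∫⁻ x, ‖b t x - c t x‖ₑ := by
  have := h.prob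
  rw [lint_dst hT h.marg hc h.meas]
  exact (lint_tri h.meas hb).trans (add_le_add h.close le_rfl)

lemma mod_of_defect (hT : 0 ≤ T) {c : ℝ → Torus d → Fin d → ℝ} (hc : Continuous (Function.uncurry c)) {R : ℝ}
    (hR0 : 0 ≤ R) (hR : ∀ s x, ‖c s x‖ ≤ R) {γ : PathSpace T d} {a h : ℝ} (H : ∀ t, ‖defect hT c t γ‖ ≤ a) :
    γ ∈ modSet T d h (2 * a + R * h) := by
  have key : ∀ s t : Icc (0:ℝ) T, (s:ℝ) ≤ t → |(t:ℝ) - s| ≤ h → ‖γ t - γ s‖ ≤ 2 * a + R * h := by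
    intro s t hst hh
    have e : γ t - γ s = defect hT c t γ - defect hT c s γ + pr (∫ r in Ioc (s:ℝ) t, c r (extendPath hT γ r)) := by
      have : ∫ r in Ioc (0:ℝ) t, c r (extendPath hT γ r) = (∫ r in Ioc (0:ℝ) s, c r (extendPath hT γ r)) + 
          ∫ r in Ioc (s:ℝ) t, c r (extendPath hT γ r) := by
        rw [← Ioc_union_Ioc_eq_Ioc s.2.1 hst, setIntegral_union _ measurableSet_Ioc (along_int hT hc hR γ _ _) (along_int hT hc hR γ _ _)]
        exact Set.disjoint_left.2 fun x hx hx' => absurd hx.2 (not_le.2 hx'.1)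
      simp only [defect, this, pr_add]; abel
    rw [e]
    have h1 : ‖∫ r in Ioc (s:ℝ) t, c r (extendPath hT γ r)‖ ≤ R * h := by
      refine (norm_setIntegral_le_of_norm_le_const (C := R) (by simp) (fun r _ => hR _ _)).trans ?_
      rw [Measure.real, Real.volume_Ioc, ENNReal.toReal_ofReal (by linarith)]
      exact mul_le_mul_of_nonneg_left ((le_abs_self _).trans hh) hR0
    have h2 := norm_add_le (defect hT c t γ - defect hT c s γ) (pr (∫ r in Ioc (s:ℝ) t, c r (extendPath hT γ r)))
    have h3 := norm_sub_le (defect hT c t γ) (defect hT c s γ)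
    have h4 := norm_pr_le (∫ r in Ioc (s:ℝ) t, c r (extendPath hT γ r))
    linarith [H t, H s]
  intro s t hh
  rcases le_total (s:ℝ) t with h1 | h1
  · exact key s t h1 hh
  · rw [norm_sub_rev]; exact key t s h1 (by rwa [abs_sub_comm])

lemma tight_aux (hT : 0 ≤ T) {b : ℝ → Torus d → Fin d → ℝ} (hb : Measurable (Function.uncurry b)) 
    (hl : ∫⁻ t in Ioc 0 T, ∫⁻ x, ‖b t x‖ₑ < ∞) {β : ℕ → ℝ → Torus d → Fin d → ℝ} {ε : ℕ → ℝ} (hε : Tendsto ε atTop (𝓝 0))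
    {η : ℕ → Measure (PathSpace T d)} (h : ∀ n, Appr hT b (ε n) (β n) (η n)) {δ : ℝ} (hδ : 0 < δ) {κ : ℝ} (hκ : 0 < κ) :
    ∃ r > 0, ∀ n, η n (modSet T d r δ)ᶜ ≤ ENNReal.ofReal κ := by
  obtain ⟨c, hc, ⟨R, hR0, hR⟩, hcb⟩ := exists_cb hb hl (δ := ENNReal.ofReal (δ * κ / 16)) (by simp only [ne_eq, ENNReal.ofReal_eq_zero, not_le]; positivity)
  obtain ⟨N, hN⟩ := eventually_atTop.1 (hε.eventually (ge_mem_nhds (show (0:ℝ) < min (δ/8) (δ * κ / 16) by positivity)))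
  obtain ⟨r, hr, H⟩ := finite_mod η (fun n => (h n).prob) hδ (show (0:ℝ≥0∞) < ENNReal.ofReal κ by simpa using hκ) N
  set r' := min r (δ / (4 * (R + 1))) with hr'
  refine ⟨r', lt_min hr (by positivity), fun n => ?_⟩
  rcases lt_or_ge n N with hn | hn
  · exact (measure_mono (compl_subset_compl.2 (modSet_anti (min_le_left _ _)))).trans (H n hn)
  have hεn := le_min_iff.1 (hN n hn)
  have hRr : R * r' ≤ δ / 4 := by
    have : r' ≤ δ / (4 * (R + 1)) := min_le_right _ _
    have h2 : R * r' ≤ R * (δ / (4 * (R + 1))) := mul_le_mul_of_nonneg_left this hR0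
    refine h2.trans ?_
    rw [mul_div_assoc', div_le_div_iff₀ (by positivity) (by norm_num)]
    nlinarith
  have h1 : η n (modSet T d r' δ)ᶜ ≤ η n {γ | ENNReal.ofReal (δ/8) ≤ dst hT c (β n) γ} := by
    refine measure_mono_ae ?_
    filter_upwards [(h n).curve] with γ hγ hγ'
    by_contra hcon
    refine hγ' ?_
    have hcon' : dst hT c (β n) γ ≤ ENNReal.ofReal (δ/8) := (not_le.1 hcon).le
    have : ∀ t, ‖defect hT c t γ‖ ≤ δ / 4 := fun t => by
      have h2 := defect_le hT hc.measurable (h n).meas γ (along_int hT hc hR γ _ _) t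
      have h3 : ‖defect hT c t γ‖ₑ ≤ ENNReal.ofReal (δ / 4) := by
        refine h2.trans ((add_le_add ((hγ t).trans (ENNReal.ofReal_le_ofReal hεn.1)) hcon').trans ?_)
        rw [← ENNReal.ofReal_add (by positivity) (by positivity)]
        exact ENNReal.ofReal_le_ofReal (by linarith)
      rw [← ofReal_norm, ENNReal.ofReal_le_ofReal_iff (by positivity)] at h3
      exact h3
    have h5 := mod_of_defect (h := r') hT hc hR0 hR this
    intro s t hst
    refine (h5 s t hst).trans (by linarith)
  refine h1.trans ?_
  have h2 := mul_meas_ge_le_lintegral (μ := η n) (meas_dst hT hc.measurable (h n).meas) (ENNReal.ofReal (δ/8))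
  have h3 : ENNReal.ofReal (δ/8) * η n {γ | ENNReal.ofReal (δ/8) ≤ dst hT c (β n) γ} ≤ ENNReal.ofReal (δ/8) * ENNReal.ofReal κ := by
    refine h2.trans (((h n).dst_le hb hc.measurable).trans ((add_le_add (ENNReal.ofReal_le_ofReal hεn.2) hcb).trans ?_))
    rw [← ENNReal.ofReal_add (by positivity) (by positivity), ← ENNReal.ofReal_mul (by positivity)]
    exact ENNReal.ofReal_le_ofReal (by linarith)
  exact (ENNReal.mul_le_mul_iff_right (by simpa using hδ) (by simp)).1 h3

lemma tight_seq (hT : 0 ≤ T) {b : ℝ → Torus d → Fin d → ℝ} (hb : Measurable (Function.uncurry b)) 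
    (hl : ∫⁻ t in Ioc 0 T, ∫⁻ x, ‖b t x‖ₑ < ∞) {β : ℕ → ℝ → Torus d → Fin d → ℝ} {ε : ℕ → ℝ} (hε : Tendsto ε atTop (𝓝 0))
    {η : ℕ → Measure (PathSpace T d)} (h : ∀ n, Appr hT b (ε n) (β n) (η n)) : IsTightMeasureSet (range η) := by
  rw [isTightMeasureSet_iff_exists_isCompact_measure_compl_le]
  intro κ hκ
  obtain ⟨κ', hκ', hs⟩ := ENNReal.exists_pos_sum_of_countable hκ.ne' ℕ
  have := fun k => tight_aux hT hb hl hε h (eps_pos k) (show (0:ℝ) < (κ' k : ℝ) from hκ' k)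
  choose r hr H using this
  refine ⟨_, compact_mod hr, ?_⟩
  rintro _ ⟨n, rfl⟩
  rw [compl_iInter]
  refine (measure_iUnion_le _).trans ((ENNReal.tsum_le_tsum fun k => H k n).trans ?_)
  simp only [ENNReal.ofReal_coe_nnreal]
  exact hs.le

lemma exists_limit (hT : 0 ≤ T) {b : ℝ → Torus d → Fin d → ℝ} (hb : Measurable (Function.uncurry b)) 
    (hl : ∫⁻ t in Ioc 0 T, ∫⁻ x, ‖b t x‖ₑ < ∞) {β : ℕ → ℝ → Torus d → Fin d → ℝ} {ε : ℕ → ℝ} (hε : Tendsto ε atTop (𝓝 0))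
    {η : ℕ → Measure (PathSpace T d)} (h : ∀ n, Appr hT b (ε n) (β n) (η n)) : 
    ∃ (ν : ℕ → ProbabilityMeasure (PathSpace T d)) (μ : ProbabilityMeasure (PathSpace T d)), 
      (∀ n, (ν n : Measure (PathSpace T d)) = η n) ∧ Tendsto ν (hyperfilter ℕ : Filter ℕ) (𝓝 μ) := by
  let ν : ℕ → ProbabilityMeasure (PathSpace T d) := fun n => ⟨η n, (h n).prob⟩
  have hν : ∀ n, (ν n : Measure (PathSpace T d)) = η n := fun n => rfl
  have h1 : IsTightMeasureSet {((μ : ProbabilityMeasure (PathSpace T d)) : Measure (PathSpace T d)) | μ ∈ range ν} := by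
    convert tight_seq hT hb hl hε h using 1
    ext μ
    constructor
    · rintro ⟨_, ⟨n, rfl⟩, rfl⟩
      exact ⟨n, rfl⟩
    · rintro ⟨n, rfl⟩
      exact ⟨_, ⟨n, rfl⟩, rfl⟩
  have h2 := isCompact_closure_of_isTightMeasureSet h1
  obtain ⟨μ, -, hμ⟩ := h2.ultrafilter_le_nhds ((hyperfilter ℕ).map ν) 
    (le_principal_iff.2 (mem_map.2 (univ_mem' fun n => subset_closure ⟨n, rfl⟩)))
  exact ⟨ν, μ, hν, hμ⟩

lemma limit_le {η : ℕ → ProbabilityMeasure (PathSpace T d)} {μ : ProbabilityMeasure (PathSpace T d)} {l : Filter ℕ} [l.NeBot]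
    (hlim : Tendsto η l (𝓝 μ)) {G : PathSpace T d → Torus d} (hG : Continuous G) {a : ℕ → ℝ≥0∞} {A : ℝ≥0∞}
    (ha : Tendsto a l (𝓝 A)) (H : ∀ n, ∫⁻ γ, ‖G γ‖ₑ ∂(η n : Measure (PathSpace T d)) ≤ a n) :
    ∫⁻ γ, ‖G γ‖ₑ ∂(μ : Measure (PathSpace T d)) ≤ A := by
  obtain ⟨C, hC⟩ := (isCompact_univ (X := Torus d)).exists_bound_of_continuousOn (f := fun x => x) continuous_id.continuousOn
  let f : BoundedContinuousFunction (PathSpace T d) NNReal := BoundedContinuousFunction.mkOfBound ⟨fun γ => ‖G γ‖₊, hG.nnnorm⟩ (2 * C) 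
    (fun x y => by
      rw [NNReal.dist_eq]
      have h1 := hC (G x) trivial
      have h2 := hC (G y) trivial
      simp only [ContinuousMap.coe_mk, coe_nnnorm]
      rw [abs_le]; constructor <;> linarith [norm_nonneg (G x), norm_nonneg (G y)])
  have h1 := (ProbabilityMeasure.tendsto_iff_forall_lintegral_tendsto.1 hlim) f
  exact le_of_tendsto_of_tendsto' h1 ha H

end

noncomputable section
set_option linter.unusedSectionVars false
variable {d : ℕ} {T : ℝ}

lemma limit_marg {η : ℕ → ProbabilityMeasure (PathSpace T d)} {μ : ProbabilityMeasure (PathSpace T d)} {l : Filter ℕ} [l.NeBot]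
    (hlim : Tendsto η l (𝓝 μ)) (H : ∀ n, Marg (η n : Measure (PathSpace T d))) : Marg (μ : Measure (PathSpace T d)) := by
  intro t
  have : IsProbabilityMeasure (Measure.map (fun γ : PathSpace T d => γ t) (μ : Measure (PathSpace T d))) := 
    Measure.isProbabilityMeasure_map (meas_e0 t).aemeasurable
  refine ext_of_forall_lintegral_eq_of_IsFiniteMeasure fun f => ?_
  have e : Continuous fun γ : PathSpace T d => γ t := ContinuousEvalConst.continuous_eval_const t
  have h1 := (ProbabilityMeasure.tendsto_iff_forall_lintegral_tendsto.1 hlim) (f.compContinuous ⟨_, e⟩)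
  have mf : Measurable fun x => (f x : ℝ≥0∞) := (ENNReal.continuous_coe.comp f.continuous).measurable
  have key : ∀ ν : Measure (PathSpace T d), ∫⁻ x, (f.compContinuous ⟨_, e⟩ x : ℝ≥0∞) ∂ν = 
      ∫⁻ x, f x ∂(Measure.map (fun γ : PathSpace T d => γ t) ν) := fun ν => by
    rw [lintegral_map mf (meas_e0 t)]; rfl
  simp only [key] at h1
  have h2 : ∀ n, Measure.map (fun γ : PathSpace T d => γ t) (η n : Measure (PathSpace T d)) = volume := fun n => H n t
  simp only [h2] at h1
  exact (tendsto_const_nhds_iff.1 h1).symm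

lemma exists_good (hT : 0 ≤ T) {b : ℝ → Torus d → Fin d → ℝ} (hb : Measurable (Function.uncurry b)) 
    (hl : ∫⁻ t in Ioc 0 T, ∫⁻ x, ‖b t x‖ₑ < ∞) 
    (H : ∀ ε > 0, ∃ β η, Appr hT b ε β η) : ∃ μ : Measure (PathSpace T d), IsProbabilityMeasure μ ∧ Marg μ ∧ 
      ∀ᵐ γ ∂μ, IntegrableOn (fun s => b s (extendPath hT γ s)) (Ioc 0 T) ∧ ∀ t, defect hT b t γ = 0 := by
  have := fun n => H (eps n) (eps_pos n)
  choose β η h using this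
  have hε : Tendsto eps atTop (𝓝 0) := tendsto_one_div_add_atTop_nhds_zero_nat
  obtain ⟨ν, μ, hν, hlim⟩ := exists_limit hT hb hl hε h
  have hεl : Tendsto eps (hyperfilter ℕ : Filter ℕ) (𝓝 0) := 
    hε.mono_left (by rw [← Nat.cofinite_eq_atTop]; exact hyperfilter_le_cofinite)
  have hm : Marg (μ : Measure (PathSpace T d)) := limit_marg hlim fun n => by rw [hν]; exact (h n).marg
  have hintg : ∀ᵐ γ ∂(μ : Measure (PathSpace T d)), IntegrableOn (fun s => b s (extendPath hT γ s)) (Ioc 0 T) := by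
    have m0 : Measurable (Function.uncurry fun (s : ℝ) (x : Torus d) => (0 : Fin d → ℝ)) := measurable_const
    have h1 := lint_dst hT hm hb m0
    have h2 := ae_lt_top (meas_dst hT hb m0) (by rw [h1]; simpa using hl.ne)
    filter_upwards [h2] with γ hγ
    refine ⟨(along_meas hT hb γ).aestronglyMeasurable, ?_⟩
    rw [hasFiniteIntegral_iff_enorm]
    simpa [dst] using hγ
  have hzero : ∀ t, ∀ᵐ γ ∂(μ : Measure (PathSpace T d)), defect hT b t γ = 0 := by
    intro t
    have h0 : ∫⁻ γ, ‖defect hT b t γ‖ₑ ∂(μ : Measure (PathSpace T d)) = 0 := by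
      refine le_antisymm (ENNReal.le_of_forall_pos_le_add fun δ hδ _ => ?_) (zero_le)
      have hδ2 : ENNReal.ofReal (δ/2) ≠ 0 := by simp only [ne_eq, ENNReal.ofReal_eq_zero, not_le]; positivity
      obtain ⟨c, hc, ⟨R, hR0, hR⟩, hcb⟩ := exists_cb hb hl hδ2
      have h1 : ∫⁻ γ, ‖defect hT c t γ‖ₑ ∂(μ : Measure (PathSpace T d)) ≤ 0 + 0 + ENNReal.ofReal (δ/2) := by
        have he : Tendsto (fun n => ENNReal.ofReal (eps n)) (hyperfilter ℕ : Filter ℕ) (𝓝 0) := by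
          have h5 := (ENNReal.continuous_ofReal.tendsto 0).comp hεl
          rw [ENNReal.ofReal_zero] at h5
          exact h5
        refine limit_le hlim (cont_defect hT hc hR t) (a := fun n => ENNReal.ofReal (eps n) + ENNReal.ofReal (eps n) + ENNReal.ofReal (δ/2))
          ((he.add he).add tendsto_const_nhds) fun n => ?_
        rw [hν]
        have := (h n).prob
        calc ∫⁻ γ, ‖defect hT c t γ‖ₑ ∂(η n) ≤ ∫⁻ γ, (ENNReal.ofReal (eps n) + dst hT c (β n) γ) ∂(η n) := by
              refine lintegral_mono_ae ?_
              filter_upwards [(h n).curve] with γ hγ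
              exact (defect_le hT hc.measurable (h n).meas γ (along_int hT hc hR γ _ _) t).trans (add_le_add (hγ t) le_rfl)
          _ = ENNReal.ofReal (eps n) + ∫⁻ γ, dst hT c (β n) γ ∂(η n) := by
              rw [lintegral_add_left measurable_const, lintegral_const, measure_univ, mul_one]
          _ ≤ ENNReal.ofReal (eps n) + (ENNReal.ofReal (eps n) + ENNReal.ofReal (δ/2)) := 
              add_le_add le_rfl (((h n).dst_le hb hc.measurable).trans (add_le_add le_rfl hcb))
          _ = _ := by rw [add_assoc]
      calc ∫⁻ γ, ‖defect hT b t γ‖ₑ ∂(μ : Measure (PathSpace T d)) 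
          ≤ ∫⁻ γ, (‖defect hT c t γ‖ₑ + dst hT b c γ) ∂(μ : Measure (PathSpace T d)) := by
            refine lintegral_mono_ae ?_
            filter_upwards [hintg] with γ hγ
            exact defect_le hT hb hc.measurable γ hγ t
        _ = (∫⁻ γ, ‖defect hT c t γ‖ₑ ∂(μ : Measure (PathSpace T d))) + ∫⁻ γ, dst hT b c γ ∂(μ : Measure (PathSpace T d)) :=
            lintegral_add_left (meas_defect hT hc.measurable t).enorm _
        _ ≤ ENNReal.ofReal (δ/2) + ENNReal.ofReal (δ/2) := by
            rw [zero_add, zero_add] at h1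
            refine add_le_add h1 ?_
            rw [lint_dst hT hm hb hc.measurable]; exact hcb
        _ = 0 + δ := by
            rw [← ENNReal.ofReal_add (by positivity) (by positivity), add_halves, zero_add, ENNReal.ofReal_coe_nnreal]
    have h2 := (lintegral_eq_zero_iff (meas_defect hT hb t).enorm).1 h0
    filter_upwards [h2] with γ hγ
    simpa using hγ
  refine ⟨μ, inferInstance, hm, ?_⟩
  obtain ⟨D, hDc, hDd⟩ := TopologicalSpace.exists_countable_dense (Icc (0:ℝ) T)
  have hD : ∀ᵐ γ ∂(μ : Measure (PathSpace T d)), ∀ t ∈ D, defect hT b t γ = 0 := (ae_ball_iff hDc).2 fun t _ => hzero t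
  filter_upwards [hintg, hD] with γ hγ hγD
  refine ⟨hγ, ?_⟩
  have hcont : Continuous fun t => defect hT b t γ := by
    unfold defect
    refine (γ.continuous.sub continuous_const).sub (continuous_pr.comp ?_)
    have h1 : ContinuousOn (fun t : ℝ => ∫ s in Ioc (0:ℝ) t, b s (extendPath hT γ s)) (Icc 0 T) :=
      intervalIntegral.continuousOn_primitive (by rwa [integrableOn_Icc_iff_integrableOn_Ioc])
    exact continuousOn_iff_continuous_domRestrict.1 h1
  have := Continuous.ext_on hDd hcont (continuous_const (y := (0 : Torus d))) hγD
  exact fun t => congrFun this t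

lemma exists_valid (hT : 0 < T) {b : ℝ → Torus d → Vec d} (hb : Measurable (Function.uncurry b))
    (hbL1 : ∫⁻ t in Set.Ioo 0 T, ∫⁻ x, (‖b t x‖₊ : ℝ≥0∞) ∂(volume : Measure (Torus d)) < ∞) 
    (H : ∀ ε > 0, ∃ β η, Appr hT.le (bet b) ε β η) : ∃ η, Valid hT b η := by
  obtain ⟨μ, h1, h2, h3⟩ := exists_good hT.le (meas_bet hb) (l1_bet hbL1) H
  refine ⟨μ, h1, ?_, h2⟩
  filter_upwards [h3] with γ hγ
  refine ⟨?_, fun t => ?_⟩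
  · exact ((PiLp.continuousLinearEquiv 2 ℝ (fun _ : Fin d => ℝ)).symm : (Fin d → ℝ) →L[ℝ] Vec d).integrable_comp hγ.1
  · have := hγ.2 t
    rw [projT_eq, ofLp_integral]
    rw [defect, sub_sub, sub_eq_zero] at this
    exact this

end

noncomputable section
set_option linter.unusedSectionVars false
variable {d : ℕ} {T : ℝ}

/-- shears preserve the measure -/
lemma mp_shear {c : Torus d → ℝ} (hc : Measurable c) {a : Fin d → ℝ} (hinv : ∀ (r : ℝ) x, c (x + pr (r • a)) = c x) :
    MeasurePreserving (fun x : Torus d => x + pr (c x • a)) volume volume := by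
  have mS : Measurable fun x : Torus d => x + pr (c x • a) := 
    measurable_id.add (measurable_pr.comp (hc.smul_const a))
  refine ⟨mS, Measure.ext_of_lintegral _ fun f hf => ?_⟩
  rw [lintegral_map hf mS]
  set w : ℝ → ℝ≥0∞ := (Icc (0:ℝ) 1).indicator 1 with hw
  have mw : Measurable w := measurable_one.indicator measurableSet_Icc
  have iw : ∫⁻ s, w s = 1 := by rw [hw, lintegral_indicator_one measurableSet_Icc]; simp
  have mpr : Measurable fun q : ℝ × Torus d => q.2 + pr (q.1 • a) := 
    measurable_snd.add (measurable_pr.comp (measurable_fst.smul_const a))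
  have mprs : Measurable fun q : Torus d × ℝ => q.1 + pr (q.2 • a) := mpr.comp measurable_swap
  have mc : Measurable fun q : Torus d × ℝ => c q.1 := hc.comp measurable_fst
  have step1 : ∀ s : ℝ, ∫⁻ x, f (x + pr (c x • a)) = ∫⁻ x, f (x + pr ((s + c x) • a)) := by
    intro s
    rw [← lintegral_add_right_eq_self (fun x => f (x + pr (c x • a))) (pr (s • a))]
    refine lintegral_congr fun x => ?_
    rw [hinv, add_smul, pr_add, add_assoc]
  have m2 : Measurable fun q : Torus d × ℝ => f (q.1 + pr (q.2 • a)) * w (q.2 - c q.1) := 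
    (hf.comp mprs).mul (mw.comp (measurable_snd.sub mc))
  have m2' : Measurable fun q : ℝ × Torus d => f (q.2 + pr (q.1 • a)) * w (q.1 - c q.2) := m2.comp measurable_swap
  have m1 : Measurable fun q : ℝ × Torus d => f (q.2 + pr ((q.1 + c q.2) • a)) * w q.1 := by
    have : Measurable fun q : ℝ × Torus d => (q.2, q.1 + c q.2) := measurable_snd.prodMk (measurable_fst.add (hc.comp measurable_snd))
    exact (hf.comp (mprs.comp this)).mul (mw.comp measurable_fst)
  calc ∫⁻ x, f (x + pr (c x • a)) = ∫⁻ s, (∫⁻ x, f (x + pr (c x • a))) * w s := by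
        rw [lintegral_const_mul _ mw, iw, mul_one]
    _ = ∫⁻ s, ∫⁻ x, f (x + pr ((s + c x) • a)) * w s := by
        refine lintegral_congr fun s => ?_
        rw [step1 s]
        have : Measurable fun x => f (x + pr ((s + c x) • a)) := 
          hf.comp (mpr.comp ((hc.const_add s).prodMk measurable_id))
        rw [lintegral_mul_const _ this]
    _ = ∫⁻ x, ∫⁻ s, f (x + pr ((s + c x) • a)) * w s := lintegral_lintegral_swap m1.aemeasurable
    _ = ∫⁻ x, ∫⁻ r, f (x + pr (r • a)) * w (r - c x) := by
        refine lintegral_congr fun x => ?_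
        rw [← lintegral_add_right_eq_self (fun r => f (x + pr (r • a)) * w (r - c x)) (c x)]
        refine lintegral_congr fun r => ?_
        rw [add_sub_cancel_right]
    _ = ∫⁻ r, ∫⁻ x, f (x + pr (r • a)) * w (r - c x) := lintegral_lintegral_swap m2.aemeasurable
    _ = ∫⁻ r, ∫⁻ x, f x * w (r - c x) := by
        refine lintegral_congr fun r => ?_
        rw [← lintegral_add_right_eq_self (fun x => f x * w (r - c x)) (pr (r • a))]
        refine lintegral_congr fun x => ?_
        rw [hinv]
    _ = ∫⁻ x, ∫⁻ r, f x * w (r - c x) := by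
        have : Measurable fun q : ℝ × Torus d => f q.2 * w (q.1 - c q.2) := 
          (hf.comp measurable_snd).mul (mw.comp (measurable_fst.sub (hc.comp measurable_snd)))
        exact lintegral_lintegral_swap this.aemeasurable
    _ = ∫⁻ x, f x := by
        refine lintegral_congr fun x => ?_
        have : Measurable fun r => w (r - c x) := mw.comp (measurable_id.sub_const _)
        rw [lintegral_const_mul _ this, lintegral_sub_right_eq_self (fun r => w r) (c x), iw, mul_one]

/-- a shear mode -/
structure Mode (T L : ℝ) (c : Torus d → ℝ) (A : ℝ → Fin d → ℝ) : Prop where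
  meas : Measurable A
  int : IntegrableOn A (Ioc 0 T)
  bd : ∀ x, |c x| ≤ 1
  lip : ∀ x y, |c x - c y| ≤ L * ‖x - y‖
  inv : ∃ k : (Fin d → ℝ) →L[ℝ] ℝ, (∀ᵐ t ∂volume.restrict (Ioc 0 T), k (A t) = 0) ∧ ∀ a x, k a = 0 → c (x + pr a) = c x

lemma Mode.cont {L : ℝ} {c : Torus d → ℝ} {A : ℝ → Fin d → ℝ} (h : Mode T L c A) : Continuous c := by
  have hL : 0 ≤ max L 0 := le_max_right _ _
  refine (LipschitzWith.of_dist_le_mul (K := ⟨max L 0, hL⟩) fun x y => ?_).continuous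
  rw [Real.dist_eq, dist_eq_norm]
  exact (h.lip x y).trans (mul_le_mul_of_nonneg_right (le_max_left _ _) (norm_nonneg _))

/-- the truncated primitive -/
def prim (A : ℝ → Fin d → ℝ) (p q t : ℝ) : Fin d → ℝ := ∫ s in Ioc p (min t q), A s

lemma Mode.cont_prim {L : ℝ} {c : Torus d → ℝ} {A : ℝ → Fin d → ℝ} (h : Mode T L c A) {p q : ℝ} (hp : 0 ≤ p) (hpq : p ≤ q) (hq : q ≤ T) :
    Continuous (prim A p q) := by
  have h1 : ContinuousOn (fun t : ℝ => ∫ s in Ioc p t, A s) (Icc p q) :=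
    intervalIntegral.continuousOn_primitive (by 
      rw [integrableOn_Icc_iff_integrableOn_Ioc]; exact h.int.mono_set (Ioc_subset_Ioc hp hq))
  have h2 : prim A p q = fun t => ∫ s in Ioc p (max p (min t q)), A s := by
    funext t
    unfold prim
    rcases le_total p (min t q) with h3 | h3
    · rw [max_eq_right h3]
    · rw [max_eq_left h3, Ioc_self, Ioc_eq_empty (not_lt.2 h3)]
  rw [h2]
  exact h1.comp_continuous (by fun_prop) fun t => ⟨le_max_left _ _, max_le hpq (min_le_right _ _)⟩

lemma Mode.prim_le {L : ℝ} {c : Torus d → ℝ} {A : ℝ → Fin d → ℝ} (h : Mode T L c A) {p q : ℝ} (hp : 0 ≤ p) (hq : q ≤ T) (t : ℝ) :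
    ‖prim A p q t‖ ≤ ∫ s in Ioc p q, ‖A s‖ := by
  refine (norm_integral_le_integral_norm _).trans ?_
  exact setIntegral_mono_set (h.int.mono_set (Ioc_subset_Ioc hp hq)).norm (Eventually.of_forall fun s => norm_nonneg _) 
    (Eventually.of_forall fun s hs => ⟨hs.1, hs.2.trans (min_le_right _ _)⟩)

lemma prim_left {A : ℝ → Fin d → ℝ} {p q t : ℝ} (h : t ≤ p) : prim A p q t = 0 := by
  rw [prim, Ioc_eq_empty (not_lt.2 ((min_le_left _ _).trans h))]; simp

lemma prim_right {A : ℝ → Fin d → ℝ} {p q t : ℝ} (h : q ≤ t) : prim A p q t = prim A p q q := by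
  rw [prim, prim, min_eq_right h, min_self]

lemma Mode.inv_prim {L : ℝ} {c : Torus d → ℝ} {A : ℝ → Fin d → ℝ} (h : Mode T L c A) {p q : ℝ} (hp : 0 ≤ p) (hq : q ≤ T) (t r : ℝ) (x : Torus d) :
    c (x + pr (r • prim A p q t)) = c x := by
  obtain ⟨k, hk, hkc⟩ := h.inv
  refine hkc _ _ ?_
  have hs : Ioc p (min t q) ⊆ Ioc 0 T := Ioc_subset_Ioc hp ((min_le_right _ _).trans hq)
  rw [map_smul, prim, ← ContinuousLinearMap.integral_comp_comm _ (h.int.mono_set hs), 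
    integral_eq_zero_of_ae (ae_mono (Measure.restrict_mono hs le_rfl) hk), smul_zero]

lemma block {L : ℝ} (hL : 0 ≤ L) {c : ℕ → Torus d → ℝ} {A : ℕ → ℝ → Fin d → ℝ} {p q : ℝ} (hp : 0 ≤ p) (hpq : p ≤ q) (hq : q ≤ T) (N : ℕ)
    (h : ∀ i < N, Mode T L (c i) (A i)) :
    ∃ g : ℝ → Torus d → Fin d → ℝ, Continuous (Function.uncurry g) ∧ 
      (∀ t, MeasurePreserving (fun x : Torus d => x + pr (g t x)) volume volume) ∧
      (∀ t ≤ p, ∀ x, g t x = 0) ∧ (∀ t, q ≤ t → ∀ x, g t x = g q x) ∧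
      (∀ t x, ‖g t x‖ ≤ ∑ i ∈ Finset.range N, ∫ s in Ioc p q, ‖A i s‖) ∧
      (∀ t x, ‖g t x - ∑ i ∈ Finset.range N, c i x • prim (A i) p q t‖ ≤ L * (∑ i ∈ Finset.range N, ∫ s in Ioc p q, ‖A i s‖)^2) := by
  induction N with
  | zero =>
    refine ⟨fun _ _ => 0, continuous_const, fun t => ?_, fun _ _ _ => rfl, fun _ _ _ => rfl, fun t x => by simp, fun t x => by simp⟩
    simp only [pr_zero, add_zero]
    exact MeasurePreserving.id _
  | succ N ih =>
    obtain ⟨g, h1, h2, h3, h4, h5, h6⟩ := ih fun i hi => h i (by omega)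
    have hN := h N (by omega)
    have hcp := hN.cont_prim hp hpq hq
    set α := ∑ i ∈ Finset.range N, ∫ s in Ioc p q, ‖A i s‖ with hα
    set a := ∫ s in Ioc p q, ‖A N s‖ with ha
    have ha0 : 0 ≤ a := integral_nonneg fun s => norm_nonneg _
    have hα0 : 0 ≤ α := Finset.sum_nonneg fun i _ => integral_nonneg fun s => norm_nonneg _
    refine ⟨fun t x => g t x + c N (x + pr (g t x)) • prim (A N) p q t, ?_, fun t => ?_, fun t ht x => ?_, fun t ht x => ?_, fun t x => ?_, fun t x => ?_⟩
    · refine h1.add (Continuous.smul (hN.cont.comp (continuous_snd.add (continuous_pr.comp h1))) (hcp.comp continuous_fst))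
    · have e1 := (mp_shear hN.cont.measurable (hN.inv_prim hp hq t)).comp (h2 t)
      convert e1 using 1
      funext x
      simp only [Function.comp, pr_add, add_assoc]
    · simp [h3 t ht, prim_left ht]
    · simp only []
      rw [h4 t ht, prim_right ht]
    · rw [Finset.sum_range_succ]
      refine (norm_add_le _ _).trans (add_le_add (h5 t x) ?_)
      rw [norm_smul]
      have e1 := hN.prim_le hp hq t
      have e2 : ‖c N (x + pr (g t x))‖ ≤ 1 := hN.bd _
      exact (mul_le_of_le_one_left (norm_nonneg _) e2).trans e1
    · rw [Finset.sum_range_succ, Finset.sum_range_succ]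
      have e0 : g t x + c N (x + pr (g t x)) • prim (A N) p q t - (∑ i ∈ Finset.range N, c i x • prim (A i) p q t + c N x • prim (A N) p q t) = 
        (g t x - ∑ i ∈ Finset.range N, c i x • prim (A i) p q t) + (c N (x + pr (g t x)) - c N x) • prim (A N) p q t := by
        rw [sub_smul]; abel
      rw [e0]
      refine (norm_add_le _ _).trans ?_
      rw [norm_smul]
      have e1 := hN.prim_le hp hq t
      have e2 : ‖c N (x + pr (g t x)) - c N x‖ ≤ L * α := by
        refine (hN.lip _ _).trans (mul_le_mul_of_nonneg_left ?_ hL)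
        rw [add_sub_cancel_left]
        exact (norm_pr_le _).trans (h5 t x)
      have e3 : ‖c N (x + pr (g t x)) - c N x‖ * ‖prim (A N) p q t‖ ≤ L * α * a := 
        mul_le_mul e2 e1 (norm_nonneg _) (by positivity)
      have e4 := h6 t x
      have e5 : L * α ^ 2 + L * α * a ≤ L * (α + a)^2 := by nlinarith [mul_nonneg hL (mul_nonneg hα0 ha0), mul_nonneg hL (mul_nonneg ha0 ha0)]
      linarith

end

noncomputable section
set_option linter.unusedSectionVars false
variable {d : ℕ} {T : ℝ}

/-- sum of modes -/
def Usum (c : ℕ → Torus d → ℝ) (A : ℕ → ℝ → Fin d → ℝ) (N : ℕ) (s : ℝ) (x : Torus d) : Fin d → ℝ :=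
  ∑ i ∈ Finset.range N, c i x • A i s

lemma Mode.int_along {L : ℝ} {c : Torus d → ℝ} {A : ℝ → Fin d → ℝ} (h : Mode T L c A) {W : ℝ → Torus d} (hW : Continuous W) :
    IntegrableOn (fun s => c (W s) • A s) (Ioc 0 T) := by
  refine Integrable.mono' h.int.norm ((h.cont.comp hW).measurable.smul h.meas).aestronglyMeasurable (Eventually.of_forall fun s => ?_)
  rw [norm_smul]
  exact mul_le_of_le_one_left (norm_nonneg _) (h.bd _)

lemma U_int {L : ℝ} {c : ℕ → Torus d → ℝ} {A : ℕ → ℝ → Fin d → ℝ} {N : ℕ}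
    (h : ∀ i < N, Mode T L (c i) (A i)) {W : ℝ → Torus d} (hW : Continuous W) : 
    IntegrableOn (fun s => Usum c A N s (W s)) (Ioc 0 T) := 
  integrable_finsetSum _ fun i hi => (h i (Finset.mem_range.1 hi)).int_along hW

lemma block' {L : ℝ} (hL : 0 ≤ L) {c : ℕ → Torus d → ℝ} {A : ℕ → ℝ → Fin d → ℝ} {p q : ℝ} (hp : 0 ≤ p) (hpq : p ≤ q) (hq : q ≤ T) (N : ℕ)
    (h : ∀ i < N, Mode T L (c i) (A i)) :
    ∃ g : ℝ → Torus d → Fin d → ℝ, Continuous (Function.uncurry g) ∧ 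
      (∀ t, MeasurePreserving (fun x : Torus d => x + pr (g t x)) volume volume) ∧
      (∀ t ≤ p, ∀ x, g t x = 0) ∧ (∀ t, q ≤ t → ∀ x, g t x = g q x) ∧
      (∀ t ≤ q, ∀ x, ‖g t x - ∫ s in Ioc p t, Usum c A N s (x + pr (g s x))‖ ≤ 2 * L * (∑ i ∈ Finset.range N, ∫ s in Ioc p q, ‖A i s‖)^2) := by
  obtain ⟨g, h1, h2, h3, h4, h5, h6⟩ := block hL hp hpq hq N h
  refine ⟨g, h1, h2, h3, h4, fun t ht x => ?_⟩
  set α := ∑ i ∈ Finset.range N, ∫ s in Ioc p q, ‖A i s‖ with hα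
  have hα0 : 0 ≤ α := Finset.sum_nonneg fun i _ => integral_nonneg fun s => norm_nonneg _
  have hW : Continuous fun s => x + pr (g s x) := 
    continuous_const.add (continuous_pr.comp (h1.comp (continuous_id.prodMk continuous_const)))
  have hsub : Ioc p t ⊆ Ioc 0 T := Ioc_subset_Ioc hp (ht.trans hq)
  have hi1 : ∀ i ∈ Finset.range N, IntegrableOn (fun s => c i (x + pr (g s x)) • A i s) (Ioc p t) := fun i hi => 
    ((h i (Finset.mem_range.1 hi)).int_along hW).mono_set hsub
  have e1 : (∫ s in Ioc p t, Usum c A N s (x + pr (g s x))) = ∑ i ∈ Finset.range N, ∫ s in Ioc p t, c i (x + pr (g s x)) • A i s := by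
    unfold Usum
    exact integral_finsetSum _ hi1
  have e2 : ∀ i ∈ Finset.range N, c i x • prim (A i) p q t = ∫ s in Ioc p t, c i x • A i s := fun i hi => by
    rw [integral_smul, prim, min_eq_left ht]
  have e3 : ‖(∑ i ∈ Finset.range N, c i x • prim (A i) p q t) - ∫ s in Ioc p t, Usum c A N s (x + pr (g s x))‖ ≤ L * α^2 := by
    rw [e1, Finset.sum_congr rfl e2, ← Finset.sum_sub_distrib, pow_two, ← mul_assoc, hα, Finset.mul_sum]
    refine norm_sum_le_of_le _ fun i hi => ?_
    have hA := (h i (Finset.mem_range.1 hi))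
    have hAi : IntegrableOn (A i) (Ioc p t) := hA.int.mono_set hsub
    have hAi' : IntegrableOn (A i) (Ioc p q) := hA.int.mono_set (Ioc_subset_Ioc hp hq)
    have hAs : IntegrableOn (fun s => c i x • A i s) (Ioc p t) := hAi.smul (c i x)
    rw [← integral_sub hAs (hi1 i hi), ← hα]
    refine (norm_integral_le_integral_norm _).trans ?_
    calc ∫ s in Ioc p t, ‖c i x • A i s - c i (x + pr (g s x)) • A i s‖ ≤ ∫ s in Ioc p t, L * α * ‖A i s‖ := by
          refine integral_mono (((hAi.smul (c i x)).sub (hi1 i hi)).norm) (hAi.norm.const_mul _) fun s => ?_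
          simp only []
          rw [← sub_smul, norm_smul]
          refine mul_le_mul_of_nonneg_right ((hA.lip _ _).trans (mul_le_mul_of_nonneg_left ?_ hL)) (norm_nonneg _)
          rw [sub_add_cancel_left, norm_neg]
          exact (norm_pr_le _).trans (h5 s x)
      _ = L * α * ∫ s in Ioc p t, ‖A i s‖ := integral_const_mul _ _
      _ ≤ L * α * ∫ s in Ioc p q, ‖A i s‖ := by
          refine mul_le_mul_of_nonneg_left ?_ (by positivity)
          exact setIntegral_mono_set hAi'.norm (Eventually.of_forall fun s => norm_nonneg _) 
            (Eventually.of_forall (Ioc_subset_Ioc_right ht))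
  have e4 := norm_add_le (g t x - ∑ i ∈ Finset.range N, c i x • prim (A i) p q t) 
    ((∑ i ∈ Finset.range N, c i x • prim (A i) p q t) - ∫ s in Ioc p t, Usum c A N s (x + pr (g s x)))
  rw [sub_add_sub_cancel] at e4
  linarith [h6 t x]

/-- approximate flow up to time `τ` -/
def FlowTo (c : ℕ → Torus d → ℝ) (A : ℕ → ℝ → Fin d → ℝ) (N : ℕ) (τ E : ℝ) : Prop :=
  ∃ g : ℝ → Torus d → Fin d → ℝ, Continuous (Function.uncurry g) ∧ 
      (∀ t, MeasurePreserving (fun x : Torus d => x + pr (g t x)) volume volume) ∧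
      (∀ t ≤ 0, ∀ x, g t x = 0) ∧ (∀ t, τ ≤ t → ∀ x, g t x = g τ x) ∧
      (∀ t ≤ τ, ∀ x, ‖g t x - ∫ s in Ioc 0 t, Usum c A N s (x + pr (g s x))‖ ≤ E)

lemma FlowTo.step {L : ℝ} (hL : 0 ≤ L) {c : ℕ → Torus d → ℝ} {A : ℕ → ℝ → Fin d → ℝ} {p q : ℝ} (hp : 0 ≤ p) (hpq : p ≤ q) (hq : q ≤ T) {N : ℕ}
    (h : ∀ i < N, Mode T L (c i) (A i)) {E : ℝ} (hE : 0 ≤ E) (H : FlowTo c A N p E) : 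
    FlowTo c A N q (E + 2 * L * (∑ i ∈ Finset.range N, ∫ s in Ioc p q, ‖A i s‖)^2) := by
  obtain ⟨g, g1, g2, g3, g4, g5⟩ := H
  obtain ⟨k, k1, k2, k3, k4, k5⟩ := block' hL hp hpq hq N h
  set α := ∑ i ∈ Finset.range N, ∫ s in Ioc p q, ‖A i s‖ with hα
  set g' : ℝ → Torus d → Fin d → ℝ := fun t x => g t x + k t (x + pr (g t x)) with hg'
  have c1 : Continuous (Function.uncurry g') := 
    g1.add (k1.comp (continuous_fst.prodMk (continuous_snd.add (continuous_pr.comp g1))))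
  have hlow : ∀ t ≤ p, ∀ x, g' t x = g t x := fun t ht x => by simp [hg', k3 t ht]
  have hup : ∀ t, p ≤ t → ∀ x, g' t x = g p x + k t (x + pr (g p x)) := fun t ht x => by
    simp only [hg']; rw [g4 t ht]
  refine ⟨g', c1, fun t => ?_, fun t ht x => ?_, fun t ht x => ?_, fun t ht x => ?_⟩
  · convert (k2 t).comp (g2 t) using 1
    funext x
    simp only [Function.comp, hg', pr_add, add_assoc]
  · rw [hlow t (ht.trans hp), g3 t ht]
  · rw [hup t (hpq.trans ht), hup q hpq, k4 t ht]
  · have hlowint : ∀ t ≤ p, ∫ s in Ioc 0 t, Usum c A N s (x + pr (g' s x)) = ∫ s in Ioc 0 t, Usum c A N s (x + pr (g s x)) := 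
      fun t ht => setIntegral_congr_fun measurableSet_Ioc fun s hs => by
        beta_reduce
        rw [hlow s (hs.2.trans ht)]
    rcases le_total t p with htp | htp
    · rw [hlow t htp, hlowint t htp]
      exact (g5 t htp x).trans (by have : 0 ≤ 2 * L * α^2 := by positivity
                                   linarith)
    · have hW : Continuous fun s => x + pr (g' s x) := 
        continuous_const.add (continuous_pr.comp (c1.comp (continuous_id.prodMk continuous_const)))
      have hU := U_int h hW
      have e1 : ∫ s in Ioc 0 t, Usum c A N s (x + pr (g' s x)) = (∫ s in Ioc 0 p, Usum c A N s (x + pr (g s x))) + 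
          ∫ s in Ioc p t, Usum c A N s ((x + pr (g p x)) + pr (k s (x + pr (g p x)))) := by
        rw [← hlowint p le_rfl, ← Ioc_union_Ioc_eq_Ioc hp htp, setIntegral_union _ measurableSet_Ioc 
          (hU.mono_set (Ioc_subset_Ioc_right (hpq.trans hq))) (hU.mono_set (Ioc_subset_Ioc hp (ht.trans hq)))]
        · congr 1
          refine setIntegral_congr_fun measurableSet_Ioc fun s hs => ?_
          beta_reduce
          rw [hup s hs.1.le, pr_add, add_assoc]
        · exact Set.disjoint_left.2 fun x hx hx' => absurd hx.2 (not_le.2 hx'.1)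
      rw [e1, hup t htp, add_sub_add_comm]
      exact (norm_add_le _ _).trans (add_le_add (g5 p le_rfl x) (k5 t ht _))

lemma FlowTo.zero (c : ℕ → Torus d → ℝ) (A : ℕ → ℝ → Fin d → ℝ) (N : ℕ) : FlowTo c A N 0 0 := by
  refine ⟨fun _ _ => 0, continuous_const, fun t => ?_, fun _ _ _ => rfl, fun _ _ _ => rfl, fun t ht x => ?_⟩
  · simp only [pr_zero, add_zero]
    exact MeasurePreserving.id _
  · rw [Ioc_eq_empty (not_lt.2 ht)]; simp

lemma exists_flow (hT : 0 ≤ T) {L : ℝ} (hL : 0 ≤ L) {c : ℕ → Torus d → ℝ} {A : ℕ → ℝ → Fin d → ℝ} {N : ℕ}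
    (h : ∀ i < N, Mode T L (c i) (A i)) {ε : ℝ} (hε : 0 < ε) : FlowTo c A N T ε := by
  set F : ℝ → ℝ := fun t => ∑ i ∈ Finset.range N, ∫ s in Ioc 0 t, ‖A i s‖ with hF
  have hFc : ContinuousOn F (Icc 0 T) := by
    refine continuousOn_finsetSum _ fun i hi => ?_
    exact intervalIntegral.continuousOn_primitive (by 
      rw [integrableOn_Icc_iff_integrableOn_Ioc]; exact (h i (Finset.mem_range.1 hi)).int.norm)
  have hFd : ∀ p q, 0 ≤ p → p ≤ q → q ≤ T → ∑ i ∈ Finset.range N, ∫ s in Ioc p q, ‖A i s‖ = F q - F p := by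
    intro p q hp hpq hq
    simp only [hF]
    rw [← Finset.sum_sub_distrib]
    refine Finset.sum_congr rfl fun i hi => ?_
    have hi' := (h i (Finset.mem_range.1 hi)).int.norm
    rw [← Ioc_union_Ioc_eq_Ioc hp hpq, setIntegral_union _ measurableSet_Ioc 
          (IntegrableOn.mono_set hi' (Ioc_subset_Ioc_right (hpq.trans hq))) (IntegrableOn.mono_set hi' (Ioc_subset_Ioc hp hq))]
    · ring
    · exact Set.disjoint_left.2 fun x hx hx' => absurd hx.2 (not_le.2 hx'.1)
  have hFnn : ∀ p q, 0 ≤ p → p ≤ q → q ≤ T → F p ≤ F q := fun p q hp hpq hq => by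
    have := hFd p q hp hpq hq
    have h2 : 0 ≤ ∑ i ∈ Finset.range N, ∫ s in Ioc p q, ‖A i s‖ := Finset.sum_nonneg fun i _ => integral_nonneg fun s => norm_nonneg _
    linarith
  have hF0 : F 0 = 0 := by simp [hF]
  have hFT : 0 ≤ F T := hF0 ▸ hFnn 0 T le_rfl hT le_rfl
  set δ := ε / (2 * L * F T + 1) with hδ
  have hδ0 : 0 < δ := by positivity
  have huc := isCompact_Icc.uniformContinuousOn_of_continuous hFc
  obtain ⟨r, hr, hr'⟩ := Metric.uniformContinuousOn_iff.1 huc δ hδ0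
  obtain ⟨M, hM⟩ := exists_nat_gt (T / r)
  have hMp : 0 < (M:ℝ) := lt_of_le_of_lt (by positivity) hM
  have hTM : T / M < r := by rw [div_lt_iff₀ hMp]; rwa [div_lt_iff₀' hr] at hM
  have key : ∀ j : ℕ, j ≤ M → FlowTo c A N (j * (T / M)) (2 * L * δ * F (j * (T / M))) := by
    intro j
    induction j with
    | zero => 
      intro _
      simp only [Nat.cast_zero, zero_mul, hF0, mul_zero]
      exact FlowTo.zero c A N
    | succ j ih =>
      intro hj
      have ih := ih (by omega)
      have hp : 0 ≤ j * (T / M) := by positivity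
      have hpq : j * (T / M) ≤ ((j + 1 : ℕ) : ℝ) * (T / M) := by gcongr; simp
      have hq : ((j + 1 : ℕ) : ℝ) * (T / M) ≤ T := by
        have : ((j + 1 : ℕ) : ℝ) ≤ M := by exact_mod_cast hj
        calc ((j + 1 : ℕ) : ℝ) * (T / M) ≤ M * (T / M) := by gcongr
          _ = T := by field_simp
      have h0 := hFnn 0 _ le_rfl hp (hpq.trans hq)
      rw [hF0] at h0
      have s := ih.step hL hp hpq hq h (by positivity)
      rw [hFd _ _ hp hpq hq] at s
      obtain ⟨g, g1, g2, g3, g4, g5⟩ := s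
      refine ⟨g, g1, g2, g3, g4, fun t ht x => (g5 t ht x).trans ?_⟩
      have d1 := hFnn _ _ hp hpq hq
      have d2 : F (((j + 1 : ℕ) : ℝ) * (T / M)) - F (j * (T / M)) ≤ δ := by
        have := hr' (((j + 1 : ℕ) : ℝ) * (T / M)) ⟨hp.trans hpq, hq⟩ (j * (T / M)) ⟨hp, hpq.trans hq⟩ (by
          rw [Real.dist_eq, ← sub_mul]
          push_cast
          rw [add_sub_cancel_left, one_mul, abs_of_nonneg (by positivity)]
          exact hTM)
        rw [Real.dist_eq] at this
        exact (le_abs_self _).trans this.le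
      set P := F (j * (T / M))
      set Q := F (((j + 1 : ℕ) : ℝ) * (T / M))
      have d3 : (Q - P)^2 ≤ δ * (Q - P) := by rw [pow_two]; exact mul_le_mul_of_nonneg_right d2 (by linarith)
      have d4 : 2 * L * (Q - P)^2 ≤ 2 * L * (δ * (Q - P)) := mul_le_mul_of_nonneg_left d3 (by positivity)
      nlinarith
  have hk := key M le_rfl
  have hMT : (M:ℝ) * (T / M) = T := by field_simp
  rw [hMT] at hk
  obtain ⟨g, g1, g2, g3, g4, g5⟩ := hk
  refine ⟨g, g1, g2, g3, g4, fun t ht x => (g5 t ht x).trans ?_⟩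
  rw [hδ, mul_div_assoc', div_mul_eq_mul_div, div_le_iff₀ (by positivity)]
  nlinarith

lemma U_meas {L : ℝ} {c : ℕ → Torus d → ℝ} {A : ℕ → ℝ → Fin d → ℝ} {N : ℕ}
    (h : ∀ i < N, Mode T L (c i) (A i)) : Measurable (Function.uncurry (Usum c A N)) := by
  have : Function.uncurry (Usum c A N) = fun q : ℝ × Torus d => ∑ i ∈ Finset.range N, c i q.2 • A i q.1 := rfl
  rw [this]
  refine Finset.measurable_fun_sum _ fun i hi => ?_
  have hi := h i (Finset.mem_range.1 hi)
  exact (hi.cont.measurable.comp measurable_snd).smul (hi.meas.comp measurable_fst)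

lemma exists_appr (hT : 0 ≤ T) {L : ℝ} (hL : 0 ≤ L) {c : ℕ → Torus d → ℝ} {A : ℕ → ℝ → Fin d → ℝ} {N : ℕ}
    (h : ∀ i < N, Mode T L (c i) (A i)) {ε : ℝ} (hε : 0 < ε) {b : ℝ → Torus d → Fin d → ℝ} 
    (hc : ∫⁻ s in Ioc 0 T, ∫⁻ x, ‖Usum c A N s x - b s x‖ₑ ≤ ENNReal.ofReal ε) : 
    ∃ β η, Appr hT b ε β η := by
  obtain ⟨g, g1, g2, g3, g4, g5⟩ := exists_flow hT hL h hε
  let G : C(Torus d, PathSpace T d) := ContinuousMap.curry ⟨fun q : Torus d × Icc (0:ℝ) T => q.1 + pr (g q.2 q.1), by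
    have h0 : Continuous fun q : Torus d × Icc (0:ℝ) T => ((q.2 : ℝ), q.1) := 
      (continuous_subtype_val.comp continuous_snd).prodMk continuous_fst
    exact continuous_fst.add (continuous_pr.comp (g1.comp h0))⟩
  have hG : ∀ x t, G x t = x + pr (g t x) := fun x t => rfl
  have hGe : ∀ x, ∀ s ∈ Ioc 0 T, extendPath hT (G x) s = x + pr (g s x) := fun x s hs => by
    rw [extendPath, projIcc_of_mem hT ⟨hs.1.le, hs.2⟩, hG]
  refine ⟨Usum c A N, Measure.map G volume, Measure.isProbabilityMeasure_map G.continuous.measurable.aemeasurable, fun t => ?_, 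
    U_meas h, hc, ?_⟩
  · rw [Measure.map_map (meas_e0 t) G.continuous.measurable]
    exact (g2 t).map_eq
  · have m : MeasurableSet (range G) := (isCompact_range G.continuous).isClosed.measurableSet
    filter_upwards [ae_map_mem_range G m volume] with γ hγ t
    obtain ⟨x, rfl⟩ := hγ
    have e1 : ∫ s in Ioc (0:ℝ) t, Usum c A N s (extendPath hT (G x) s) = ∫ s in Ioc (0:ℝ) t, Usum c A N s (x + pr (g s x)) := 
      setIntegral_congr_fun measurableSet_Ioc fun s hs => by
        beta_reduce
        rw [hGe x s ⟨hs.1, hs.2.trans t.2.2⟩]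
    rw [e1, hG, hG]
    have e2 := g5 t t.2.2 x
    have e3 : g 0 x = 0 := g3 0 le_rfl x
    simp only [e3, pr_zero, add_zero, add_sub_cancel_left]
    rw [← pr_sub]
    refine (enorm_pr_le _).trans ?_
    rw [← ofReal_norm]
    exact ENNReal.ofReal_le_ofReal e2

end

noncomputable section
set_option linter.unusedSectionVars false
variable {d : ℕ} {T : ℝ}

/-- the Fourier characters of the torus -/
def ek (k : Fin d → ℤ) (x : Torus d) : ℂ := UnitAddTorus.mFourier (d := Fin d) k x

lemma ek_cont (k : Fin d → ℤ) : Continuous (ek k) := (UnitAddTorus.mFourier k).continuous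

/-- the linear form `a ↦ k · a` -/
def kf (k : Fin d → ℤ) : (Fin d → ℝ) →L[ℝ] ℝ := ∑ i, (k i : ℝ) • ContinuousLinearMap.proj (R := ℝ) (φ := fun _ : Fin d => ℝ) i

lemma kf_apply (k : Fin d → ℤ) (a : Fin d → ℝ) : kf k a = ∑ i, (k i : ℝ) * a i := by
  simp [kf]

lemma ek_apply (k : Fin d → ℤ) (x : Torus d) : ek k x = ∏ i, (fourier (k i) (x i) : ℂ) := rfl

lemma ek_add (k : Fin d → ℤ) (x y : Torus d) : ek k (x + y) = ek k x * ek k y := by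
  simp only [ek_apply, ← Finset.prod_mul_distrib]
  refine Finset.prod_congr rfl fun i _ => ?_
  simp [fourier_apply, smul_add, AddCircle.toCircle_add]

lemma ek_pr (k : Fin d → ℤ) (a : Fin d → ℝ) : ek k (pr a) = Complex.exp (Complex.I * ((2 * Real.pi * kf k a : ℝ) : ℂ)) := by
  simp only [ek_apply, pr, fourier_coe_apply]
  rw [← Complex.exp_sum]
  congr 1
  rw [kf_apply]
  push_cast
  rw [Finset.mul_sum, Finset.mul_sum]
  refine Finset.sum_congr rfl fun i _ => ?_
  ring

lemma ek_norm (k : Fin d → ℤ) (x : Torus d) : ‖ek k x‖ = 1 := by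
  rw [← pr_lf x, ek_pr, mul_comm, Complex.norm_exp_ofReal_mul_I]

lemma ek_sub (k : Fin d → ℤ) (x y : Torus d) : ek k (x - y) = ek k x * (starRingEnd ℂ) (ek k y) := by
  have h : ek k (x - y) * ek k y = ek k x := by rw [← ek_add, sub_add_cancel]
  rw [← h, mul_assoc, Complex.mul_conj, Complex.normSq_eq_norm_sq, ek_norm]
  simp

/-- real modes -/
def cm (z : ℂ) (k : Fin d → ℤ) (x : Torus d) : ℝ := (z * ek k x).re

lemma cm_cont (z : ℂ) (k : Fin d → ℤ) : Continuous (cm z k) :=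
  Complex.continuous_re.comp (continuous_const.mul (ek_cont k))

lemma cm_bd (z : ℂ) (k : Fin d → ℤ) (x : Torus d) : |cm z k x| ≤ ‖z‖ := by
  refine (Complex.abs_re_le_norm _).trans ?_
  rw [norm_mul, ek_norm, mul_one]

lemma cm_inv (z : ℂ) (k : Fin d → ℤ) (a : Fin d → ℝ) (x : Torus d) (h : kf k a = 0) : cm z k (x + pr a) = cm z k x := by
  simp [cm, ek_add, ek_pr, h]

/-- Lipschitz constant -/
def Lk (k : Fin d → ℤ) : ℝ := 2 * Real.pi * ∑ i, |(k i : ℝ)|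

lemma Lk_nonneg (k : Fin d → ℤ) : 0 ≤ Lk k := by
  unfold Lk; have := Real.pi_pos; positivity

lemma cm_lip {z : ℂ} (hz : ‖z‖ ≤ 1) (k : Fin d → ℤ) (x y : Torus d) : |cm z k x - cm z k y| ≤ Lk k * ‖x - y‖ := by
  have h0 : cm z k x - cm z k y = (z * (ek k y * (ek k (x - y) - 1))).re := by
    rw [mul_sub, ← ek_add, add_sub_cancel, mul_one, mul_sub, Complex.sub_re]; rfl
  rw [h0]
  refine (Complex.abs_re_le_norm _).trans ?_
  rw [norm_mul, norm_mul, ek_norm, one_mul]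
  have h1 : ‖ek k (x - y) - 1‖ ≤ Lk k * ‖x - y‖ := by
    conv_lhs => rw [← pr_lf (x - y), ek_pr]
    refine Real.norm_exp_I_mul_ofReal_sub_one_le.trans ?_
    rw [← norm_lf, norm_mul, Lk, mul_assoc]
    rw [Real.norm_of_nonneg (by positivity)]
    refine mul_le_mul_of_nonneg_left ?_ (by positivity)
    rw [kf_apply, Finset.sum_mul]
    refine (norm_sum_le _ _).trans (Finset.sum_le_sum fun i _ => ?_)
    rw [norm_mul, Real.norm_eq_abs]
    exact mul_le_mul_of_nonneg_left (norm_le_pi_norm _ i) (abs_nonneg _)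
  calc _ ≤ 1 * ‖ek k (x - y) - 1‖ := mul_le_mul_of_nonneg_right hz (norm_nonneg _)
    _ ≤ _ := by rw [one_mul]; exact h1

lemma cm_pr (z : ℂ) (k : Fin d → ℤ) (a : Fin d → ℝ) : cm z k (pr a) = (z * Complex.exp (Complex.I * ((2 * Real.pi * kf k a : ℝ) : ℂ))).re := by
  rw [cm, ek_pr]

lemma cm_tst (z : ℂ) (k : Fin d → ℤ) : Tst (cm z k) := by
  have : (fun x : Fin d → ℝ => cm z k (pr x)) = fun x => Complex.reCLM (z * Complex.exp (Complex.I * Complex.ofRealCLM (2 * Real.pi * kf k x))) := by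
    funext x; rw [cm_pr]; rfl
  rw [Tst, this]
  have h1 : ContDiff ℝ ((⊤ : ℕ∞) : WithTop ℕ∞) fun x : Fin d → ℝ => 2 * Real.pi * kf k x := contDiff_const.mul (kf k).contDiff
  exact Complex.reCLM.contDiff.comp (contDiff_const.mul ((Complex.contDiff_exp (𝕜 := ℝ)).comp (contDiff_const.mul (Complex.ofRealCLM.contDiff.comp h1))))

lemma cm_dT (z : ℂ) (k : Fin d → ℤ) (y : Torus d) (i : Fin d) : dT (cm z k) y (Pi.single i 1) = 2 * Real.pi * k i * cm (z * Complex.I) k y := by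
  have h1 : HasDerivAt (fun θ : ℝ => (z * Complex.exp (Complex.I * (θ : ℂ))).re) ((z * Complex.I * ek k y).re) (2 * Real.pi * kf k (lf y)) := by
    have e : ek k y = Complex.exp (Complex.I * ((2 * Real.pi * kf k (lf y) : ℝ) : ℂ)) := by rw [← ek_pr, pr_lf]
    rw [e]
    set θ0 := 2 * Real.pi * kf k (lf y)
    have : HasDerivAt (fun θ : ℂ => z * Complex.exp (Complex.I * θ)) (z * Complex.I * Complex.exp (Complex.I * (θ0 : ℂ))) (θ0 : ℂ) := by
      have := (((hasDerivAt_id (θ0 : ℂ)).const_mul Complex.I).cexp).const_mul z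
      refine this.congr_deriv ?_
      simp; ring
    exact this.real_of_complex
  have h2 : HasFDerivAt (fun x : Fin d → ℝ => 2 * Real.pi * kf k x) ((2 * Real.pi) • kf k) (lf y) := (kf k).hasFDerivAt.const_mul _
  have h3 := HasDerivAt.comp_hasFDerivAt (lf y) h1 h2
  have h4 : dT (cm z k) y = (z * Complex.I * ek k y).re • ((2 * Real.pi) • kf k) := by
    rw [dT]
    have : (fun x : Fin d → ℝ => cm z k (pr x)) = (fun θ : ℝ => (z * Complex.exp (Complex.I * (θ : ℂ))).re) ∘ fun x => 2 * Real.pi * kf k x := by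
      funext x; rw [cm_pr]; rfl
    rw [this]; exact h3.fderiv
  rw [h4]
  simp only [_root_.smul_apply, kf_apply, smul_eq_mul, Pi.single_apply, mul_ite, mul_one, mul_zero, Finset.sum_ite_eq', Finset.mem_univ, if_true]
  rw [cm]; ring
end

noncomputable section
set_option linter.unusedSectionVars false
variable {d : ℕ} {T : ℝ}

/-- Fourier coefficient-like averages of `β` -/
def Am (β : ℝ → Torus d → Fin d → ℝ) (z : ℂ) (k : Fin d → ℤ) (t : ℝ) : Fin d → ℝ := ∫ y, cm z k y • β t y

lemma ae_int {β : ℝ → Torus d → Fin d → ℝ} (hβ : Measurable (Function.uncurry β))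
    (h1 : ∫⁻ t in Ioc 0 T, ∫⁻ x, ‖β t x‖ₑ < ⊤) : ∀ᵐ t ∂volume.restrict (Ioc 0 T), Integrable (β t) := by
  have m : Measurable fun t => ∫⁻ x, ‖β t x‖ₑ := Measurable.lintegral_prod_right' (f := fun p : ℝ × Torus d => ‖β p.1 p.2‖ₑ) hβ.enorm
  filter_upwards [ae_lt_top m h1.ne] with t ht
  exact ⟨(hβ.comp (measurable_prodMk_left (x := t))).aestronglyMeasurable, ht⟩

lemma Am_meas {β : ℝ → Torus d → Fin d → ℝ} (hβ : Measurable (Function.uncurry β)) (z : ℂ) (k : Fin d → ℤ) : Measurable (Am β z k) := by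
  have : Measurable fun p : ℝ × Torus d => cm z k p.2 • β p.1 p.2 := ((cm_cont z k).measurable.comp measurable_snd).smul hβ
  exact (this.stronglyMeasurable.integral_prod_right' (ν := (volume : Measure (Torus d)))).measurable

lemma Am_int {β : ℝ → Torus d → Fin d → ℝ} (hβ : Measurable (Function.uncurry β))
    (h1 : ∫⁻ t in Ioc 0 T, ∫⁻ x, ‖β t x‖ₑ < ⊤) (z : ℂ) (k : Fin d → ℤ) : IntegrableOn (Am β z k) (Ioc 0 T) := by
  refine ⟨(Am_meas hβ z k).aestronglyMeasurable, ?_⟩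
  refine lt_of_le_of_lt (b := ∫⁻ t in Ioc 0 T, ‖z‖ₑ * ∫⁻ x, ‖β t x‖ₑ) (lintegral_mono fun t => ?_) ?_
  · refine (enorm_integral_le_lintegral_enorm _).trans ?_
    rw [← lintegral_const_mul' _ _ (by simp)]
    refine lintegral_mono fun y => ?_
    rw [enorm_smul]
    gcongr
    rw [← ofReal_norm, ← ofReal_norm]
    exact ENNReal.ofReal_le_ofReal (cm_bd z k y)
  · rw [lintegral_const_mul' _ _ (by simp)]
    exact ENNReal.mul_lt_top (by simp) h1

lemma cm_smul_int {v : Torus d → Fin d → ℝ} (hv : Integrable v) (z : ℂ) (k : Fin d → ℤ) : Integrable fun y => cm z k y • v y :=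
  hv.bdd_smul ‖z‖ (cm_cont z k).aestronglyMeasurable (Eventually.of_forall fun y => cm_bd z k y)

lemma kf_zero {v : Torus d → Fin d → ℝ} (hv : Integrable v) (hdiv : ∀ ψ, Tst ψ → ∫ x, ∑ i, v x i * dT ψ x (Pi.single i 1) = 0)
    (z : ℂ) (k : Fin d → ℤ) : kf k (∫ y, cm z k y • v y) = 0 := by
  rw [← ContinuousLinearMap.integral_comp_comm _ (cm_smul_int hv z k)]
  have h := hdiv _ (cm_tst (-(Complex.I * z)) k)
  simp only [cm_dT] at h
  have e : -(Complex.I * z) * Complex.I = z := by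
    linear_combination (-z) * Complex.I_mul_I
  rw [e] at h
  have : ∀ x, ∑ i, v x i * (2 * Real.pi * k i * cm z k x) = (2 * Real.pi) * kf k (cm z k x • v x) := by
    intro x
    rw [kf_apply, Finset.mul_sum]
    refine Finset.sum_congr rfl fun i _ => ?_
    simp only [Pi.smul_apply, smul_eq_mul]; ring
  simp only [this] at h
  rw [integral_const_mul] at h
  have := Real.pi_pos
  rcases mul_eq_zero.1 h with h | h
  · linarith
  · exact h

/-- standing hypotheses on the field -/
structure Fld (T : ℝ) (β : ℝ → Torus d → Fin d → ℝ) : Prop where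
  meas : Measurable (Function.uncurry β)
  l1 : ∫⁻ t in Ioc 0 T, ∫⁻ x, ‖β t x‖ₑ < ⊤
  div : ∀ᵐ t ∂volume.restrict (Ioc 0 T), ∀ ψ, Tst ψ → ∫ x, ∑ i, β t x i * dT ψ x (Pi.single i 1) = 0

lemma Fld.mode {β : ℝ → Torus d → Fin d → ℝ} (h : Fld T β) {w : ℂ} (hw : ‖w‖ ≤ 1) (z : ℂ) (k : Fin d → ℤ) :
    Mode T (Lk k) (cm w k) (Am β z k) where
  meas := Am_meas h.meas z k
  int := Am_int h.meas h.l1 z k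
  bd := fun x => (cm_bd w k x).trans hw
  lip := cm_lip hw k
  inv := by
    refine ⟨kf k, ?_, fun a x ha => cm_inv w k a x ha⟩
    filter_upwards [h.div, ae_int h.meas h.l1] with t ht hi
    exact kf_zero hi ht z k

/-- convolution with `p` is realised by finitely many modes -/
def Q (T : ℝ) (β : ℝ → Torus d → Fin d → ℝ) (p : C(Torus d, ℂ)) : Prop :=
  ∃ L : ℝ, 0 ≤ L ∧ ∃ (N : ℕ) (c : ℕ → Torus d → ℝ) (A : ℕ → ℝ → Fin d → ℝ), (∀ i < N, Mode T L (c i) (A i)) ∧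
    ∀ᵐ t ∂volume.restrict (Ioc 0 T), ∀ x, Usum c A N t x = ∫ y, (p (x - y)).re • β t y

lemma Mode.mono {L L' : ℝ} (hL : L ≤ L') {c : Torus d → ℝ} {A : ℝ → Fin d → ℝ} (h : Mode T L c A) : Mode T L' c A :=
  { h with lip := fun x y => (h.lip x y).trans (mul_le_mul_of_nonneg_right hL (norm_nonneg _)) }

lemma conv_int {v : Torus d → Fin d → ℝ} (hv : Integrable v) (p : C(Torus d, ℂ)) (x : Torus d) : Integrable fun y => (p (x - y)).re • v y := by
  refine hv.bdd_smul (φ := fun y => (p (x - y)).re) ‖p‖ ?_ (Eventually.of_forall fun y => ?_)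
  · exact (Complex.continuous_re.comp (p.continuous.comp (continuous_const.sub continuous_id))).aestronglyMeasurable
  · exact (Complex.abs_re_le_norm _).trans (p.norm_coe_le_norm _)

lemma Q.zero {β : ℝ → Torus d → Fin d → ℝ} : Q T β 0 := by
  refine ⟨0, le_rfl, 0, fun _ _ => 0, fun _ _ => 0, by simp, Eventually.of_forall fun t x => by simp [Usum]⟩

lemma Q.add {β : ℝ → Torus d → Fin d → ℝ} (h : Fld T β) {p q : C(Torus d, ℂ)} (hp : Q T β p) (hq : Q T β q) : Q T β (p + q) := by
  obtain ⟨L, hL, N, c, A, hm, he⟩ := hp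
  obtain ⟨L', hL', N', c', A', hm', he'⟩ := hq
  refine ⟨max L L', hL.trans (le_max_left _ _), N + N', fun i => if i < N then c i else c' (i - N), fun i => if i < N then A i else A' (i - N), ?_, ?_⟩
  · intro i hi
    by_cases hiN : i < N
    · simp only [hiN, if_true]; exact (hm i hiN).mono (le_max_left _ _)
    · simp only [hiN, if_false]; exact (hm' _ (by omega)).mono (le_max_right _ _)
  · filter_upwards [he, he', ae_int h.meas h.l1] with t ht ht' hi x
    have : ∀ y, ((p + q) (x - y)).re • β t y = (p (x - y)).re • β t y + (q (x - y)).re • β t y := by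
      intro y; rw [← add_smul]; simp
    simp only [this]
    rw [integral_add (conv_int hi p x) (conv_int hi q x), ← ht x, ← ht' x, Usum, Finset.sum_range_add, Usum, Usum]
    congr 1
    · refine Finset.sum_congr rfl fun i hi => ?_
      rw [if_pos (Finset.mem_range.1 hi), if_pos (Finset.mem_range.1 hi)]
    · refine Finset.sum_congr rfl fun i hi => ?_
      simp

lemma Q.ek {β : ℝ → Torus d → Fin d → ℝ} (h : Fld T β) (z : ℂ) (k : Fin d → ℤ) : Q T β (z • UnitAddTorus.mFourier k) := by
  refine ⟨Lk k, Lk_nonneg k, 2, fun i => if i = 0 then cm 1 k else cm Complex.I k, 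
    fun i => if i = 0 then Am β ((starRingEnd ℂ) z) k else Am β (Complex.I * (starRingEnd ℂ) z) k, ?_, ?_⟩
  · intro i _
    by_cases hi : i = 0
    · simp only [hi, if_true]; exact h.mode (by simp) _ _
    · simp only [hi, if_false]; exact h.mode (by simp) _ _
  · filter_upwards [ae_int h.meas h.l1] with t hi x
    have : ∀ y, ((z • UnitAddTorus.mFourier k : C(Torus d, ℂ)) (x - y)).re • β t y = 
        cm 1 k x • (cm ((starRingEnd ℂ) z) k y • β t y) + cm Complex.I k x • (cm (Complex.I * (starRingEnd ℂ) z) k y • β t y) := by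
      intro y
      have e : ((z • UnitAddTorus.mFourier k : C(Torus d, ℂ)) (x - y)).re = (z * _root_.ek k (x - y)).re := rfl
      rw [e, smul_smul, smul_smul, ← add_smul, ek_sub]
      congr 1
      simp only [cm, Complex.mul_re, Complex.mul_im, Complex.conj_re, Complex.conj_im, Complex.I_re, Complex.I_im, Complex.one_re, Complex.one_im]
      ring
    simp only [this]
    have i1 : Integrable fun y => cm 1 k x • (cm ((starRingEnd ℂ) z) k y • β t y) := by
      have := (cm_smul_int hi ((starRingEnd ℂ) z) k).smul (cm 1 k x : ℝ)
      exact this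
    have i2 : Integrable fun y => cm Complex.I k x • (cm (Complex.I * (starRingEnd ℂ) z) k y • β t y) := by
      have := (cm_smul_int hi (Complex.I * (starRingEnd ℂ) z) k).smul (cm Complex.I k x : ℝ)
      exact this
    rw [integral_add i1 i2, integral_smul, integral_smul]
    simp [Usum, Finset.sum_range_succ, Am]

lemma Q.all {β : ℝ → Torus d → Fin d → ℝ} (h : Fld T β) {p : C(Torus d, ℂ)} 
    (hp : p ∈ Submodule.span ℂ (Set.range (UnitAddTorus.mFourier (d := Fin d)))) : ∀ z : ℂ, Q T β (z • p) := by
  induction hp using Submodule.span_induction with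
  | mem p hp => obtain ⟨k, rfl⟩ := hp; exact fun z => Q.ek h z k
  | zero => intro z; rw [smul_zero]; exact Q.zero
  | add p q _ _ hp hq => intro z; rw [show z • (p + q) = z • p + z • q by ext x; simp [mul_add]]; exact (hp z).add h (hq z)
  | smul a p _ hp => intro z; rw [show z • (a • p) = (z * a) • p by ext x; simp [mul_assoc]]; exact hp _

lemma exists_Q {β : ℝ → Torus d → Fin d → ℝ} (h : Fld T β) {κ : Torus d → ℝ} (hκ : Continuous κ) {δ : ℝ} (hδ : 0 < δ) :
    ∃ p : C(Torus d, ℂ), Q T β p ∧ ∀ x, |(p x).re - κ x| ≤ δ := by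
  have hd := UnitAddTorus.span_mFourier_closure_eq_top (d := Fin d)
  set f : C(Torus d, ℂ) := ⟨fun x => (κ x : ℂ), Complex.continuous_ofReal.comp hκ⟩ with hf
  have hfm : f ∈ (Submodule.span ℂ (Set.range (UnitAddTorus.mFourier (d := Fin d)))).topologicalClosure := by
    rw [hd]; trivial
  have hfc : f ∈ closure (Submodule.span ℂ (Set.range (UnitAddTorus.mFourier (d := Fin d))) : Set C(Torus d, ℂ)) := hfm
  obtain ⟨p, hp, hpd⟩ := Metric.mem_closure_iff.1 hfc δ hδ
  refine ⟨p, by simpa using Q.all h hp 1, fun x => ?_⟩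
  have : (p x).re - κ x = (p x - f x).re := by simp [hf]
  rw [this]
  refine (Complex.abs_re_le_norm _).trans ?_
  rw [← dist_eq_norm, dist_comm]
  exact (ContinuousMap.dist_apply_le_dist x).trans hpd.le
end

noncomputable section
set_option linter.unusedSectionVars false
variable {d : ℕ} {T : ℝ}

instance torusNeg (d : ℕ) : (volume : Measure (Torus d)).IsNegInvariant := Measure.IsAddHaarMeasure.isNegInvariant_of_regular _

lemma enorm_le_sum (v : Fin d → ℝ) : ‖v‖ₑ ≤ ∑ j, ‖v j‖ₑ := by
  simp only [← ofReal_norm]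
  rw [← ENNReal.ofReal_sum_of_nonneg (fun _ _ => norm_nonneg _)]
  refine ENNReal.ofReal_le_ofReal ?_
  rw [pi_norm_le_iff_of_nonneg (Finset.sum_nonneg fun _ _ => norm_nonneg _)]
  intro i
  exact Finset.single_le_sum (f := fun i => ‖v i‖) (fun _ _ => norm_nonneg _) (Finset.mem_univ i)

lemma tendsto_translate_vec {v : Torus d → Fin d → ℝ} (mv : Measurable v) (hv : Integrable v) :
    Tendsto (fun w => ∫⁻ x, ‖v (x - w) - v x‖ₑ) (𝓝 0) (𝓝 0) := by
  have hn : Tendsto (fun w : Torus d => -w) (𝓝 0) (𝓝 0) := by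
    have := (continuous_neg (G := Torus d)).tendsto 0
    rwa [neg_zero] at this
  have h1 : Tendsto (fun w : Torus d => ∑ j, ∫⁻ x, ‖v (x + -w) j - v x j‖ₑ) (𝓝 0) (𝓝 0) := by
    have : Tendsto (fun w : Torus d => ∑ j, ∫⁻ x, ‖v (x + -w) j - v x j‖ₑ) (𝓝 0) (𝓝 (∑ _j : Fin d, 0)) := by
      refine tendsto_finsetSum _ fun j _ => ?_
      have hvj : Integrable (fun x => v x j) := hv.eval j
      exact (tendsto_translate hvj).comp hn
    simpa using this
  refine tendsto_of_tendsto_of_tendsto_of_le_of_le tendsto_const_nhds h1 (fun _ => zero_le) fun w => ?_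
  beta_reduce
  have mw : Measurable fun x : Torus d => v (x - w) := mv.comp (measurable_id.sub_const w)
  rw [← lintegral_finsetSum _ fun j _ => ?_]
  · refine lintegral_mono fun x => ?_
    simp only [← sub_eq_add_neg]
    exact enorm_le_sum _
  · simp only [← sub_eq_add_neg]
    exact (((measurable_pi_apply j).comp mw).sub ((measurable_pi_apply j).comp mv)).enorm

/-- the mollification error -/
def Gerr (κ : Torus d → ℝ) (v : Torus d → Fin d → ℝ) : ℝ≥0∞ := ∫⁻ w, ENNReal.ofReal (κ w) * ∫⁻ x, ‖v (x - w) - v x‖ₑ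

lemma tendsto_Gerr {v : Torus d → Fin d → ℝ} (mv : Measurable v) (hv : Integrable v) {ρ : (Fin d → ℝ) → ℝ} (hρ : Adm ρ) :
    Tendsto (fun n => Gerr (kap (eps n) ρ) v) atTop (𝓝 0) := by
  obtain ⟨R, R0, hR⟩ := hρ.exists_R
  rw [ENNReal.tendsto_nhds_zero]
  intro δ hδ
  have ht := (ENNReal.tendsto_nhds_zero.1 (tendsto_translate_vec mv hv)) δ hδ
  rw [Metric.eventually_nhds_iff] at ht
  obtain ⟨r, r0, hr⟩ := ht
  filter_upwards [(tendsto_eps_mul R).eventually (gt_mem_nhds (show (0:ℝ) < min r (1/2) by positivity))] with n hn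
  have hn1 : eps n * R < 1/2 := hn.trans_le (min_le_right _ _)
  have hn2 : eps n * R < r := hn.trans_le (min_le_left _ _)
  calc _ ≤ ∫⁻ w : Torus d, ENNReal.ofReal (kap (eps n) ρ w) * δ := by
        refine lintegral_mono fun w => ?_
        by_cases hw : ‖w‖ < r
        · gcongr
          exact hr (by simpa using hw)
        · have : kap (eps n) ρ w = 0 := by
            rw [kap, (hR _ _).1, mul_zero]
            rw [norm_smul, norm_inv, Real.norm_of_nonneg (eps_pos n).le, norm_lf, le_inv_mul_iff₀ (eps_pos n)]
            push Not at hw; exact hn2.le.trans hw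
          simp [this]
    _ = δ := by
        rw [lintegral_mul_const _ (measurable_kap hρ _).ennreal_ofReal, 
          lintegral_kap hρ (eps_pos n) hn1 hR, one_mul]

lemma Gerr_le {v : Torus d → Fin d → ℝ} (mv : Measurable v) {κ : Torus d → ℝ} (mκ : Measurable κ) (h1 : ∫⁻ w, ENNReal.ofReal (κ w) = 1) :
    Gerr κ v ≤ 2 * ∫⁻ x, ‖v x‖ₑ := by
  calc _ ≤ ∫⁻ w, ENNReal.ofReal (κ w) * (2 * ∫⁻ x, ‖v x‖ₑ) := by
        refine lintegral_mono fun w => ?_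
        gcongr
        have mw : Measurable fun x : Torus d => ‖v (x - w)‖ₑ := (mv.comp (measurable_id.sub_const w)).enorm
        calc _ ≤ ∫⁻ x, (‖v (x - w)‖ₑ + ‖v x‖ₑ) := lintegral_mono fun x => enorm_sub_le
          _ = _ := by rw [lintegral_add_left mw, lintegral_sub_right_eq_self (fun x => ‖v x‖ₑ) w, two_mul]
    _ = _ := by rw [lintegral_mul_const _ mκ.ennreal_ofReal, h1, one_mul]

lemma conv_err {v : Torus d → Fin d → ℝ} (mv : Measurable v) (hv : Integrable v) {κ : Torus d → ℝ} (cκ : Continuous κ) (κ0 : ∀ w, 0 ≤ κ w)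
    (h1 : ∫⁻ w, ENNReal.ofReal (κ w) = 1) (p : C(Torus d, ℂ)) {δ : ℝ} (hp : ∀ x, |(p x).re - κ x| ≤ δ) :
    ∫⁻ x, ‖(∫ y, (p (x - y)).re • v y) - v x‖ₑ ≤ ENNReal.ofReal δ * (∫⁻ x, ‖v x‖ₑ) + Gerr κ v := by
  have iκ : Integrable κ := by
    refine ⟨cκ.aestronglyMeasurable, ?_⟩
    rw [hasFiniteIntegral_iff_ofReal (Eventually.of_forall κ0), h1]; exact ENNReal.one_lt_top
  have eκ : ∫ w, κ w = 1 := by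
    rw [integral_eq_lintegral_of_nonneg_ae (Eventually.of_forall κ0) cκ.aestronglyMeasurable, h1]; simp
  have msub : Measurable fun q : Torus d × Torus d => v (q.1 - q.2) := mv.comp (measurable_fst.sub measurable_snd)
  have mk : Measurable fun q : Torus d × Torus d => ENNReal.ofReal (κ q.2) := (cκ.measurable.comp measurable_snd).ennreal_ofReal
  have key : ∀ x, ‖(∫ y, (p (x - y)).re • v y) - v x‖ₑ ≤ ∫⁻ w, (ENNReal.ofReal δ * ‖v (x - w)‖ₑ + ENNReal.ofReal (κ w) * ‖v (x - w) - v x‖ₑ) := by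
    intro x
    have i1 : Integrable fun w => (p w).re • v (x - w) := by
      have := (conv_int hv p x).comp_sub_left x
      simpa using this
    have i2 : Integrable fun w => κ w • v x := iκ.smul_const _
    have e1 : ∫ y, (p (x - y)).re • v y = ∫ w, (p w).re • v (x - w) := by
      rw [← integral_sub_left_eq_self (fun y => (p (x - y)).re • v y) volume x]
      simp
    have e2 : v x = ∫ w, κ w • v x := by rw [integral_smul_const, eκ, one_smul]
    have e3 : (∫ y, (p (x - y)).re • v y) - v x = ∫ w, ((p w).re • v (x - w) - κ w • v x) := by
      rw [integral_sub i1 i2, ← e2, e1]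
    rw [e3]
    refine (enorm_integral_le_lintegral_enorm _).trans (lintegral_mono fun w => ?_)
    have e4 : (p w).re • v (x - w) - κ w • v x = ((p w).re - κ w) • v (x - w) + κ w • (v (x - w) - v x) := by
      rw [sub_smul, smul_sub]; abel
    rw [e4]
    refine (enorm_add_le _ _).trans ?_
    rw [enorm_smul, enorm_smul, Real.enorm_eq_ofReal (κ0 w)]
    gcongr
    rw [← ofReal_norm]; exact ENNReal.ofReal_le_ofReal (hp w)
  refine (lintegral_mono key).trans ?_
  have m1 : Measurable fun q : Torus d × Torus d => ENNReal.ofReal δ * ‖v (q.1 - q.2)‖ₑ := msub.enorm.const_mul _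
  have m2 : Measurable fun q : Torus d × Torus d => ENNReal.ofReal (κ q.2) * ‖v (q.1 - q.2) - v q.1‖ₑ := 
    mk.mul (msub.sub (mv.comp measurable_fst)).enorm
  have s1 : ∀ x, ∫⁻ w, (ENNReal.ofReal δ * ‖v (x - w)‖ₑ + ENNReal.ofReal (κ w) * ‖v (x - w) - v x‖ₑ) = 
      ENNReal.ofReal δ * (∫⁻ y, ‖v y‖ₑ) + ∫⁻ w, ENNReal.ofReal (κ w) * ‖v (x - w) - v x‖ₑ := by
    intro x
    have mw : Measurable fun w : Torus d => ENNReal.ofReal δ * ‖v (x - w)‖ₑ := by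
      have m0 : Measurable fun w : Torus d => v (x - w) := mv.comp (measurable_id.const_sub x)
      exact m0.enorm.const_mul _
    rw [lintegral_add_left mw, lintegral_const_mul' _ _ ENNReal.ofReal_ne_top, lintegral_sub_left_eq_self (fun y => ‖v y‖ₑ) x]
  simp only [s1]
  rw [lintegral_add_left measurable_const, lintegral_const, measure_univ, mul_one]
  gcongr
  rw [lintegral_lintegral_swap m2.aemeasurable, Gerr]
  refine lintegral_mono fun w => ?_
  rw [lintegral_const_mul' _ _ ENNReal.ofReal_ne_top]

lemma Gerr_meas {β : ℝ → Torus d → Fin d → ℝ} (hβ : Measurable (Function.uncurry β)) {κ : Torus d → ℝ} (mκ : Measurable κ) :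
    Measurable fun t => Gerr κ (β t) := by
  have ma : Measurable fun q : (ℝ × Torus d) × Torus d => β q.1.1 (q.2 - q.1.2) := 
    hβ.comp ((measurable_fst.comp measurable_fst).prodMk (measurable_snd.sub (measurable_snd.comp measurable_fst)))
  have mb : Measurable fun q : (ℝ × Torus d) × Torus d => β q.1.1 q.2 := 
    hβ.comp ((measurable_fst.comp measurable_fst).prodMk measurable_snd)
  have mab : Measurable fun q : (ℝ × Torus d) × Torus d => ‖β q.1.1 (q.2 - q.1.2) - β q.1.1 q.2‖ₑ := (ma.sub mb).enorm
  have mc : Measurable fun q : ℝ × Torus d => ∫⁻ x, ‖β q.1 (x - q.2) - β q.1 x‖ₑ := mab.lintegral_prod_right'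
  have md : Measurable fun q : ℝ × Torus d => ENNReal.ofReal (κ q.2) * ∫⁻ x, ‖β q.1 (x - q.2) - β q.1 x‖ₑ := 
    ((mκ.comp measurable_snd).ennreal_ofReal).mul mc
  exact md.lintegral_prod_right'

lemma tendsto_int_Gerr {β : ℝ → Torus d → Fin d → ℝ} (h : Fld T β) {ρ : (Fin d → ℝ) → ℝ} (hρ : Adm ρ) :
    Tendsto (fun n => ∫⁻ t in Ioc 0 T, Gerr (kap (eps n) ρ) (β t)) atTop (𝓝 0) := by
  obtain ⟨R, R0, hR⟩ := hρ.exists_R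
  have key := tendsto_lintegral_filter_of_dominated_convergence (μ := volume.restrict (Ioc 0 T)) (l := atTop) (F := fun n t => Gerr (kap (eps n) ρ) (β t)) (f := fun _ => 0)
    (fun t => 2 * ∫⁻ x, ‖β t x‖ₑ) (Eventually.of_forall fun n => Gerr_meas h.meas (measurable_kap hρ _)) ?_ ?_ ?_
  · simpa using key
  · filter_upwards [(tendsto_eps_mul R).eventually (gt_mem_nhds (show (0:ℝ) < 1/2 by positivity))] with n hn
    exact Eventually.of_forall fun t => Gerr_le (h.meas.comp (measurable_prodMk_left (x := t))) (measurable_kap hρ _) (lintegral_kap hρ (eps_pos n) hn hR)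
  · rw [lintegral_const_mul' _ _ (by simp)]
    exact ENNReal.mul_ne_top (by simp) h.l1.ne
  · filter_upwards [ae_int h.meas h.l1] with t ht
    exact tendsto_Gerr (h.meas.comp (measurable_prodMk_left (x := t))) ht hρ

lemma Fld.appr {β : ℝ → Torus d → Fin d → ℝ} (hT : 0 ≤ T) (h : Fld T β) {ε : ℝ} (hε : 0 < ε) : ∃ β' η, Appr hT β ε β' η := by
  obtain ⟨ρ, hρ⟩ := exists_Adm d
  obtain ⟨R, R0, hR⟩ := hρ.exists_R
  have h1 := (ENNReal.tendsto_nhds_zero.1 (tendsto_int_Gerr h hρ)) (ENNReal.ofReal (ε / 2)) (by simp; positivity)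
  obtain ⟨n, hn1, hn⟩ := (h1.and ((tendsto_eps_mul R).eventually (gt_mem_nhds (show (0:ℝ) < 1/2 by positivity)))).exists
  set M := (∫⁻ t in Ioc 0 T, ∫⁻ x, ‖β t x‖ₑ).toReal with hM
  have eM : ∫⁻ t in Ioc 0 T, ∫⁻ x, ‖β t x‖ₑ = ENNReal.ofReal M := (ENNReal.ofReal_toReal h.l1.ne).symm
  have M0 : 0 ≤ M := ENNReal.toReal_nonneg
  set δ := ε / (2 * (M + 1)) with hδ
  have δ0 : 0 < δ := by positivity
  have cκ := (TC1_kap hρ (eps_pos n) hn hR).1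
  obtain ⟨p, ⟨L, hL, N, c, A, hm, he⟩, hp⟩ := exists_Q h cκ δ0
  refine exists_appr hT hL hm hε ?_
  have mG := Gerr_meas h.meas (measurable_kap hρ (eps n))
  calc _ ≤ ∫⁻ t in Ioc 0 T, (ENNReal.ofReal δ * (∫⁻ x, ‖β t x‖ₑ) + Gerr (kap (eps n) ρ) (β t)) := by
        refine lintegral_mono_ae ?_
        filter_upwards [he, ae_int h.meas h.l1] with t ht hi
        simp only [ht]
        exact conv_err (h.meas.comp (measurable_prodMk_left (x := t))) hi cκ (kap_nonneg hρ (eps_pos n)) (lintegral_kap hρ (eps_pos n) hn hR) p hp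
    _ = ENNReal.ofReal δ * ENNReal.ofReal M + ∫⁻ t in Ioc 0 T, Gerr (kap (eps n) ρ) (β t) := by
        rw [lintegral_add_right _ mG, lintegral_const_mul' _ _ ENNReal.ofReal_ne_top, eM]
    _ ≤ ENNReal.ofReal (ε / 2) + ENNReal.ofReal (ε / 2) := by
        gcongr
        rw [← ENNReal.ofReal_mul δ0.le]
        refine ENNReal.ofReal_le_ofReal ?_
        rw [hδ, div_mul_eq_mul_div, div_le_div_iff₀ (by positivity) (by positivity)]
        nlinarith
    _ = ENNReal.ofReal ε := by rw [← ENNReal.ofReal_add (by positivity) (by positivity), add_halves]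
end

noncomputable section
set_option linter.unusedSectionVars false
variable {d : ℕ} {T : ℝ}

lemma fld_of {b : ℝ → Torus d → Vec d} (hb : Measurable (Function.uncurry b)) (hdiv : DivergenceFree T d b)
    (hbL1 : ∫⁻ t in Set.Ioo 0 T, ∫⁻ x, (‖b t x‖₊ : ℝ≥0∞) ∂(volume : Measure (Torus d)) < ∞) : Fld T (bet b) where
  meas := meas_bet hb
  l1 := l1_bet hbL1
  div := by
    rw [← Measure.restrict_congr_set (Ioo_ae_eq_Ioc (μ := volume) (a := (0:ℝ)) (b := T))]
    filter_upwards [hdiv] with t ht ψ hψ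
    have := ht (fun x => ψ (projT d x)) hψ.contDiff_projT (fun x y hxy => by simp [hxy])
    rw [← this]
    simp only [fderiv_projT hψ.tc1]
    symm
    have mu : Measurable fun x => bet b t x := (meas_bet hb).comp (measurable_prodMk_left (x := t))
    refine unit_integral (F := fun x => ∑ i, bet b t x i * dT ψ x (Pi.single i 1)) ?_
    exact Finset.measurable_sum _ fun i _ => ((measurable_pi_apply i).comp mu).mul 
      (meas_clm_apply (measurable_dT ψ) measurable_const)
end

/-- for a divergence-free field `b ∈ L¹_loc([0,T); BV) ∩ L¹`, there is a
unique incompressible probability measure `η` concentrated on integral curves of `b`;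
moreover its disintegration at time `0` is a.e. given by Dirac masses on a Borel family
of paths. -/
theorem stmt_16 (T : ℝ) (hT : 0 < T) (d : ℕ) (b : ℝ → Torus d → Vec d)
    (hb : Measurable (Function.uncurry b))
    (hdiv : DivergenceFree T d b)
    (hBV : MemL1locBVIco T d b)
    (hbL1 : ∫⁻ t in Set.Ioo 0 T, ∫⁻ x, (‖b t x‖₊ : ℝ≥0∞) ∂(volume : Measure (Torus d)) < ∞) :
    (∃! η : Measure (PathSpace T d),
      IsProbabilityMeasure η ∧
      ConcentratedOnCurves hT.le b η ∧
      ∀ t : Set.Icc (0 : ℝ) T,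
        Measure.map (fun γ : PathSpace T d => γ t) η = (volume : Measure (Torus d))) ∧
    ∀ η : Measure (PathSpace T d),
      (IsProbabilityMeasure η ∧
        ConcentratedOnCurves hT.le b η ∧
        ∀ t : Set.Icc (0 : ℝ) T,
          Measure.map (fun γ : PathSpace T d => γ t) η = (volume : Measure (Torus d))) →
      ∃ γY : Torus d → PathSpace T d, Measurable γY ∧
        ∀ k : Torus d → Measure (PathSpace T d),
          IsProbDisintegration η
            (fun γ : PathSpace T d => γ ⟨0, Set.left_mem_Icc.2 hT.le⟩)
            (volume : Measure (Torus d)) k →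
          ∀ᵐ y ∂(volume : Measure (Torus d)), k y = Measure.dirac (γY y) := by
  have hS : ∀ T', 0 ≤ T' → T' < T → SmallComm T' (bet b) := fun T' h0 h1 => smallComm hb hdiv hBV hbL1 h0 h1
  obtain ⟨η, hη⟩ := exists_valid hT hb hbL1 (fun ε hε => (fld_of hb hdiv hbL1).appr hT.le hε)
  refine ⟨⟨η, hη, fun η' h' => ?_⟩, fun η' h' => ?_⟩
  · exact Valid.unique (hT := hT) h' hη hb hbL1 hS
  · exact Valid.disint (hT := hT) h' hb hbL1 hS
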